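/- Let k be a field of characteristic zero, X an r × s matrix of indeterminates with r < s, R = k[X], and I = I_r(X) the ideal of maximal minors. Then H^i_I(R) ≠ 0 if and only if i = (r−t)(s−r) + 1 for some integer t with 0 ≤ t < r. -/

import Mathlib

/-- The ideal of `t × t` minors of a matrix over a commutative ring. -/
noncomputable def minorsIdeal {T α β : Type*} [CommRing T] (M : Matrix α β T) (t : ℕ) :
    Ideal T :=
  Ideal.span (Set.range fun p : (Fin t ↪ α) × (Fin t ↪ β) =>
    (M.submatrix (⇑p.1) (⇑p.2)).det)

/-- The polynomial ring `R = k[X]` in the entries of an `r × s` matrix `X` of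
indeterminates. -/
abbrev detPolyRing (k : Type) [Field k] (r s : ℕ) : Type := MvPolynomial (Fin r × Fin s) k

/-- The generic `r × s` matrix `X` of indeterminates. -/
noncomputable abbrev genericMatrix (k : Type) [Field k] (r s : ℕ) :
    Matrix (Fin r) (Fin s) (detPolyRing k r s) :=
  Matrix.of fun i j => MvPolynomial.X (i, j)

set_option linter.unusedSectionVars false

namespace KoszulColim

variable {ι R M : Type*} [LinearOrder ι] [CommRing R] [AddCommGroup M] [Module R M]

/-- The sign of the face map removing `j` from `K`. -/
def ksign (j : ι) (K : Finset ι) : ℤ := (-1) ^ (K.filter (· < j)).card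

/-- The Koszul cochain differential on the elements `y j ^ N`. -/
def kd (y : ι → R) (N : ℕ) (m : Finset ι → M) (K : Finset ι) : M :=
  ∑ j ∈ K, ksign j K • (y j ^ N) • m (K.erase j)

/-- The transition map between Koszul complexes on `y ^ N` and on `y ^ (N + k)`. -/
def kphi (y : ι → R) (k : ℕ) (m : Finset ι → M) (K : Finset ι) : M :=
  ((∏ j ∈ K, y j) ^ k) • m K

/-- The colimit over `N` of the degree `q` cohomology of the Koszul complexes on `y ^ N` with
coefficients in `M` vanishes. -/
def KV (y : ι → R) (M : Type*) [AddCommGroup M] [Module R M] (q : ℕ) : Prop :=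
  ∀ (N : ℕ) (m : Finset ι → M), (∀ J, J.card ≠ q → m J = 0) → (∀ K, kd y N m K = 0) →
    ∃ (k : ℕ) (b : Finset ι → M), ∀ K, kd y (N + k) b K = kphi y k m K

theorem kd_add (y : ι → R) (N : ℕ) (m m' : Finset ι → M) (K : Finset ι) :
    kd y N (fun J => m J + m' J) K = kd y N m K + kd y N m' K := by
  simp [kd, smul_add, Finset.sum_add_distrib]

theorem kd_sub (y : ι → R) (N : ℕ) (m m' : Finset ι → M) (K : Finset ι) :
    kd y N (fun J => m J - m' J) K = kd y N m K - kd y N m' K := by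
  simp [kd, smul_sub, Finset.sum_sub_distrib]

theorem kd_zero (y : ι → R) (N : ℕ) (K : Finset ι) :
    kd y N (fun _ => (0 : M)) K = 0 := by
  simp [kd]

theorem kd_smul (y : ι → R) (N : ℕ) (a : R) (m : Finset ι → M) (K : Finset ι) :
    kd y N (fun J => a • m J) K = a • kd y N m K := by
  simp only [kd, Finset.smul_sum]
  refine Finset.sum_congr rfl fun j _ => ?_
  rw [smul_comm a, smul_comm a]

theorem kphi_sub (y : ι → R) (k : ℕ) (m m' : Finset ι → M) (K : Finset ι) :
    kphi y k (fun J => m J - m' J) K = kphi y k m K - kphi y k m' K := by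
  simp [kphi, smul_sub]

theorem kphi_kphi (y : ι → R) (k l : ℕ) (m : Finset ι → M) (K : Finset ι) :
    kphi y k (kphi y l m) K = kphi y (l + k) m K := by
  simp [kphi, smul_smul, pow_add, mul_comm]

theorem kphi_kd (y : ι → R) (N k : ℕ) (m : Finset ι → M) (K : Finset ι) :
    kphi y k (kd y N m) K = kd y (N + k) (kphi y k m) K := by
  simp only [kphi, kd, Finset.smul_sum]
  refine Finset.sum_congr rfl fun j hj => ?_
  rw [smul_comm, smul_smul, smul_smul, ← Finset.mul_prod_erase K y hj]
  congr 2
  ring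

theorem kd_congr (y : ι → R) (N : ℕ) {m m' : Finset ι → M} {K : Finset ι}
    (h : ∀ j ∈ K, m (K.erase j) = m' (K.erase j)) : kd y N m K = kd y N m' K := by
  refine Finset.sum_congr rfl fun j hj => ?_
  rw [h j hj]

theorem kd_kd (y : ι → R) (N : ℕ) (m : Finset ι → M) (K : Finset ι) :
    kd y N (kd y N m) K = 0 := by
  have key : ∀ j ∈ K, ∀ l ∈ K, j < l →
      ksign j K * ksign l (K.erase j) = -(ksign l K * ksign j (K.erase l)) := by
    intro j hj l hl hjl
    have h1 : ((K.erase l).filter (· < j)) = K.filter (· < j) := by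
      ext x
      simp only [Finset.mem_filter, Finset.mem_erase]
      constructor
      · rintro ⟨⟨_, h⟩, h'⟩; exact ⟨h, h'⟩
      · rintro ⟨h, h'⟩; exact ⟨⟨(h'.trans hjl).ne, h⟩, h'⟩
    have h2 : K.filter (· < l) = insert j ((K.erase j).filter (· < l)) := by
      ext x
      simp only [Finset.mem_filter, Finset.mem_erase, Finset.mem_insert]
      constructor
      · rintro ⟨h, h'⟩
        by_cases hx : x = j
        · exact Or.inl hx
        · exact Or.inr ⟨⟨hx, h⟩, h'⟩
      · rintro (rfl | ⟨⟨_, h⟩, h'⟩)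
        · exact ⟨hj, hjl⟩
        · exact ⟨h, h'⟩
    unfold ksign
    rw [h1, h2, Finset.card_insert_of_notMem (by simp)]
    ring
  unfold kd
  simp only [Finset.smul_sum]
  rw [Finset.sum_sigma']
  refine Finset.sum_involution (fun p _ => ⟨p.2, p.1⟩) ?_ ?_ ?_ ?_
  · rintro ⟨j, l⟩ h
    simp only [Finset.mem_sigma, Finset.mem_erase] at h
    obtain ⟨hj, hlj, hl⟩ := h
    simp only
    have e : (K.erase l).erase j = (K.erase j).erase l := Finset.erase_right_comm
    have h3 : ksign j K * ksign l (K.erase j) = -(ksign l K * ksign j (K.erase l)) := by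
      rcases lt_or_gt_of_ne hlj with h | h
      · rw [key l hl j hj h]; ring
      · exact key j hj l hl h
    rw [e, smul_comm (y j ^ N) (ksign l _), smul_comm (y l ^ N) (ksign j _),
      smul_smul (ksign j K), smul_smul (ksign l K), h3,
      smul_comm (y l ^ N) (y j ^ N), neg_smul, neg_add_cancel]
  · rintro ⟨j, l⟩ h _ e
    simp only [Finset.mem_sigma, Finset.mem_erase] at h
    simp only [Sigma.mk.injEq] at e
    exact h.2.1 e.1
  · rintro ⟨j, l⟩ h
    simp only [Finset.mem_sigma, Finset.mem_erase] at h ⊢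
    exact ⟨h.2.2, fun e => h.2.1 e.symm, h.1⟩
  · rintro ⟨j, l⟩ h
    rfl

/-- Truncation of a cochain to degree `q`. -/
def kproj (q : ℕ) (b : Finset ι → M) (K : Finset ι) : M := if K.card = q then b K else 0

theorem kproj_ne (q : ℕ) (b : Finset ι → M) (K : Finset ι) (h : K.card ≠ q) :
    kproj q b K = 0 := if_neg h

theorem kd_kproj (y : ι → R) (N q : ℕ) (b : Finset ι → M) (K : Finset ι) :
    kd y N (kproj q b) K = kproj (q + 1) (kd y N b) K := by
  unfold kproj
  split_ifs with h
  · refine kd_congr y N fun j hj => ?_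
    rw [if_pos]
    rw [Finset.card_erase_of_mem hj, h]; rfl
  · refine (kd_congr y N fun j hj => ?_).trans (kd_zero (M := M) y N K)
    rw [if_neg]
    rw [Finset.card_erase_of_mem hj]
    have := Finset.card_pos.2 ⟨j, hj⟩
    omega

theorem kd_deg (y : ι → R) (N q : ℕ) {m : Finset ι → M} (h : ∀ J, J.card ≠ q → m J = 0)
    (K : Finset ι) (hK : K.card ≠ q + 1) : kd y N m K = 0 := by
  refine (kd_congr y N fun j hj => h _ ?_).trans (kd_zero (M := M) y N K)
  rw [Finset.card_erase_of_mem hj]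
  have := Finset.card_pos.2 ⟨j, hj⟩
  omega

theorem kphi_deg (y : ι → R) (k q : ℕ) {m : Finset ι → M} (h : ∀ J, J.card ≠ q → m J = 0)
    (K : Finset ι) (hK : K.card ≠ q) : kphi y k m K = 0 := by
  rw [kphi, h K hK, smul_zero]

/-- The primitive in the definition of `KV` may be chosen homogeneous. -/
theorem KV.exists_deg {y : ι → R} {q : ℕ} (h : KV y M (q + 1)) {N : ℕ} {m : Finset ι → M}
    (hm : ∀ J, J.card ≠ q + 1 → m J = 0) (hd : ∀ K, kd y N m K = 0) :
    ∃ (k : ℕ) (b : Finset ι → M), (∀ J, J.card ≠ q → b J = 0) ∧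
      ∀ K, kd y (N + k) b K = kphi y k m K := by
  obtain ⟨k, b, hb⟩ := h N m hm hd
  refine ⟨k, kproj q b, kproj_ne q b, fun K => ?_⟩
  rw [kd_kproj, kproj]
  split_ifs with h'
  · exact hb K
  · exact (kphi_deg y k (q + 1) hm K h').symm

theorem KV.lift {y : ι → R} {N k : ℕ} (l : ℕ) {m b : Finset ι → M}
    (h : ∀ K, kd y (N + k) b K = kphi y k m K) (K : Finset ι) :
    kd y (N + (k + l)) (kphi y l b) K = kphi y (k + l) m K := by
  rw [← add_assoc, ← kphi_kd, ← kphi_kphi, kphi, kphi, h]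

theorem KV.of_card_lt [Fintype ι] (y : ι → R) {q : ℕ} (h : Fintype.card ι < q) : KV y M q := by
  intro N m hm _
  refine ⟨0, fun _ => 0, fun K => ?_⟩
  rw [kd_zero, kphi, hm K, smul_zero]
  exact ((Finset.card_le_univ K).trans_lt h).ne

/-- Transfer along additive maps intertwining the actions. -/
theorem kd_map {R' M' : Type*} [CommRing R'] [AddCommGroup M'] [Module R' M'] (y : ι → R)
    (y' : ι → R') (i : M →+ M') (hi : ∀ j m, i (y j • m) = y' j • i m) (N : ℕ)
    (m : Finset ι → M) (K : Finset ι) :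
    kd y' N (fun J => i (m J)) K = i (kd y N m K) := by
  have hp : ∀ j N m, i (y j ^ N • m) = y' j ^ N • i m := by
    intro j N m
    induction N generalizing m with
    | zero => simp
    | succ n ih => rw [pow_succ, mul_smul, ih, hi, ← mul_smul, ← pow_succ]
  simp only [kd, map_sum, map_zsmul, hp]

theorem kphi_map {R' M' : Type*} [CommRing R'] [AddCommGroup M'] [Module R' M'] (y : ι → R)
    (y' : ι → R') (i : M →+ M') (hi : ∀ j m, i (y j • m) = y' j • i m) (N : ℕ)
    (m : Finset ι → M) (K : Finset ι) :
    kphi y' N (fun J => i (m J)) K = i (kphi y N m K) := by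
  have hpr : ∀ (K : Finset ι) m, i ((∏ j ∈ K, y j) • m) = (∏ j ∈ K, y' j) • i m := by
    intro K
    induction K using Finset.induction_on with
    | empty => simp
    | insert a s ha ih =>
      intro m
      rw [Finset.prod_insert ha, Finset.prod_insert ha, mul_smul, hi, ih, mul_smul]
  have hp : ∀ m, i ((∏ j ∈ K, y j) ^ N • m) = (∏ j ∈ K, y' j) ^ N • i m := by
    induction N with
    | zero => simp
    | succ n ih => intro m; rw [pow_succ, mul_smul, ih, hpr, ← mul_smul, ← pow_succ]
  simp only [kphi, hp]

theorem KV.of_retract {R' M' : Type*} [CommRing R'] [AddCommGroup M'] [Module R' M'] {y : ι → R}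
    {y' : ι → R'} (i : M →+ M') (p : M' →+ M) (hpi : ∀ m, p (i m) = m)
    (hi : ∀ j m, i (y j • m) = y' j • i m) (hp : ∀ j m, p (y' j • m) = y j • p m) {q : ℕ}
    (h : KV y' M' q) : KV y M q := by
  intro N m hm hd
  obtain ⟨k, b, hb⟩ := h N (fun J => i (m J)) (fun J hJ => by simp [hm J hJ])
    (fun K => by rw [kd_map y y' i hi, hd, map_zero])
  refine ⟨k, fun J => p (b J), fun K => ?_⟩
  rw [kd_map y' y p hp, hb, kphi_map y y' i hi, hpi]

theorem KV.of_equiv {R' M' : Type*} [CommRing R'] [AddCommGroup M'] [Module R' M'] {y : ι → R}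
    {y' : ι → R'} (e : M ≃+ M') (he : ∀ j m, e (y j • m) = y' j • e m) {q : ℕ}
    (h : KV y M q) : KV y' M' q := by
  refine KV.of_retract (e.symm : M' →+ M) (e : M →+ M') (by simp) ?_ (by simpa using he) h
  intro j m
  apply e.injective
  simp [he]

/-- A uniform exponent exists for finitely many cocycles. -/
theorem KV.finset_exists {β : Type*} {y : ι → R} {q : ℕ} (h : KV y M q) (t : Finset β) (N : ℕ)
    (m : β → Finset ι → M) (hm : ∀ b J, J.card ≠ q → m b J = 0)
    (hd : ∀ b K, kd y N (m b) K = 0) :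
    ∃ (k : ℕ) (c : β → Finset ι → M), ∀ b ∈ t, ∀ K, kd y (N + k) (c b) K = kphi y k (m b) K := by
  choose k c hc using fun b => h N (m b) (hm b) (hd b)
  refine ⟨t.sup k, fun b => kphi y (t.sup k - k b) (c b), fun b hb K => ?_⟩
  have h2 := KV.lift (t.sup k - k b) (hc b) K
  rwa [Nat.add_sub_cancel' (Finset.le_sup hb)] at h2

theorem KV.finsupp {β : Type*} [Fintype ι] {y : ι → R} {q : ℕ} (h : KV y M q) :
    KV y (β →₀ M) q := by
  classical
  intro N m hm hd
  have ev : ∀ b : β, ∀ j, ∀ f : β →₀ M,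
      Finsupp.applyAddHom b (y j • f) = y j • Finsupp.applyAddHom b f := fun b j f => by simp
  set t : Finset β := Finset.univ.biUnion fun J : Finset ι => (m J).support with ht
  obtain ⟨k, c, hc⟩ := h.finset_exists t N (fun b J => Finsupp.applyAddHom b (m J))
    (fun b J hJ => by simp [hm J hJ]) (fun b K => by rw [kd_map y y _ (ev b), hd, map_zero])
  refine ⟨k, fun J => Finsupp.onFinset t (fun b => if b ∈ t then c b J else 0)
    (by intro b hb; by_contra h'; simp [h'] at hb), fun K => ?_⟩
  ext b
  have h1 := kd_map y y (Finsupp.applyAddHom b) (ev b) (N + k) (fun J => Finsupp.onFinset t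
    (fun b => if b ∈ t then c b J else 0) (by intro b hb; by_contra h'; simp [h'] at hb)) K
  have h2 := kphi_map y y (Finsupp.applyAddHom b) (ev b) k m K
  simp only [Finsupp.applyAddHom_apply, Finsupp.onFinset_apply] at h1 h2
  rw [← h1, ← h2]
  by_cases hb : b ∈ t
  · simp only [hb, if_true]
    exact hc b hb K
  · simp only [hb, if_false]
    rw [kd_zero, kphi]
    have : m K b = 0 := by
      by_contra h'
      exact hb (by rw [ht]; simp only [Finset.mem_biUnion]; exact ⟨K, Finset.mem_univ _, by simpa using h'⟩)
    rw [this, smul_zero]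

end KoszulColim

namespace KoszulColim

section Injective

variable {R E : Type} [CommRing R] [AddCommGroup E] [Module R E]

theorem exists_pow_smul_eq_zero_of_forall [IsNoetherianRing R] (a : R) (I : Ideal R)
    (g : I →ₗ[R] E) (hg : ∀ x, ∃ n, a ^ n • g x = 0) : ∃ n, ∀ x, a ^ n • g x = 0 := by
  obtain ⟨s, hs⟩ := Module.Finite.fg_top (R := R) (M := I)
  choose n hn using hg
  refine ⟨s.sup n, fun x => ?_⟩
  have hx : x ∈ Submodule.span R (s : Set I) := by rw [hs]; trivial
  induction hx using Submodule.span_induction with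
  | mem x hx =>
    obtain ⟨c, hc⟩ := Nat.exists_eq_add_of_le (Finset.le_sup (f := n) hx)
    rw [hc, add_comm, pow_add, mul_smul, hn, smul_zero]
  | zero => simp
  | add x y _ _ hx hy => rw [map_add, smul_add, hx, hy, add_zero]
  | smul r x _ hx => rw [map_smul, smul_comm, hx, smul_zero]

/-- The `a`-power torsion of an injective module over a Noetherian ring is injective. -/
theorem baer_torsion [IsNoetherianRing R] (a : R) (hE : Module.Baer R E) :
    Module.Baer R (Submodule.torsion' R E (Submonoid.powers a)) := by
  intro I g
  obtain ⟨n, hn⟩ := exists_pow_smul_eq_zero_of_forall a I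
    ((Submodule.torsion' R E (Submonoid.powers a)).subtype ∘ₗ g) (by
      intro x
      obtain ⟨⟨_, n, rfl⟩, hn⟩ := (Submodule.mem_torsion'_iff _ _).1 (g x).2
      exact ⟨n, hn⟩)
  obtain ⟨k, hk⟩ := Ideal.exists_pow_inf_eq_pow_smul (Ideal.span {a}) I
  have hz : ∀ x : I, (x : R) ∈ Ideal.span {a ^ (n + k)} → g x = 0 := by
    intro x hx
    have h1 : (x : R) ∈ (Ideal.span {a} ^ (n + k) • ⊤ ⊓ I : Ideal R) := by
      refine ⟨?_, x.2⟩
      rw [Ideal.span_singleton_pow, smul_eq_mul, Ideal.mul_top]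
      exact hx
    rw [hk (n + k) (by omega), Nat.add_sub_cancel] at h1
    have h2 := smul_mono_right (Ideal.span {a} ^ n)
      (inf_le_right : (Ideal.span {a} ^ k • ⊤ ⊓ I : Ideal R) ≤ I) h1
    rw [Ideal.span_singleton_pow, Submodule.ideal_span_singleton_smul,
      Submodule.mem_smul_pointwise_iff_exists] at h2
    obtain ⟨w, hw, e⟩ := h2
    have : x = a ^ n • (⟨w, hw⟩ : I) := Subtype.ext e.symm
    rw [this, map_smul]
    exact Subtype.ext (hn ⟨w, hw⟩)
  set P : Ideal R := Ideal.span {a ^ (n + k)} with hP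
  let f : (I ⧸ Submodule.comap (Submodule.subtype I) P) →ₗ[R] (R ⧸ P) := Submodule.mapQ _ P (Submodule.subtype I) le_rfl
  have hf : Function.Injective f := by
    rw [← LinearMap.ker_eq_bot, Submodule.ker_mapQ, ← Submodule.mkQ_map_self]
  let g' : (I ⧸ Submodule.comap (Submodule.subtype I) P) →ₗ[R] E := Submodule.liftQ _
    ((Submodule.torsion' R E (Submonoid.powers a)).subtype ∘ₗ g) (by
      intro x hx
      rw [LinearMap.mem_ker, LinearMap.comp_apply, hz x hx, map_zero])
  obtain ⟨h, hh⟩ := hE.extension_property f hf g'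
  have ht : ∀ x, h (Submodule.Quotient.mk x) ∈ Submodule.torsion' R E (Submonoid.powers a) := by
    intro x
    rw [Submodule.mem_torsion'_iff]
    refine ⟨⟨a ^ (n + k), n + k, rfl⟩, ?_⟩
    change a ^ (n + k) • h _ = 0
    rw [← map_smul, ← Submodule.Quotient.mk_smul]
    have : (Submodule.Quotient.mk (a ^ (n + k) • x) : R ⧸ P) = 0 := by
      rw [Submodule.Quotient.mk_eq_zero, smul_eq_mul]
      exact Ideal.mul_mem_right _ _ (Ideal.subset_span rfl)
    rw [this, map_zero]
  refine ⟨(h ∘ₗ P.mkQ).codRestrict _ ht, fun x hx => Subtype.ext ?_⟩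
  have := LinearMap.congr_fun hh (Submodule.Quotient.mk ⟨x, hx⟩)
  exact this

theorem baer_divisible [IsDomain R] (hE : Module.Baer R E) {a : R} (ha : a ≠ 0) (e : E) :
    ∃ e', a • e' = e := by
  let i : R →ₗ[R] R := LinearMap.mulLeft R a
  have hi : Function.Injective i := fun x y h => mul_left_cancel₀ ha h
  obtain ⟨h, hh⟩ := hE.extension_property i hi (LinearMap.toSpanSingleton R E e)
  refine ⟨h 1, ?_⟩
  have := LinearMap.congr_fun hh 1
  simp only [LinearMap.comp_apply, i, LinearMap.mulLeft_apply, LinearMap.toSpanSingleton_apply,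
    one_smul] at this
  rw [← map_smul, smul_eq_mul]
  exact this

theorem baer_exists_smul [IsDomain R] (hE : Module.Baer R E) (a : R) (N : ℕ) (e : E) :
    ∃ e', a ^ (N + 1) • e' = a • e := by
  by_cases ha : a = 0
  · exact ⟨0, by simp [ha]⟩
  · exact baer_divisible hE (pow_ne_zero _ ha) _

end Injective

section InjectiveKV

variable {ι R : Type} [LinearOrder ι] [CommRing R]

theorem kd_insert {M : Type*} [AddCommGroup M] [Module R M] (y : ι → R) (N : ℕ)
    (m : Finset ι → M) {a : ι} {K : Finset ι} (hK : ∀ x ∈ K, x < a) :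
    kd y N m (insert a K) =
      kd y N (fun J => m (insert a J)) K + (-1 : ℤ) ^ K.card • y a ^ N • m K := by
  have ha : a ∉ K := fun h => lt_irrefl _ (hK a h)
  rw [kd, Finset.sum_insert ha, add_comm, kd]
  congr 1
  · refine Finset.sum_congr rfl fun j hj => ?_
    have hja : j ≠ a := (hK j hj).ne
    rw [Finset.erase_insert_of_ne hja.symm]
    congr 1
    simp only [ksign, Finset.filter_insert, if_neg (hK j hj).not_gt]
  · rw [Finset.erase_insert ha, ksign, Finset.filter_insert, if_neg (lt_irrefl a),
      Finset.filter_true_of_mem hK]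

theorem kd_baer [IsNoetherianRing R] [IsDomain R] (y : ι → R) (s : Finset ι) :
    ∀ (E : Type) [AddCommGroup E] [Module R E], Module.Baer R E → ∀ (N : ℕ) (c : Finset ι → E),
      c ∅ = 0 → (∀ K ⊆ s, kd y N c K = 0) →
      ∃ (k : ℕ) (b : Finset ι → E), ∀ K ⊆ s, kd y (N + k) b K = kphi y k c K := by
  induction s using Finset.induction_on_max with
  | empty =>
    intro E _ _ _ N c hc _
    refine ⟨0, fun _ => 0, fun K hK => ?_⟩
    rw [Finset.subset_empty.1 hK, kd_zero, kphi, hc, smul_zero]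
  | insert a s hs ih =>
    intro E _ _ hE N c hc hd
    have has : a ∉ s := fun h => lt_irrefl _ (hs a h)
    have hKs : ∀ K ⊆ s, ∀ x ∈ K, x < a := fun K hK x hx => hs x (hK hx)
    choose g hg using fun K : Finset ι => baer_exists_smul hE (y a) N (c (insert a K))
    let b₁ : Finset ι → E := fun K =>
      if a ∈ K then 0 else (-1 : ℤ) ^ K.card • (∏ j ∈ K, y j) ^ 1 • g K
    let c₁ : Finset ι → E := fun K => kphi y 1 c K - kd y (N + 1) b₁ K
    have hd₁ : ∀ K ⊆ insert a s, kd y (N + 1) c₁ K = 0 := by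
      intro K hK
      rw [kd_sub, ← kphi_kd, kd_kd, kphi, hd K hK, smul_zero, sub_zero]
    have hc₁ : c₁ ∅ = 0 := by simp [c₁, kphi, kd, hc]
    have hsg : ∀ n : ℕ, ((-1 : ℤ) ^ n) * (-1) ^ n = 1 := fun n => by
      rw [← mul_pow]; simp
    have hins : ∀ K ⊆ s, c₁ (insert a K) = 0 := by
      intro K hK
      have haK : a ∉ K := fun h => has (hK h)
      simp only [c₁]
      rw [kd_insert y _ _ (hKs K hK), sub_eq_zero]
      have h0 : kd y (N + 1) (fun J => b₁ (insert a J)) K = 0 := by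
        rw [← kd_zero (M := E) y (N + 1) K]
        exact kd_congr _ _ fun j _ => if_pos (Finset.mem_insert_self a _)
      rw [h0, zero_add]
      simp only [b₁, if_neg haK, kphi]
      rw [smul_comm (y a ^ (N + 1)), smul_smul, hsg, one_smul, smul_comm (y a ^ (N + 1)), hg,
        Finset.prod_insert haK, pow_one, pow_one, smul_smul, mul_comm]
    have htor : ∀ K ⊆ s, y a ^ (N + 1) • c₁ K = 0 := by
      intro K hK
      have h1 := hd₁ (insert a K) (Finset.insert_subset_insert a hK)
      rw [kd_insert y _ _ (hKs K hK)] at h1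
      have h0 : kd y (N + 1) (fun J => c₁ (insert a J)) K = 0 := by
        rw [← kd_zero (M := E) y (N + 1) K]
        exact kd_congr _ _ fun j _ => hins _ ((Finset.erase_subset _ _).trans hK)
      rw [h0, zero_add] at h1
      have h2 := congrArg (fun x => (-1 : ℤ) ^ K.card • x) h1
      simpa only [smul_smul, hsg, one_smul, smul_zero] using h2
    let T := Submodule.torsion' R E (Submonoid.powers (y a))
    have hT : ∀ K, K ⊆ s → c₁ K ∈ T := fun K hK =>
      (Submodule.mem_torsion'_iff _ _).2 ⟨⟨_, N + 1, rfl⟩, htor K hK⟩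
    classical
    let c₂ : Finset ι → T := fun K => if h : K ⊆ s then ⟨c₁ K, hT K h⟩ else 0
    have hTi : ∀ (j : ι) (m : T), T.subtype.toAddMonoidHom (y j • m) =
      y j • T.subtype.toAddMonoidHom m := fun j m => rfl
    have hc₂ : ∀ K ⊆ s, T.subtype.toAddMonoidHom (c₂ K) = c₁ K := by
      intro K hK
      simp [c₂, hK]
    obtain ⟨k, b₂, hb₂⟩ := ih T (baer_torsion (y a) hE) (N + 1) c₂
      (by simp [c₂, hc₁]) (fun K hK => by
        apply T.injective_subtype
        have := kd_map y y T.subtype.toAddMonoidHom hTi (N + 1) c₂ K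
        rw [map_zero]
        refine this.symm.trans ?_
        rw [← hd₁ K (hK.trans (Finset.subset_insert a s))]
        exact kd_congr _ _ fun j _ => hc₂ _ ((Finset.erase_subset _ _).trans hK))
    obtain ⟨l, hl⟩ : ∃ l, ∀ K ∈ s.powerset, y a ^ l • (b₂ K : E) = 0 := by
      have : ∀ K, ∃ n, y a ^ n • (b₂ K : E) = 0 := by
        intro K
        obtain ⟨⟨_, n, rfl⟩, hn⟩ := (Submodule.mem_torsion'_iff _ _).1 (b₂ K).2
        exact ⟨n, hn⟩
      choose n hn using this
      refine ⟨s.powerset.sup n, fun K hK => ?_⟩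
      obtain ⟨c, hc⟩ := Nat.exists_eq_add_of_le (Finset.le_sup (f := n) hK)
      rw [hc, add_comm, pow_add, mul_smul, hn, smul_zero]
    let b₃ : Finset ι → E := fun K => if a ∈ K then 0 else (b₂ K : E)
    have hb₃ : ∀ K ⊆ insert a s,
        kd y (N + 1 + (k + l)) (kphi y l b₃) K = kphi y (k + l) c₁ K := by
      intro K hK
      by_cases haK : a ∈ K
      · obtain ⟨L, hL, rfl⟩ : ∃ L, L ⊆ s ∧ K = insert a L :=
          ⟨K.erase a, fun x hx => (Finset.mem_insert.1 (hK (Finset.mem_of_mem_erase hx))).resolve_left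
            (Finset.ne_of_mem_erase hx), (Finset.insert_erase haK).symm⟩
        have haL : a ∉ L := fun h => has (hL h)
        rw [kd_insert y _ _ (hKs L hL)]
        have h0 : kd y (N + 1 + (k + l)) (fun J => kphi y l b₃ (insert a J)) L = 0 := by
          refine (kd_congr _ _ fun j _ => ?_).trans (kd_zero (M := E) y (N + 1 + (k + l)) L)
          simp only [kphi, b₃]
          rw [if_pos (Finset.mem_insert_self a _), smul_zero]
        rw [h0, zero_add, kphi, kphi, hins L hL, smul_zero]
        have : y a ^ (N + 1 + (k + l)) • (∏ j ∈ L, y j) ^ l • b₃ L = 0 := by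
          simp only [b₃, if_neg haL]
          rw [smul_comm, ← add_assoc, pow_add (y a), mul_smul,
            hl L (Finset.mem_powerset.2 hL), smul_zero, smul_zero]
        rw [this, smul_zero]
      · have hKs' : K ⊆ s := (Finset.subset_insert_iff_of_notMem haK).1 hK
        have h1 : kd y (N + 1 + k) b₃ K = kphi y k c₁ K := by
          have e1 := kd_map y y T.subtype.toAddMonoidHom hTi (N + 1 + k) b₂ K
          have e2 := kphi_map y y T.subtype.toAddMonoidHom hTi k c₂ K
          rw [hb₂ K hKs', ← e2] at e1
          simp only [kphi] at e1 ⊢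
          rw [hc₂ K hKs'] at e1
          rw [← e1]
          exact kd_congr _ _ fun j _ => if_neg fun h => haK (Finset.mem_of_mem_erase h)
        rw [← add_assoc, ← kphi_kd, ← kphi_kphi, kphi, kphi, h1]
    refine ⟨1 + (k + l), fun K => kphi y (k + l) b₁ K + kphi y l b₃ K, fun K hK => ?_⟩
    rw [kd_add, ← add_assoc, hb₃ K hK, ← kphi_kd, ← kphi_kphi y (k + l)]
    simp only [c₁]
    rw [kphi_sub]
    abel

theorem KV.of_baer [IsNoetherianRing R] [IsDomain R] [Fintype ι] (y : ι → R) {E : Type}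
    [AddCommGroup E] [Module R E] (hE : Module.Baer R E) (q : ℕ) : KV y E (q + 1) := by
  intro N m hm hd
  obtain ⟨k, b, hb⟩ := kd_baer y Finset.univ E hE N m (hm ∅ (by simp)) fun K _ => hd K
  exact ⟨k, b, fun K => hb K (Finset.subset_univ K)⟩

end InjectiveKV

section Recursion

/-- `m` is annihilated by a power of each element of `J`. -/
def IsTors {R M : Type} [CommRing R] [AddCommGroup M] [Module R M] (J : Ideal R) (m : M) : Prop :=
  J ≤ (Ideal.torsionOf R M m).radical

/-- The recursion (by dimension shifting along embeddings into injectives) which characterizes the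
vanishing of local cohomology supported at `J`. -/
structure VanishingRec {R : Type} [CommRing R] (J : Ideal R)
    (V : ℕ → ∀ (M : Type) [AddCommGroup M] [Module R M], Prop) : Prop where
  zero : ∀ (M : Type) [AddCommGroup M] [Module R M], V 0 M ↔ ∀ m : M, IsTors J m → m = 0
  one : ∀ (M E Q : Type) [AddCommGroup M] [AddCommGroup E] [AddCommGroup Q]
    [Module R M] [Module R E] [Module R Q] (i : M →ₗ[R] E) (p : E →ₗ[R] Q),
    Function.Injective i → Function.Surjective p → Function.Exact i p → Module.Baer R E →
    (V 1 M ↔ ∀ x : Q, IsTors J x → ∃ e : E, IsTors J e ∧ p e = x)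
  succ : ∀ (q : ℕ) (M E Q : Type) [AddCommGroup M] [AddCommGroup E] [AddCommGroup Q]
    [Module R M] [Module R E] [Module R Q] (i : M →ₗ[R] E) (p : E →ₗ[R] Q),
    Function.Injective i → Function.Surjective p → Function.Exact i p → Module.Baer R E →
    (V (q + 2) M ↔ V (q + 1) Q)

open CategoryTheory in
theorem exists_baer_embedding (R M : Type) [CommRing R] [AddCommGroup M] [Module R M] :
    ∃ (E : Type) (_ : AddCommGroup E) (_ : Module R E) (i : M →ₗ[R] E),
      Function.Injective i ∧ Module.Baer R E := by
  let P := Injective.under (ModuleCat.of R M)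
  refine ⟨P, inferInstance, inferInstance, (Injective.ι (ModuleCat.of R M)).hom, ?_, ?_⟩
  · exact (ModuleCat.mono_iff_injective _).1 inferInstance
  · have : Injective (ModuleCat.of R P) := inferInstanceAs (Injective P)
    exact Module.Baer.of_injective (Module.injective_module_of_injective_object R P)

theorem VanishingRec.unique {R : Type} [CommRing R] {J J' : Ideal R} (hJ : J.radical = J'.radical)
    {V V' : ℕ → ∀ (M : Type) [AddCommGroup M] [Module R M], Prop} (h : VanishingRec J V)
    (h' : VanishingRec J' V') (q : ℕ) (M : Type) [AddCommGroup M] [Module R M] :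
    V q M ↔ V' q M := by
  have ht : ∀ {M : Type} [AddCommGroup M] [Module R M] (m : M), IsTors J m ↔ IsTors J' m := by
    intro M _ _ m
    rw [IsTors, IsTors, ← Ideal.radical_le_radical_iff, hJ, Ideal.radical_le_radical_iff]
  induction q using Nat.strong_induction_on generalizing M with
  | _ q ih =>
    obtain ⟨E, _, _, i, hi, hE⟩ := exists_baer_embedding R M
    have hex : Function.Exact i (LinearMap.range i).mkQ := by
      intro x; simp
    have hs := Submodule.mkQ_surjective (LinearMap.range i)
    match q with
    | 0 => rw [h.zero, h'.zero]; simp only [ht]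
    | 1 => rw [h.one M E _ i _ hi hs hex hE, h'.one M E _ i _ hi hs hex hE]; simp only [ht]
    | q + 2 =>
      rw [h.succ q M E _ i _ hi hs hex hE, h'.succ q M E _ i _ hi hs hex hE]
      exact ih (q + 1) (by omega) _

end Recursion

section KoszulRecursion

variable {ι R : Type} [LinearOrder ι] [Fintype ι] [CommRing R]

theorem isTors_span_iff {M : Type} [AddCommGroup M] [Module R M] (y : ι → R) (m : M) :
    IsTors (Ideal.span (Set.range y)) m ↔ ∃ N, ∀ j, y j ^ N • m = 0 := by
  rw [IsTors, Ideal.span_le, Set.range_subset_iff]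
  simp only [SetLike.mem_coe, Ideal.mem_radical_iff, Ideal.mem_torsionOf_iff]
  constructor
  · intro h
    choose n hn using h
    refine ⟨Finset.univ.sup n, fun j => ?_⟩
    obtain ⟨c, hc⟩ := Nat.exists_eq_add_of_le (Finset.le_sup (f := n) (Finset.mem_univ j))
    rw [hc, add_comm, pow_add, mul_smul, hn, smul_zero]
  · rintro ⟨N, h⟩ j
    exact ⟨N, h j⟩

variable {M E Q : Type} [AddCommGroup M] [AddCommGroup E] [AddCommGroup Q]
    [Module R M] [Module R E] [Module R Q]

theorem kphi_empty (y : ι → R) (k : ℕ) (m : Finset ι → M) : kphi y k m ∅ = m ∅ := by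
  simp [kphi]

theorem kd_empty (y : ι → R) (k : ℕ) (m : Finset ι → M) : kd y k m ∅ = 0 := by
  simp [kd]

theorem kd_singleton (y : ι → R) (k : ℕ) (m : Finset ι → M) (j : ι) :
    kd y k m {j} = y j ^ k • m ∅ := by
  simp [kd, ksign, Finset.filter_singleton]

/-- The cochain concentrated in degree `0`. -/
def kconst (x : M) (K : Finset ι) : M := if K = ∅ then x else 0

theorem kconst_deg (x : M) (K : Finset ι) (h : K.card ≠ 0) : kconst x K = 0 :=
  if_neg fun h' => h (by simp [h'])

theorem kd_kconst_eq_zero (y : ι → R) (N : ℕ) (x : M) (h : ∀ j, y j ^ N • x = 0)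
    (K : Finset ι) : kd y N (kconst x) K = 0 := by
  by_cases hK : K.card = 1
  · obtain ⟨j, rfl⟩ := Finset.card_eq_one.1 hK
    rw [kd_singleton, kconst, if_pos rfl, h]
  · exact kd_deg y N 0 (kconst_deg x) K hK

theorem KV.zero_iff (y : ι → R) : KV y M 0 ↔ ∀ m : M, IsTors (Ideal.span (Set.range y)) m →
    m = 0 := by
  simp only [isTors_span_iff]
  constructor
  · rintro h m ⟨N, hN⟩
    obtain ⟨k, b, hb⟩ := h N (kconst m) (kconst_deg m) (kd_kconst_eq_zero y N m hN)
    have := hb ∅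
    rw [kd_empty, kphi_empty] at this
    simpa [kconst] using this.symm
  · intro h N m hm hd
    refine ⟨0, fun _ => 0, fun K => ?_⟩
    rw [kd_zero, kphi]
    by_cases hK : K.card = 0
    · rw [Finset.card_eq_zero.1 hK, h (m ∅) ⟨N, fun j => by rw [← kd_singleton, hd]⟩, smul_zero]
    · rw [hm K hK, smul_zero]

theorem lmap_comm (y : ι → R) (p : E →ₗ[R] Q) (j : ι) (m : E) :
    p.toAddMonoidHom (y j • m) = y j • p.toAddMonoidHom m := map_smul p _ _

/-- Lifting cochains. -/
theorem exists_cochain_lift {p : E →ₗ[R] Q} (hp : Function.Surjective p) (q : ℕ)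
    (c : Finset ι → Q) (hc : ∀ J, J.card ≠ q → c J = 0) :
    ∃ c' : Finset ι → E, (∀ J, J.card ≠ q → c' J = 0) ∧ ∀ J, p (c' J) = c J := by
  choose g hg using fun J => hp (c J)
  refine ⟨kproj q g, kproj_ne q g, fun J => ?_⟩
  rw [kproj]
  split_ifs with h
  · exact hg J
  · rw [hc J h, map_zero]

theorem KV.succ_iff [IsNoetherianRing R] [IsDomain R] (y : ι → R) (q : ℕ) (i : M →ₗ[R] E)
    (p : E →ₗ[R] Q) (hi : Function.Injective i) (hp : Function.Surjective p)
    (hip : Function.Exact i p) (hE : Module.Baer R E) :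
    KV y M (q + 1) ↔ ∀ N (z : Finset ι → Q), (∀ J, J.card ≠ q → z J = 0) →
      (∀ K, kd y N z K = 0) → ∃ (k : ℕ) (e : Finset ι → E) (c : Finset ι → Q),
        (∀ J, J.card ≠ q → e J = 0) ∧ (∀ K, kd y (N + k) e K = 0) ∧
        ∀ K, kphi y k z K = p (e K) + kd y (N + k) c K := by
  constructor
  · intro h N z hz hd
    obtain ⟨z', hz', hpz⟩ := exists_cochain_lift hp q z hz
    have h1 : ∀ K, ∃ w, i w = kd y N z' K := fun K => by
      rw [← Set.mem_range, ← hip]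
      have := kd_map y y p.toAddMonoidHom (lmap_comm y p) N z' K
      refine this.symm.trans ?_
      rw [← hd K]
      exact kd_congr _ _ fun j _ => hpz _
    choose w hw using h1
    obtain ⟨k, b, hb, hdb⟩ := h.exists_deg (N := N) (m := w) (fun J hJ => hi (by
      rw [hw, map_zero, kd_deg y N q hz' J hJ])) (fun K => hi (by
        rw [map_zero]
        refine (kd_map y y i.toAddMonoidHom (lmap_comm y i) N w K).symm.trans ?_
        rw [← kd_kd y N z' K]
        exact kd_congr _ _ fun j _ => hw _))
    refine ⟨k, fun K => kphi y k z' K - i (b K), fun _ => 0, ?_, ?_, ?_⟩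
    · intro J hJ
      simp only [kphi_deg y k q hz' J hJ, hb J hJ, map_zero, sub_zero]
    · intro K
      rw [kd_sub, ← kphi_kd, sub_eq_zero]
      have h1 := kd_map y y i.toAddMonoidHom (lmap_comm y i) (N + k) b K
      have h2 := kphi_map y y i.toAddMonoidHom (lmap_comm y i) k w K
      rw [hdb, ← h2] at h1
      refine Eq.trans ?_ h1.symm
      simp only [kphi]
      congr 1
      exact (hw K).symm
    · intro K
      rw [map_sub, kd_zero, add_zero, hip.apply_apply_eq_zero, sub_zero, kphi, kphi, map_smul,
        hpz]
  · intro h N m hm hd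
    obtain ⟨k, b, hb, hdb⟩ := (KV.of_baer y hE q).exists_deg (N := N) (m := fun J => i (m J))
      (fun J hJ => by simp [hm J hJ])
      (fun K => (kd_map y y i.toAddMonoidHom (lmap_comm y i) N m K).trans (by simp [hd K]))
    obtain ⟨l, e, c, -, hde, hl⟩ := h (N + k) (fun K => p (b K)) (fun J hJ => by simp [hb J hJ])
      (fun K => (kd_map y y p.toAddMonoidHom (lmap_comm y p) (N + k) b K).trans (by
        change p _ = 0
        rw [hdb, kphi, map_smul, hip.apply_apply_eq_zero, smul_zero]))
    choose c' hc' using fun J => hp (c J)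
    have h1 : ∀ K, ∃ w, i w = kphi y l b K - e K - kd y (N + k + l) c' K := fun K => by
      rw [← Set.mem_range, ← hip, map_sub, map_sub, sub_sub, sub_eq_zero]
      refine (kphi_map y y p.toAddMonoidHom (lmap_comm y p) l b K).symm.trans ?_
      rw [show kphi y l (fun J => p.toAddMonoidHom (b J)) K = _ from hl K]
      congr 1
      refine Eq.trans ?_ (kd_map y y p.toAddMonoidHom (lmap_comm y p) _ c' K)
      exact kd_congr _ _ fun j _ => (hc' _).symm
    choose w hw using h1
    refine ⟨k + l, w, fun K => hi ?_⟩
    have e1 := kd_map y y i.toAddMonoidHom (lmap_comm y i) (N + (k + l)) w K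
    have e2 := kphi_map y y i.toAddMonoidHom (lmap_comm y i) (k + l) m K
    refine e1.symm.trans (Eq.trans ?_ e2)
    have e3 : kd y (N + (k + l)) (fun J => i.toAddMonoidHom (w J)) K = kd y (N + k + l)
        (fun J => (kphi y l b J - e J) - kd y (N + k + l) c' J) K := by
      rw [← add_assoc]
      exact kd_congr _ _ fun j _ => hw _
    rw [e3, kd_sub, kd_sub, kd_kd, hde, sub_zero, sub_zero, ← kphi_kd, ← kphi_kphi y l k, kphi,
      kphi, hdb]
    rfl

theorem KV.vanishingRec [IsNoetherianRing R] [IsDomain R] (y : ι → R) :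
    VanishingRec (Ideal.span (Set.range y)) fun q M _ _ => KV y M q where
  zero M _ _ := KV.zero_iff y
  one M E Q _ _ _ _ _ _ i p hi hp hip hE := by
    simp only [isTors_span_iff]
    rw [KV.succ_iff y 0 i p hi hp hip hE]
    constructor
    · rintro h x ⟨N, hN⟩
      obtain ⟨k, e, c, he, hde, hke⟩ := h N (kconst x) (kconst_deg x) (kd_kconst_eq_zero y N x hN)
      refine ⟨e ∅, ⟨N + k, fun j => by rw [← kd_singleton, hde]⟩, ?_⟩
      have := hke ∅
      rw [kphi_empty, kd_empty, add_zero, kconst, if_pos rfl] at this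
      exact this.symm
    · intro h N z hz hd
      obtain ⟨e, ⟨n, hn⟩, he⟩ := h (z ∅) ⟨N, fun j => by rw [← kd_singleton, hd]⟩
      refine ⟨n, kconst e, fun _ => 0, kconst_deg e, kd_kconst_eq_zero y _ e ?_, ?_⟩
      · intro j
        rw [pow_add, mul_smul, hn, smul_zero]
      · intro K
        rw [kd_zero, add_zero]
        by_cases hK : K.card = 0
        · rw [Finset.card_eq_zero.1 hK, kphi_empty, kconst, if_pos rfl, he]
        · rw [kconst_deg e K hK, kphi, hz K hK, smul_zero, map_zero]
  succ q M E Q _ _ _ _ _ _ i p hi hp hip hE := by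
    rw [KV.succ_iff y (q + 1) i p hi hp hip hE]
    constructor
    · intro h N z hz hd
      obtain ⟨k, e, c, he, hde, hke⟩ := h N z hz hd
      obtain ⟨l, b, hb⟩ := KV.of_baer y hE q (N + k) e he hde
      refine ⟨k + l, fun K => p (b K) + kphi y l c K, fun K => ?_⟩
      rw [← add_assoc, kd_add, ← kphi_kd, ← kphi_kphi y l k]
      rw [kphi, kphi, hke, smul_add]
      congr 1
      refine (kd_map y y p.toAddMonoidHom (lmap_comm y p) _ b K).trans ?_
      rw [hb]
      exact (kphi_map y y p.toAddMonoidHom (lmap_comm y p) l e K).symm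
    · intro h N z hz hd
      obtain ⟨k, b, hb⟩ := h N z hz hd
      exact ⟨k, fun _ => 0, b, fun _ _ => rfl, fun K => kd_zero _ _ _,
        fun K => by rw [map_zero, zero_add, hb]⟩

theorem KV.congr_radical {κ : Type} [LinearOrder κ] [Fintype κ] [IsNoetherianRing R] [IsDomain R]
    (y : ι → R) (y' : κ → R)
    (h : (Ideal.span (Set.range y)).radical = (Ideal.span (Set.range y')).radical) (q : ℕ)
    (M : Type) [AddCommGroup M] [Module R M] : KV y M q ↔ KV y' M q :=
  (KV.vanishingRec y).unique h (KV.vanishingRec y') q M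

end KoszulRecursion


end KoszulColim

open CategoryTheory Limits Opposite

namespace KoszulColim

section OpComplex

variable {R : Type} [CommRing R] (K L : ChainComplex (ModuleCat.{0} R)ᵒᵖ ℕ) (n : ℕ)

/-- `z` is a cocycle representing the class `x` in the homology of a complex in the opposite
category of modules. -/
def RepClass (z : (K.X n).unop) (x : (K.homology n).unop) : Prop :=
  ∃ c : (K.opcycles n).unop, (K.pOpcycles n).unop c = z ∧ (K.homologyι n).unop c = x

variable {K L n}

theorem homologyι_unop_surjective : Function.Surjective (K.homologyι n).unop :=
  (ModuleCat.epi_iff_surjective _).1 inferInstance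

theorem pOpcycles_unop_injective : Function.Injective (K.pOpcycles n).unop :=
  (ModuleCat.mono_iff_injective _).1 inferInstance

theorem RepClass.exists (x : (K.homology n).unop) : ∃ z, RepClass K n z x := by
  obtain ⟨c, hc⟩ := homologyι_unop_surjective x
  exact ⟨_, c, rfl, hc⟩

theorem RepClass.cocycle {z : (K.X n).unop} {x : (K.homology n).unop} (h : RepClass K n z x) :
    (K.d (n + 1) n).unop z = 0 := by
  obtain ⟨c, rfl, _⟩ := h
  rw [← ModuleCat.comp_apply, ← unop_comp, HomologicalComplex.d_pOpcycles]
  rfl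

theorem RepClass.of_cocycle (z : (K.X n).unop) (h : (K.d (n + 1) n).unop z = 0) :
    ∃ x, RepClass K n z x := by
  have ex : (ShortComplex.mk (K.d (n + 1) n) (K.pOpcycles n) (K.d_pOpcycles _ _)).Exact :=
    ShortComplex.exact_of_g_is_cokernel _ (K.opcyclesIsCokernel (n + 1) n (by simp))
  obtain ⟨c, hc⟩ := (ShortComplex.moduleCat_exact_iff _).1 ex.unop z h
  exact ⟨_, c, hc, rfl⟩

theorem RepClass.zero_iff {z : (K.X n).unop} {x : (K.homology n).unop} (h : RepClass K n z x) :
    x = 0 ↔ ∃ b, (K.d n ((ComplexShape.down ℕ).next n)).unop b = z := by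
  obtain ⟨c, rfl, rfl⟩ := h
  set j := (ComplexShape.down ℕ).next n with hj
  have ex : (ShortComplex.mk (K.homologyι n) (K.fromOpcycles n j)
      (K.homologyι_comp_fromOpcycles n j)).Exact :=
    ShortComplex.exact_of_f_is_kernel _ (K.homologyIsKernel n j hj.symm)
  constructor
  · intro h0
    obtain ⟨b, hb⟩ := (ShortComplex.moduleCat_exact_iff _).1 ex.unop c h0
    refine ⟨b, ?_⟩
    rw [← K.p_fromOpcycles n j, unop_comp]
    exact congrArg (K.pOpcycles n).unop hb
  · rintro ⟨b, hb⟩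
    rw [← K.p_fromOpcycles n j, unop_comp, ModuleCat.comp_apply] at hb
    rw [← pOpcycles_unop_injective hb, ← ModuleCat.comp_apply, ← unop_comp,
      K.homologyι_comp_fromOpcycles]
    rfl

theorem RepClass.map (f : K ⟶ L) {z : (L.X n).unop} {x : (L.homology n).unop}
    (h : RepClass L n z x) :
    RepClass K n ((f.f n).unop z) ((HomologicalComplex.homologyMap f n).unop x) := by
  obtain ⟨c, rfl, rfl⟩ := h
  refine ⟨(HomologicalComplex.opcyclesMap f n).unop c, ?_, ?_⟩
  · rw [← ModuleCat.comp_apply, ← ModuleCat.comp_apply, ← unop_comp, ← unop_comp,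
      HomologicalComplex.p_opcyclesMap]
  · rw [← ModuleCat.comp_apply, ← ModuleCat.comp_apply, ← unop_comp, ← unop_comp,
      HomologicalComplex.homologyι_naturality]

end OpComplex

section ExtMap

variable {R : Type} [CommRing R] {X Y : ModuleCat.{0} R}

/-- The complex, in the opposite category of modules, computing `Ext`. -/
noncomputable abbrev homComplex (P : ProjectiveResolution X) (M : ModuleCat.{0} R) :
    ChainComplex (ModuleCat.{0} R)ᵒᵖ ℕ :=
  (((linearYoneda R _).obj M).rightOp.mapHomologicalComplex _).obj P.complex

/-- The comparison of `Ext` with the homology of `homComplex`. -/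
noncomputable def extEquiv (P : ProjectiveResolution X) (n : ℕ) (M : ModuleCat.{0} R) :
    ((Ext R (ModuleCat.{0} R) n).obj (op X)).obj M ≃ₗ[R] ((homComplex P M).homology n).unop :=
  ((P.isoLeftDerivedObj ((linearYoneda R _).obj M).rightOp n).unop.toLinearEquiv).symm

/-- A cocycle representative of an element of `Ext`. -/
def ExtRep (P : ProjectiveResolution X) (n : ℕ) (M : ModuleCat.{0} R) (z : P.complex.X n ⟶ M)
    (x : ((Ext R (ModuleCat.{0} R) n).obj (op X)).obj M) : Prop :=
  RepClass (homComplex P M) n z (extEquiv P n M x)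

theorem ExtRep.exists (P : ProjectiveResolution X) (n : ℕ) (M : ModuleCat.{0} R)
    (x : ((Ext R (ModuleCat.{0} R) n).obj (op X)).obj M) : ∃ z, ExtRep P n M z x :=
  RepClass.exists (K := homComplex P M) (extEquiv P n M x)

theorem ExtRep.cocycle {P : ProjectiveResolution X} {n : ℕ} {M : ModuleCat.{0} R}
    {z : P.complex.X n ⟶ M} {x : ((Ext R (ModuleCat.{0} R) n).obj (op X)).obj M}
    (h : ExtRep P n M z x) : P.complex.d (n + 1) n ≫ z = 0 :=
  RepClass.cocycle h

theorem ExtRep.of_cocycle {P : ProjectiveResolution X} {n : ℕ} {M : ModuleCat.{0} R}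
    (z : P.complex.X n ⟶ M) (h : P.complex.d (n + 1) n ≫ z = 0) : ∃ x, ExtRep P n M z x := by
  obtain ⟨x, hx⟩ := RepClass.of_cocycle (K := homComplex P M) z h
  obtain ⟨y, rfl⟩ := (extEquiv P n M).surjective x
  exact ⟨y, hx⟩

theorem ExtRep.zero_iff {P : ProjectiveResolution X} {n : ℕ} {M : ModuleCat.{0} R}
    {z : P.complex.X n ⟶ M} {x : ((Ext R (ModuleCat.{0} R) n).obj (op X)).obj M}
    (h : ExtRep P n M z x) :
    x = 0 ↔ ∃ b, P.complex.d n ((ComplexShape.down ℕ).next n) ≫ b = z :=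
  (map_eq_zero_iff (extEquiv P n M) (extEquiv P n M).injective).symm.trans (RepClass.zero_iff h)

theorem ExtRep.map {P : ProjectiveResolution X} {Q : ProjectiveResolution Y} (f : X ⟶ Y) {n : ℕ}
    {M : ModuleCat.{0} R}
    {z : Q.complex.X n ⟶ M} {x : ((Ext R (ModuleCat.{0} R) n).obj (op Y)).obj M}
    (h : ExtRep Q n M z x) : ExtRep P n M ((ProjectiveResolution.lift f P Q).f n ≫ z)
      ((((Ext R (ModuleCat.{0} R) n).map f.op).app M) x) := by
  have h2 := ProjectiveResolution.isoLeftDerivedObj_inv_naturality f P Q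
    (ProjectiveResolution.lift f P Q) (ProjectiveResolution.lift_commutes_zero f P Q)
    ((linearYoneda R _).obj M).rightOp n
  have h3 : extEquiv P n M ((((Ext R (ModuleCat.{0} R) n).map f.op).app M) x) =
      (HomologicalComplex.homologyMap
        ((((linearYoneda R _).obj M).rightOp.mapHomologicalComplex _).map
          (ProjectiveResolution.lift f P Q)) n).unop (extEquiv Q n M x) :=
    congrArg (fun g => g.unop.hom x) h2
  rw [ExtRep, h3]
  exact RepClass.map ((((linearYoneda R _).obj M).rightOp.mapHomologicalComplex _).map
    (ProjectiveResolution.lift f P Q)) h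

end ExtMap

section Colimit

variable {R : Type} [CommRing R] (J : Ideal R)

/-- The projection `R / J ^ m → R / J ^ n`. -/
noncomputable abbrev powProj {n m : ℕ} (h : n ≤ m) :
    ModuleCat.of R (R ⧸ J ^ m) ⟶ ModuleCat.of R (R ⧸ J ^ n) :=
  ModuleCat.ofHom (Submodule.mapQ _ _ LinearMap.id (Ideal.pow_le_pow_right h))

theorem localCohomology_subsingleton_iff_ext (q : ℕ) (M : ModuleCat.{0} R) :
    Subsingleton ((localCohomology J q).obj M) ↔
      ∀ (n : ℕ) (x : ((Ext R (ModuleCat.{0} R) q).obj (op (ModuleCat.of R (R ⧸ J ^ n)))).obj M),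
        ∃ (m : ℕ) (h : n ≤ m), ((Ext R (ModuleCat.{0} R) q).map (powProj J h).op).app M x = 0 := by
  let D := localCohomology.diagram (localCohomology.idealPowersDiagram J) q
  have hc : IsColimit (((evaluation _ _).obj M).mapCocone (colimit.cocone D)) :=
    isColimitOfPreserves ((evaluation _ _).obj M) (colimit.isColimit D)
  have hL : (localCohomology J q).obj M =
    (((evaluation _ _).obj M).mapCocone (colimit.cocone D)).pt := rfl
  rw [hL]
  constructor
  · intro hs n x
    obtain ⟨k, f, g, hfg⟩ := Concrete.isColimit_exists_of_rep_eq
      (F := D ⋙ (evaluation _ _).obj M) hc (i := op (op n)) (j := op (op n)) x 0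
      (Subsingleton.elim (α := (((evaluation _ _).obj M).mapCocone (colimit.cocone D)).pt) _ _)
    refine ⟨k.unop.unop, f.unop.unop.down.down, ?_⟩
    have : ((D ⋙ (evaluation _ _).obj M).map g) 0 = 0 := map_zero _
    exact hfg.trans this
  · intro h
    refine ⟨fun a b => ?_⟩
    have key : ∀ a : (((evaluation _ _).obj M).mapCocone (colimit.cocone D)).pt, a = 0 := by
      intro a
      obtain ⟨k, x, rfl⟩ := Concrete.isColimit_exists_rep (F := D ⋙ (evaluation _ _).obj M) hc a
      obtain ⟨m, hm, hx⟩ := h k.unop.unop x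
      let f : k ⟶ op (op m) := (homOfLE hm).op.op
      rw [← (((evaluation _ _).obj M).mapCocone (colimit.cocone D)).w f]
      rw [ModuleCat.comp_apply]
      refine (congrArg _ ?_).trans (map_zero _)
      exact hx
    rw [key a, key b]

/-- Vanishing of local cohomology in terms of cocycles on projective resolutions. -/
theorem localCohomology_subsingleton_iff (q : ℕ) (M : ModuleCat.{0} R)
    (P : ∀ n, ProjectiveResolution (ModuleCat.of R (R ⧸ J ^ n))) {j : ℕ}
    (hj : (ComplexShape.down ℕ).next q = j) :
    Subsingleton ((localCohomology J q).obj M) ↔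
      ∀ (n : ℕ) (z : (P n).complex.X q ⟶ M), (P n).complex.d (q + 1) q ≫ z = 0 →
        ∃ (m : ℕ) (h : n ≤ m) (b : _ ⟶ M),
          (P m).complex.d q j ≫ b =
            (ProjectiveResolution.lift (powProj J h) (P m) (P n)).f q ≫ z := by
  subst hj
  rw [localCohomology_subsingleton_iff_ext]
  constructor
  · intro H n z hz
    obtain ⟨x, hx⟩ := ExtRep.of_cocycle z hz
    obtain ⟨m, h, h0⟩ := H n x
    exact ⟨m, h, (ExtRep.zero_iff (hx.map (P := P m) (powProj J h))).1 h0⟩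
  · intro H n x
    obtain ⟨z, hz⟩ := ExtRep.exists (P n) q M x
    obtain ⟨m, h, hb⟩ := H n z hz.cocycle
    exact ⟨m, h, (ExtRep.zero_iff (hz.map (P := P m) (powProj J h))).2 hb⟩

end Colimit

end KoszulColim

open CategoryTheory Limits Opposite

namespace KoszulColim

section Bridge

variable {R : Type} [CommRing R] (J : Ideal R)

theorem IsTors.exists_hom [IsNoetherianRing R] {M : ModuleCat.{0} R} {x : M} (hx : IsTors J x) :
    ∃ n₀, ∀ n, n₀ ≤ n → ∃ g : ModuleCat.of R (R ⧸ J ^ n) ⟶ M, g (Ideal.Quotient.mk _ 1) = x := by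
  obtain ⟨n₀, h₀⟩ := Ideal.exists_pow_le_of_le_radical_of_fg hx (IsNoetherian.noetherian J)
  refine ⟨n₀, fun n hn => ⟨ModuleCat.ofHom (Submodule.liftQ _ (LinearMap.toSpanSingleton R M x)
    fun a ha => ?_), ?_⟩⟩
  · exact h₀ (Ideal.pow_le_pow_right hn ha)
  · change (1 : R) • x = x
    rw [one_smul]

theorem isTors_hom {M : ModuleCat.{0} R} {n : ℕ} (g : ModuleCat.of R (R ⧸ J ^ n) ⟶ M) :
    IsTors J (g (Ideal.Quotient.mk _ 1)) := by
  intro a ha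
  refine ⟨n, ?_⟩
  rw [Ideal.mem_torsionOf_iff, ← map_smul]
  refine (congrArg g.hom ?_).trans (map_zero g.hom)
  change Ideal.Quotient.mk (J ^ n) (a ^ n • 1) = 0
  rw [Ideal.Quotient.eq_zero_iff_mem, smul_eq_mul, mul_one]
  exact Ideal.pow_mem_pow ha n

theorem quot_hom_ext {M : ModuleCat.{0} R} {n : ℕ} {g g' : ModuleCat.of R (R ⧸ J ^ n) ⟶ M}
    (h : g (Ideal.Quotient.mk _ 1) = g' (Ideal.Quotient.mk _ 1)) : g = g' := by
  ext
  exact h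

variable {J}

/-- The augmentation of a projective resolution. -/
noncomputable def aug {X : ModuleCat.{0} R} (P : ProjectiveResolution X) : P.complex.X 0 ⟶ X :=
  P.π.f 0

theorem d_aug {X : ModuleCat.{0} R} (P : ProjectiveResolution X) :
    P.complex.d 1 0 ≫ aug P = 0 := P.complex_d_comp_π_f_zero

instance {X : ModuleCat.{0} R} (P : ProjectiveResolution X) : Epi (aug P) :=
  inferInstanceAs (Epi (P.π.f 0))

theorem lift_aug {X Y : ModuleCat.{0} R} (P : ProjectiveResolution X) (Q : ProjectiveResolution Y)
    (f : X ⟶ Y) : (ProjectiveResolution.lift f P Q).f 0 ≫ aug Q = aug P ≫ f :=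
  ProjectiveResolution.lift_commutes_zero f P Q

theorem cocycle_zero_factor {X M : ModuleCat.{0} R} (P : ProjectiveResolution X)
    (z : P.complex.X 0 ⟶ M) (hz : P.complex.d 1 0 ≫ z = 0) :
    ∃ g : X ⟶ M, aug P ≫ g = z :=
  ⟨P.exact₀.desc z hz, P.exact₀.g_desc z hz⟩

theorem aug_cocycle {X M : ModuleCat.{0} R} (P : ProjectiveResolution X) (g : X ⟶ M) :
    P.complex.d 1 0 ≫ aug P ≫ g = 0 := by
  rw [← Category.assoc, d_aug, zero_comp]

variable (P : ∀ n, ProjectiveResolution (ModuleCat.of R (R ⧸ J ^ n)))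

/-- Dimension shifting on the level of cocycles. -/
theorem localCohomology_shift (S : ShortComplex (ModuleCat.{0} R)) (hS : S.ShortExact)
    [Injective S.X₂] (q : ℕ) (j : ℕ) :
    Subsingleton ((localCohomology J (q + 1)).obj S.X₁) ↔
      ∀ (n : ℕ) (z : (P n).complex.X q ⟶ S.X₃), (P n).complex.d (q + 1) q ≫ z = 0 →
        ∃ (m : ℕ) (h : n ≤ m) (e : (P m).complex.X q ⟶ S.X₂) (c : _ ⟶ S.X₃),
          (P m).complex.d (q + 1) q ≫ e = 0 ∧
          (ProjectiveResolution.lift (powProj J h) (P m) (P n)).f q ≫ z =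
            e ≫ S.g + (P m).complex.d q j ≫ c := by
  have := hS.mono_f
  have := hS.epi_g
  rw [localCohomology_subsingleton_iff J (q + 1) S.X₁ P (ChainComplex.next_nat_succ q)]
  constructor
  · intro H n z hz
    have h0 : ((P n).complex.d (q + 1) q ≫ Projective.factorThru z S.g) ≫ S.g = 0 := by
      rw [Category.assoc, Projective.factorThru_comp, hz]
    obtain ⟨m, h, b, hb⟩ := H n (hS.exact.lift _ h0) (by
      rw [← cancel_mono S.f, Category.assoc, hS.exact.lift_f, zero_comp,
        HomologicalComplex.d_comp_d_assoc, zero_comp])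
    refine ⟨m, h, (ProjectiveResolution.lift (powProj J h) (P m) (P n)).f q ≫
      Projective.factorThru z S.g - b ≫ S.f, 0, ?_, ?_⟩
    · rw [Preadditive.comp_sub, ← Category.assoc _ b, hb, Category.assoc, hS.exact.lift_f,
        HomologicalComplex.Hom.comm_assoc, sub_self]
    · simp
  · intro H n z hz
    let ψ := ((P n).exact_succ q).descToInjective (z ≫ S.f) (by
      dsimp only
      rw [← Category.assoc, hz, zero_comp])
    have hψ : (P n).complex.d (q + 1) q ≫ ψ = z ≫ S.f :=
      ((P n).exact_succ q).comp_descToInjective _ _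
    obtain ⟨m, h, e, c, he, hc⟩ := H n (ψ ≫ S.g) (by
      rw [← Category.assoc, hψ, Category.assoc, S.zero, comp_zero])
    let c' := Projective.factorThru c S.g
    have hc' : c' ≫ S.g = c := Projective.factorThru_comp _ _
    let η := (ProjectiveResolution.lift (powProj J h) (P m) (P n)).f q ≫ ψ - e -
      (P m).complex.d q j ≫ c'
    have hη : η ≫ S.g = 0 := by
      simp only [η, Preadditive.sub_comp, Category.assoc, hc', hc]
      abel
    refine ⟨m, h, hS.exact.lift η hη, ?_⟩
    rw [← cancel_mono S.f, Category.assoc, hS.exact.lift_f, Category.assoc, ← hψ]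
    simp only [η, Preadditive.comp_sub, he, HomologicalComplex.d_comp_d_assoc, zero_comp, sub_zero,
      HomologicalComplex.Hom.comm_assoc]

theorem localCohomology_vanishingRec [IsNoetherianRing R] (J : Ideal R) :
    VanishingRec J fun q M _ _ =>
      Subsingleton ((localCohomology J q).obj (ModuleCat.of R M)) where
  zero M _ _ := by
    let P := fun n => projectiveResolution (ModuleCat.of R (R ⧸ J ^ n))
    rw [localCohomology_subsingleton_iff J 0 (ModuleCat.of R M) P ChainComplex.next_nat_zero]
    constructor
    · intro H x hx
      obtain ⟨n, hn⟩ := IsTors.exists_hom J (M := ModuleCat.of R M) hx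
      obtain ⟨g, hg⟩ := hn n le_rfl
      obtain ⟨m, h, b, hb⟩ := H n (aug (P n) ≫ g) (aug_cocycle _ _)
      rw [HomologicalComplex.shape _ _ _ (by simp), zero_comp,
        ← Category.assoc, lift_aug, Category.assoc] at hb
      have h1 : powProj J h ≫ g = 0 := by
        rw [← cancel_epi (aug (P m)), comp_zero]
        exact hb.symm
      rw [← hg]
      exact congrArg (fun f => f.hom (Ideal.Quotient.mk _ 1)) h1
    · intro H n z hz
      obtain ⟨g, rfl⟩ := cocycle_zero_factor (P n) z hz
      have h1 : g = 0 := quot_hom_ext J (H _ (isTors_hom J g))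
      exact ⟨n, le_rfl, 0, by rw [h1]; simp⟩
  one M E Q _ _ _ _ _ _ i p hi hp hip hE := by
    let P := fun n => projectiveResolution (ModuleCat.of R (R ⧸ J ^ n))
    let S : ShortComplex (ModuleCat.{0} R) := ShortComplex.mk (ModuleCat.ofHom i)
      (ModuleCat.ofHom p) (by ext x; exact hip.apply_apply_eq_zero x)
    have hS : S.ShortExact :=
      { exact := (ShortComplex.moduleCat_exact_iff _).2 fun x hx => (hip x).1 hx
        mono_f := (ModuleCat.mono_iff_injective _).2 hi
        epi_g := (ModuleCat.epi_iff_surjective _).2 hp }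
    have : Injective S.X₂ := Module.injective_object_of_injective_module R E (inj := hE.injective)
    refine (localCohomology_shift P S hS 0 0).trans ?_
    constructor
    · intro H x hx
      obtain ⟨n, hn⟩ := IsTors.exists_hom J (M := ModuleCat.of R Q) hx
      obtain ⟨g, hg⟩ := hn n le_rfl
      obtain ⟨m, h, e, c, he, hc⟩ := H n (aug (P n) ≫ g) (aug_cocycle _ _)
      obtain ⟨e', rfl⟩ := cocycle_zero_factor (P m) e he
      rw [HomologicalComplex.shape _ _ _ (by simp), zero_comp, add_zero,
        ← Category.assoc, lift_aug, Category.assoc, Category.assoc] at hc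
      have h1 : powProj J h ≫ g = e' ≫ S.g := by
        rw [← cancel_epi (aug (P m))]
        exact hc
      refine ⟨_, isTors_hom J e', ?_⟩
      rw [← hg]
      exact congrArg (fun f => f.hom (Ideal.Quotient.mk _ 1)) h1.symm
    · intro H n z hz
      obtain ⟨g, rfl⟩ := cocycle_zero_factor (P n) z hz
      obtain ⟨e, he, hpe⟩ := H _ (isTors_hom J g)
      obtain ⟨k, hk⟩ := IsTors.exists_hom J (M := ModuleCat.of R E) he
      obtain ⟨e', he'⟩ := hk (max n k) (le_max_right _ _)
      refine ⟨max n k, le_max_left _ _, aug (P (max n k)) ≫ e', 0, ?_, ?_⟩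
      · exact aug_cocycle _ _
      · rw [comp_zero, add_zero, ← Category.assoc, lift_aug, Category.assoc, Category.assoc]
        congr 1
        refine quot_hom_ext J ?_
        refine Eq.trans ?_ (hpe.symm.trans (congrArg p he'.symm))
        rfl
  succ q M E Q _ _ _ _ _ _ i p hi hp hip hE := by
    let P := fun n => projectiveResolution (ModuleCat.of R (R ⧸ J ^ n))
    let S : ShortComplex (ModuleCat.{0} R) := ShortComplex.mk (ModuleCat.ofHom i)
      (ModuleCat.ofHom p) (by ext x; exact hip.apply_apply_eq_zero x)
    have hS : S.ShortExact :=
      { exact := (ShortComplex.moduleCat_exact_iff _).2 fun x hx => (hip x).1 hx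
        mono_f := (ModuleCat.mono_iff_injective _).2 hi
        epi_g := (ModuleCat.epi_iff_surjective _).2 hp }
    have : Injective S.X₂ := Module.injective_object_of_injective_module R E (inj := hE.injective)
    refine (localCohomology_shift P S hS (q + 1) q).trans ?_
    rw [localCohomology_subsingleton_iff J (q + 1) (ModuleCat.of R Q) P (ChainComplex.next_nat_succ q)]
    constructor
    · intro H n z hz
      obtain ⟨m, h, e, c, he, hc⟩ := H n z hz
      let ψ := ((P m).exact_succ q).descToInjective e he
      have hψ : (P m).complex.d (q + 1) q ≫ ψ = e :=
        ((P m).exact_succ q).comp_descToInjective _ _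
      refine ⟨m, h, ψ ≫ S.g + c, ?_⟩
      rw [Preadditive.comp_add, ← Category.assoc, hψ, hc]
    · intro H n z hz
      obtain ⟨m, h, b, hb⟩ := H n z hz
      exact ⟨m, h, 0, b, by simp, by rw [zero_comp, zero_add]; exact hb.symm⟩

/-- Koszul cohomology in the colimit computes the vanishing of local cohomology. -/
theorem localCohomology_subsingleton_iff_KV {ι : Type} [LinearOrder ι] [Fintype ι]
    [IsNoetherianRing R] [IsDomain R] (J : Ideal R) (y : ι → R)
    (h : J.radical = (Ideal.span (Set.range y)).radical) (q : ℕ) :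
    Subsingleton ((localCohomology J q).obj (ModuleCat.of R R)) ↔ KV y R q :=
  (localCohomology_vanishingRec J).unique h (KV.vanishingRec y) q R

end Bridge

end KoszulColim

namespace KoszulColim

section Transfer

variable {ι R R' : Type*} [LinearOrder ι] [CommRing R] [CommRing R'] {y : ι → R} {q : ℕ}

theorem KV.ringEquiv (e : R ≃+* R') (h : KV y R q) : KV (fun j => e (y j)) R' q :=
  KV.of_equiv (e : R ≃+ R') (fun j m => by simp) h

theorem KV.of_ring_retract (i : R →+* R') (p : R' →+* R) (hpi : ∀ x, p (i x) = x)
    (h : KV (fun j => i (y j)) R' q) : KV y R q :=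
  KV.of_retract (i : R →+ R') (p : R' →+ R) hpi (fun j m => by simp) (fun j m => by simp [hpi]) h

theorem KV.of_free [Algebra R R'] [Module.Free R R'] [Nontrivial R']
    (h : KV (fun j => algebraMap R R' (y j)) R' q) : KV y R q := by
  have : Nontrivial R := (algebraMap R R').domain_nontrivial
  let b := Module.Free.chooseBasis R R'
  obtain ⟨β⟩ := b.index_nonempty
  refine KV.of_retract (LinearMap.toSpanSingleton R R' (b β)).toAddMonoidHom
    ((Finsupp.lapply β).comp b.repr.toLinearMap).toAddMonoidHom ?_ ?_ ?_ h
  · intro m; simp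
  · intro j m
    simp [Algebra.smul_def, mul_assoc]
  · intro j m
    have : algebraMap R R' (y j) • m = y j • m := by
      rw [Algebra.smul_def (y j), smul_eq_mul]
    rw [this]
    simp

theorem KV.free [Fintype ι] [Algebra R R'] [Module.Free R R']
    (h : KV y R q) : KV (fun j => algebraMap R R' (y j)) R' q := by
  let b := Module.Free.chooseBasis R R'
  refine KV.of_equiv b.repr.symm.toAddEquiv ?_ (KV.finsupp h)
  intro j m
  simp [Algebra.smul_def]

variable (S : Submonoid R) [Algebra R R'] [IsLocalization S R']

theorem KV.localization [Fintype ι] (hS : S ≤ nonZeroDivisors R) (h : KV y R q) :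
    KV (fun j => algebraMap R R' (y j)) R' q := by
  have hinj : Function.Injective (algebraMap R R') := IsLocalization.injective R' hS
  intro N m hm hd
  obtain ⟨b, hb⟩ := IsLocalization.exist_integer_multiples_of_finite S m
  choose m' hm' using hb
  have hi : ∀ j (a : R), (algebraMap R R').toAddMonoidHom (y j • a) =
      algebraMap R R' (y j) • (algebraMap R R').toAddMonoidHom a := fun j a => by simp
  obtain ⟨k, c, hc⟩ := h N m' (fun J hJ => hinj (by rw [hm', hm J hJ, smul_zero, map_zero]))
    (fun K => hinj (by
      have h1 := kd_map y (fun j => algebraMap R R' (y j)) _ hi N m' K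
      rw [map_zero]
      refine h1.symm.trans ?_
      have h2 : (fun J => (algebraMap R R').toAddMonoidHom (m' J)) =
          fun J => algebraMap R R' b • m J := by
        funext J
        refine (hm' J).trans ?_
        rw [Algebra.smul_def, smul_eq_mul]
      rw [h2, kd_smul, hd, smul_zero]))
  obtain ⟨u, hu⟩ := IsLocalization.map_units R' b
  refine ⟨k, fun J => (↑u⁻¹ : R') • algebraMap R R' (c J), fun K => ?_⟩
  have h1 := kd_map y (fun j => algebraMap R R' (y j)) _ hi (N + k) c K
  have h3 := kphi_map y (fun j => algebraMap R R' (y j)) _ hi k m' K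
  rw [kd_smul]
  rw [hc, ← h3] at h1
  refine (congrArg _ h1).trans ?_
  have h2 : (fun J => (algebraMap R R').toAddMonoidHom (m' J)) =
      fun J => (u : R') • m J := by
    funext J
    refine (hm' J).trans ?_
    rw [hu, Algebra.smul_def, smul_eq_mul]
  rw [h2, kphi, kphi, smul_eq_mul, smul_eq_mul, smul_eq_mul, smul_eq_mul,
    mul_left_comm, Units.inv_mul_cancel_left]

theorem KV.exists_smul_of_localization [Fintype ι] (hS : S ≤ nonZeroDivisors R)
    (h : KV (fun j => algebraMap R R' (y j)) R' q) (N : ℕ) (m : Finset ι → R)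
    (hm : ∀ J, J.card ≠ q → m J = 0) (hd : ∀ K, kd y N m K = 0) :
    ∃ s ∈ S, ∃ (k : ℕ) (b : Finset ι → R), ∀ K, kd y (N + k) b K = s • kphi y k m K := by
  have hinj : Function.Injective (algebraMap R R') := IsLocalization.injective R' hS
  have hi : ∀ j (a : R), (algebraMap R R').toAddMonoidHom (y j • a) =
      algebraMap R R' (y j) • (algebraMap R R').toAddMonoidHom a := fun j a => by simp
  obtain ⟨k, b, hb⟩ := h N (fun J => (algebraMap R R').toAddMonoidHom (m J))
    (fun J hJ => by rw [hm J hJ, map_zero]) (fun K => by rw [kd_map y _ _ hi, hd, map_zero])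
  obtain ⟨s, hs⟩ := IsLocalization.exist_integer_multiples_of_finite S b
  choose b' hb' using hs
  refine ⟨s, s.2, k, b', fun K => hinj ?_⟩
  have h1 := kd_map y (fun j => algebraMap R R' (y j)) _ hi (N + k) b' K
  have h2 : (fun J => (algebraMap R R').toAddMonoidHom (b' J)) =
      fun J => algebraMap R R' s • b J := by
    funext J
    refine (hb' J).trans ?_
    rw [Algebra.smul_def, smul_eq_mul]
  refine h1.symm.trans ?_
  rw [h2, kd_smul, hb, kphi_map y _ _ hi]
  simp

end Transfer

end KoszulColim

namespace KoszulColim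

section Regular

variable {ι R : Type} {M : Type*} [LinearOrder ι] [CommRing R] [AddCommGroup M] [Module R M]

/-- Depth sensitivity of Koszul cohomology for a (weakly) regular sequence. -/
theorem kd_exact_of_regular (y : ι → R) (N : ℕ)
    (hreg : ∀ (s : Finset ι) (a : ι), (∀ j ∈ s, j < a) → ∀ f : M,
      (∃ g : ι → M, y a ^ N • f = ∑ j ∈ s, y j ^ N • g j) →
        ∃ g : ι → M, f = ∑ j ∈ s, y j ^ N • g j) (s : Finset ι) :
    ∀ q < s.card, ∀ m : Finset ι → M, (∀ J, J.card ≠ q → m J = 0) →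
      (∀ K ⊆ s, kd y N m K = 0) → ∃ b : Finset ι → M, ∀ K ⊆ s, kd y N b K = m K := by
  induction s using Finset.induction_on_max with
  | empty => intro q hq; simp at hq
  | insert a s hs ih =>
    intro q hq m hm hd
    have has : a ∉ s := fun h => lt_irrefl _ (hs a h)
    have hKs : ∀ K ⊆ s, ∀ x ∈ K, x < a := fun K hK x hx => hs x (hK hx)
    rw [Finset.card_insert_of_notMem has] at hq
    have hb : ∃ b : Finset ι → M, ∀ K ⊆ s, kd y N b K = m K := by
      rcases Nat.lt_succ_iff_lt_or_eq.1 hq with hq | rfl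
      · exact ih q hq m hm fun K hK => hd K (hK.trans (Finset.subset_insert _ _))
      · have h1 := hd (insert a s) subset_rfl
        rw [kd_insert y N m hs] at h1
        obtain ⟨g, hg⟩ := hreg s a hs (m s) ⟨fun j => (-1 : ℤ) ^ (s.card + 1) • ksign j s •
          m (insert a (s.erase j)), by
            have h2 := congrArg (fun x => (-1 : ℤ) ^ (s.card) • x) h1
            simp only [smul_add, smul_zero, smul_smul, ← mul_pow] at h2
            rw [add_comm, neg_mul_neg, one_mul, one_pow, one_smul] at h2
            rw [eq_neg_of_add_eq_zero_left h2, kd, pow_succ, Finset.smul_sum,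
              ← Finset.sum_neg_distrib]
            refine Finset.sum_congr rfl fun j _ => ?_
            rw [mul_neg_one]
            dsimp only
            rw [neg_smul, smul_neg, smul_comm (y j ^ N), smul_comm (y j ^ N)]⟩
        classical
        refine ⟨fun K => ∑ j ∈ s, if K = s.erase j then ksign j s • g j else 0, fun K hK => ?_⟩
        by_cases hKc : K.card = s.card
        · obtain rfl := Finset.eq_of_subset_of_card_le hK hKc.ge
          rw [hg]
          refine Finset.sum_congr rfl fun j hj => ?_
          dsimp only
          rw [Finset.sum_eq_single j]
          · rw [if_pos rfl, smul_comm, smul_smul, ksign, ← mul_pow]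
            simp
          · intro l hl hlj
            rw [if_neg]
            intro h
            exact hlj ((Finset.erase_injOn K hj hl h).symm)
          · intro h; exact absurd hj h
        · rw [hm K hKc]
          refine (kd_congr y N fun j hj => ?_).trans (kd_zero (M := M) y N K)
          refine Finset.sum_eq_zero fun l hl => if_neg fun h => hKc ?_
          have h3 := congrArg Finset.card h
          rw [Finset.card_erase_of_mem hj, Finset.card_erase_of_mem hl] at h3
          have := Finset.card_pos.2 ⟨j, hj⟩
          have := Finset.card_pos.2 ⟨l, hl⟩
          omega
    obtain ⟨b, hb⟩ := hb
    rcases q with _ | q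
    · refine ⟨fun _ => 0, fun K _ => ?_⟩
      rw [kd_zero]
      by_cases hKc : K = ∅
      · rw [hKc, ← hb ∅ (Finset.empty_subset _)]; simp [kd]
      · exact (hm K (by rwa [Ne, Finset.card_eq_zero])).symm
    · let b₁ : Finset ι → M := kproj q b
      have hb₁ : ∀ K ⊆ s, kd y N b₁ K = m K := by
        intro K hK
        rw [kd_kproj, kproj]
        split_ifs with h
        · exact hb K hK
        · exact (hm K h).symm
      let m₁ : Finset ι → M := fun K => m K - kd y N b₁ K
      have hm₁ : ∀ J, J.card ≠ q + 1 → m₁ J = 0 := by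
        intro J hJ
        simp only [m₁]
        rw [hm J hJ, kd_deg y N q (kproj_ne q b) J hJ, sub_zero]
      have hm₁s : ∀ K ⊆ s, m₁ K = 0 := fun K hK => sub_eq_zero.2 (hb₁ K hK).symm
      let m' : Finset ι → M := fun J => if a ∈ J then 0 else m₁ (insert a J)
      obtain ⟨b', hb'⟩ := ih q (by omega) m' (by
        intro J hJ
        by_cases haJ : a ∈ J
        · exact if_pos haJ
        · refine (if_neg haJ).trans (hm₁ _ ?_)
          rw [Finset.card_insert_of_notMem haJ]
          omega) (by
        intro K hK
        have h1 : kd y N m₁ (insert a K) = 0 := by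
          rw [kd_sub, kd_kd, hd _ (Finset.insert_subset_insert a hK), sub_zero]
        rw [kd_insert y N m₁ (hKs K hK), hm₁s K hK, smul_zero, smul_zero, add_zero] at h1
        rw [← h1]
        exact kd_congr y N fun j _ => if_neg fun h => has (hK (Finset.mem_of_mem_erase h)))
      let b₂ : Finset ι → M := fun J => if a ∈ J then b' (J.erase a) else 0
      have hb₂ : ∀ K ⊆ s, b₂ K = 0 := fun K hK => if_neg fun h => has (hK h)
      refine ⟨fun J => b₁ J + b₂ J, fun K hK => ?_⟩
      rw [kd_add, ← eq_sub_iff_add_eq']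
      change _ = m₁ K
      by_cases haK : a ∈ K
      · obtain ⟨K, haK', rfl⟩ : ∃ K', a ∉ K' ∧ insert a K' = K :=
          ⟨K.erase a, by simp, Finset.insert_erase haK⟩
        have hK' : K ⊆ s := fun x hx => (Finset.mem_insert.1 (hK (Finset.mem_insert_of_mem hx))
          ).resolve_left (fun h => haK' (h ▸ hx))
        rw [kd_insert y N _ (hKs K hK'), hb₂ K hK', smul_zero, smul_zero, add_zero]
        refine Eq.trans (kd_congr y N fun j _ => ?_) ((hb' K hK').trans (if_neg haK'))
        have : a ∉ K.erase j := fun h => haK' (Finset.mem_of_mem_erase h)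
        simp only [b₂]
        rw [if_pos (Finset.mem_insert_self _ _), Finset.erase_insert this]
      · have hK' : K ⊆ s :=
          fun x hx => (Finset.mem_insert.1 (hK hx)).resolve_left (fun h => haK (h ▸ hx))
        rw [hm₁s K hK']
        refine (kd_congr y N fun j _ => hb₂ _ ?_).trans (kd_zero (M := M) y N K)
        exact (Finset.erase_subset _ _).trans hK'

theorem X_pow_regular {k ι : Type} [Field k] [LinearOrder ι] (N : ℕ) (s : Finset ι) (a : ι)
    (ha : ∀ j ∈ s, j < a) (f : MvPolynomial ι k)
    (h : ∃ g : ι → MvPolynomial ι k, (MvPolynomial.X a : MvPolynomial ι k) ^ N • f =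
      ∑ j ∈ s, (MvPolynomial.X j : MvPolynomial ι k) ^ N • g j) :
    ∃ g : ι → MvPolynomial ι k, f = ∑ j ∈ s, (MvPolynomial.X j : MvPolynomial ι k) ^ N • g j := by
  classical
  have hspan : ∀ f : MvPolynomial ι k, (∃ g : ι → MvPolynomial ι k,
      f = ∑ j ∈ s, (MvPolynomial.X j : MvPolynomial ι k) ^ N • g j) ↔
      f ∈ Ideal.span ((fun e => MvPolynomial.monomial e (1 : k)) ''
        ((fun j => Finsupp.single j N) '' (s : Set ι))) := by
    intro f
    rw [Set.image_image, Ideal.span, Submodule.mem_span_image_finset_iff_exists_fun']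
    constructor
    · rintro ⟨g, rfl⟩
      refine ⟨g, Finset.sum_congr rfl fun j _ => ?_⟩
      rw [smul_eq_mul, smul_eq_mul, mul_comm, MvPolynomial.X_pow_eq_monomial]
    · rintro ⟨g, rfl⟩
      refine ⟨g, Finset.sum_congr rfl fun j _ => ?_⟩
      rw [smul_eq_mul, smul_eq_mul, mul_comm, MvPolynomial.X_pow_eq_monomial]
  rw [hspan, MvPolynomial.mem_ideal_span_monomial_image] at h ⊢
  intro e he
  obtain ⟨_, ⟨j, hj, rfl⟩, hle⟩ := h (Finsupp.single a N + e) (by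
    rw [MvPolynomial.mem_support_iff, smul_eq_mul, MvPolynomial.X_pow_eq_monomial,
      MvPolynomial.coeff_monomial_mul, one_mul]
    exact MvPolynomial.mem_support_iff.1 he)
  refine ⟨_, ⟨j, hj, rfl⟩, ?_⟩
  rw [Finsupp.single_le_iff] at hle ⊢
  rwa [Finsupp.add_apply, Finsupp.single_eq_of_ne (ha j hj).ne, zero_add] at hle

theorem kd_apply {β : Type*} (y : ι → R) (N : ℕ) (m : Finset ι → β → M) (K : Finset ι) (x : β) :
    kd y N m K x = kd y N (fun J => m J x) K := by
  simp [kd, Finset.sum_apply]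

/-- Exactness of Koszul complexes of powers of the variables on free modules. -/
theorem kd_X_exact {k ι β : Type} [Field k] [LinearOrder ι] [Fintype ι] (N q : ℕ)
    (hq : q < Fintype.card ι) (m : Finset ι → β → MvPolynomial ι k)
    (hm : ∀ J, J.card ≠ q → m J = 0)
    (hd : ∀ K, kd (fun j => (MvPolynomial.X j : MvPolynomial ι k)) N m K = 0) :
    ∃ b : Finset ι → β → MvPolynomial ι k,
      ∀ K, kd (fun j => (MvPolynomial.X j : MvPolynomial ι k)) N b K = m K := by
  have key : ∀ x, ∃ b : Finset ι → MvPolynomial ι k,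
      ∀ K, kd (fun j => (MvPolynomial.X j : MvPolynomial ι k)) N b K = m K x := by
    intro x
    obtain ⟨b, hb⟩ := kd_exact_of_regular (fun j => (MvPolynomial.X j : MvPolynomial ι k)) N
      (X_pow_regular N) Finset.univ q hq (fun J => m J x)
      (fun J hJ => congrFun (hm J hJ) x) (fun K _ => by rw [← kd_apply, hd K, Pi.zero_apply])
    exact ⟨b, fun K => hb K (Finset.subset_univ _)⟩
  choose b hb using key
  refine ⟨fun J x => b x J, fun K => ?_⟩
  funext x
  rw [← hb x K, kd_apply]

end Regular

end KoszulColim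

namespace KoszulColim

open MvPolynomial

section Pairing

variable {σ : Type} [Fintype σ]

/-- The product of the factorials of the exponents. -/
def wt (e : σ →₀ ℕ) : ℕ := ∏ i, (e i).factorial

theorem wt_pos (e : σ →₀ ℕ) : 0 < wt e := Finset.prod_pos fun _ _ => Nat.factorial_pos _

theorem wt_add_single (e : σ →₀ ℕ) (i : σ) : wt (e + Finsupp.single i 1) = (e i + 1) * wt e := by
  classical
  unfold wt
  rw [← Finset.mul_prod_erase _ _ (Finset.mem_univ i),
    ← Finset.mul_prod_erase _ (fun i => (e i).factorial) (Finset.mem_univ i), ← mul_assoc]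
  congr 1
  · simp [Nat.factorial_succ]
  · refine Finset.prod_congr rfl fun j hj => ?_
    have : j ≠ i := (Finset.mem_erase.1 hj).1
    simp [this]

/-- The apolar pairing on polynomials. -/
noncomputable def pairing : MvPolynomial σ ℚ →ₗ[ℚ] MvPolynomial σ ℚ →ₗ[ℚ] ℚ :=
  (basisMonomials σ ℚ).constr ℚ fun e => (wt e : ℚ) • lcoeff ℚ e

theorem pairing_monomial (e : σ →₀ ℕ) (c : ℚ) (g : MvPolynomial σ ℚ) :
    pairing (monomial e c) g = c * (wt e * coeff e g) := by
  have h : monomial e c = c • basisMonomials σ ℚ e := by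
    rw [coe_basisMonomials, smul_monomial, smul_eq_mul, mul_one]
  rw [h, map_smul, pairing, Module.Basis.constr_basis]
  simp

theorem pairing_comm (f g : MvPolynomial σ ℚ) : pairing f g = pairing g f := by
  classical
  induction f using MvPolynomial.induction_on' with
  | add p q hp hq => rw [map_add, map_add, LinearMap.add_apply, hp, hq]
  | monomial e c =>
    induction g using MvPolynomial.induction_on' with
    | add p q hp hq => rw [map_add, map_add, LinearMap.add_apply, hp, hq]
    | monomial e' c' =>
      rw [pairing_monomial, pairing_monomial, coeff_monomial, coeff_monomial]
      by_cases h : e = e'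
      · subst h; simp; ring
      · rw [if_neg h, if_neg (Ne.symm h)]; simp

theorem pairing_X_mul (i : σ) (f g : MvPolynomial σ ℚ) :
    pairing (X i * f) g = pairing f (pderiv i g) := by
  induction f using MvPolynomial.induction_on' with
  | add p q hp hq => rw [mul_add, map_add, map_add, LinearMap.add_apply, LinearMap.add_apply, hp, hq]
  | monomial e c =>
    rw [X, monomial_mul, one_mul, pairing_monomial, pairing_monomial, coeff_pderiv, add_comm,
      wt_add_single]
    push_cast
    ring

theorem pairing_pderiv (i : σ) (f g : MvPolynomial σ ℚ) :
    pairing (pderiv i f) g = pairing f (X i * g) := by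
  rw [pairing_comm, ← pairing_X_mul, pairing_comm]

theorem pairing_one (g : MvPolynomial σ ℚ) : pairing 1 g = constantCoeff g := by
  rw [← C_1, ← monomial_zero', pairing_monomial]
  simp [wt, constantCoeff_eq]

theorem pairing_eq_sum (f g : MvPolynomial σ ℚ) :
    pairing f g = ∑ e ∈ f.support, coeff e f * (wt e * coeff e g) := by
  have h : pairing f g = pairing (∑ e ∈ f.support, monomial e (coeff e f)) g := by
    rw [← f.as_sum]
  rw [h, map_sum, LinearMap.sum_apply]
  exact Finset.sum_congr rfl fun e _ => pairing_monomial _ _ _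

theorem pairing_self_nonneg (f : MvPolynomial σ ℚ) : 0 ≤ pairing f f := by
  rw [pairing_eq_sum]
  refine Finset.sum_nonneg fun e _ => ?_
  rw [mul_left_comm]
  exact mul_nonneg (by positivity) (mul_self_nonneg _)

theorem pairing_self_eq_zero {f : MvPolynomial σ ℚ} (h : pairing f f = 0) : f = 0 := by
  rw [pairing_eq_sum, Finset.sum_eq_zero_iff_of_nonneg] at h
  · by_contra hf
    obtain ⟨e, he⟩ := support_nonempty.2 hf
    have h1 := h e he
    have h2 := mem_support_iff.1 he
    have h3 := (wt_pos e).ne'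
    simp [h2, h3] at h1
  · intro e _
    rw [mul_left_comm]
    exact mul_nonneg (by positivity) (mul_self_nonneg _)

end Pairing

section Polarization

variable {α β : Type} [Fintype α] [Fintype β] [DecidableEq α]

/-- The polarization operator, the derivation `∑ l, X (a, l) ∂ / ∂ X (b, l)`. -/
noncomputable def pol (a b : α) :
    Derivation ℚ (MvPolynomial (α × β) ℚ) (MvPolynomial (α × β) ℚ) :=
  ∑ l : β, (X (a, l) : MvPolynomial (α × β) ℚ) • pderiv (b, l)

theorem pol_apply (a b : α) (f : MvPolynomial (α × β) ℚ) :
    pol a b f = ∑ l : β, X (a, l) * pderiv (b, l) f := by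
  have h := congrFun (map_sum (Derivation.coeFnAddMonoidHom (R := ℚ)
    (A := MvPolynomial (α × β) ℚ) (M := MvPolynomial (α × β) ℚ))
    (fun l : β => (X (a, l) : MvPolynomial (α × β) ℚ) • pderiv (b, l)) Finset.univ) f
  rw [Finset.sum_apply] at h
  exact h

theorem pol_X (a b c : α) (l : β) :
    pol a b (X (c, l) : MvPolynomial (α × β) ℚ) = if c = b then X (a, l) else 0 := by
  classical
  rw [pol_apply, Finset.sum_eq_single l]
  · rw [pderiv_X]
    by_cases h : c = b
    · simp [h]
    · simp [h]
  · intro l' _ hl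
    rw [pderiv_X_of_ne, mul_zero]
    intro h
    exact hl (Prod.ext_iff.1 h).2.symm
  · simp

theorem pairing_pol (a b : α) (f g : MvPolynomial (α × β) ℚ) :
    pairing (pol a b f) g = pairing f (pol b a g) := by
  simp only [pol_apply, map_sum, LinearMap.sum_apply, pairing_X_mul, pairing_pderiv]

theorem pol_comm {a b : α} (hab : a ≠ b) (f : MvPolynomial (α × β) ℚ) :
    pol a b (pol b a f) - pol b a (pol a b f) = pol a a f - pol b b f := by
  have h : ⁅(pol a b : Derivation ℚ (MvPolynomial (α × β) ℚ) (MvPolynomial (α × β) ℚ)),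
      pol b a⁆ = (pol a a - pol b b :
        Derivation ℚ (MvPolynomial (α × β) ℚ) (MvPolynomial (α × β) ℚ)) := by
    refine MvPolynomial.derivation_ext fun p => ?_
    obtain ⟨c, l⟩ := p
    rw [Derivation.commutator_apply, Derivation.sub_apply, pol_X, pol_X, pol_X, pol_X]
    by_cases h1 : c = a <;> by_cases h2 : c = b
    · exact absurd (h1.symm.trans h2) hab
    · subst h1; simp [h2, pol_X]
    · subst h2; simp [h1, pol_X]
    · simp [h1, h2]
  rw [← Derivation.commutator_apply, h, Derivation.sub_apply]

/-- Polynomials killed by all off-diagonal polarizations. -/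
noncomputable def polInv (α β : Type) [Fintype α] [Fintype β] [DecidableEq α] :
    Subalgebra ℚ (MvPolynomial (α × β) ℚ) where
  carrier := {f | ∀ a b, a ≠ b → pol a b f = 0}
  mul_mem' hf hg a b hab := by
    rw [Derivation.leibniz, hf a b hab, hg a b hab, smul_zero, smul_zero, add_zero]
  add_mem' hf hg a b hab := by rw [map_add, hf a b hab, hg a b hab, add_zero]
  algebraMap_mem' c a b _ := Derivation.map_algebraMap _ c

theorem mem_polInv {f : MvPolynomial (α × β) ℚ} :
    f ∈ polInv α β ↔ ∀ a b, a ≠ b → pol a b f = 0 := Iff.rfl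

/-- The off-diagonal Casimir operator. -/
noncomputable def casimir : MvPolynomial (α × β) ℚ →ₗ[ℚ] MvPolynomial (α × β) ℚ :=
  ∑ p ∈ (Finset.univ : Finset α).offDiag,
    (pol p.2 p.1).toLinearMap.comp (pol p.1 p.2).toLinearMap

theorem casimir_apply (f : MvPolynomial (α × β) ℚ) :
    casimir f = ∑ p ∈ (Finset.univ : Finset α).offDiag, pol p.2 p.1 (pol p.1 p.2 f) := by
  rw [casimir, LinearMap.sum_apply]
  rfl

theorem pol_mul_inv {s : MvPolynomial (α × β) ℚ} (hs : s ∈ polInv α β) {a b : α} (hab : a ≠ b)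
    (f : MvPolynomial (α × β) ℚ) : pol a b (s * f) = s * pol a b f := by
  rw [Derivation.leibniz, hs a b hab, smul_zero, add_zero, smul_eq_mul]

theorem casimir_mul_inv {s : MvPolynomial (α × β) ℚ} (hs : s ∈ polInv α β)
    (f : MvPolynomial (α × β) ℚ) : casimir (s * f) = s * casimir f := by
  rw [casimir_apply, casimir_apply, Finset.mul_sum]
  refine Finset.sum_congr rfl fun p hp => ?_
  have h : p.1 ≠ p.2 := (Finset.mem_offDiag.1 hp).2.2
  rw [pol_mul_inv hs h, pol_mul_inv hs h.symm]

theorem casimir_of_inv {f : MvPolynomial (α × β) ℚ} (hf : f ∈ polInv α β) : casimir f = 0 := by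
  rw [casimir_apply]
  refine Finset.sum_eq_zero fun p hp => ?_
  rw [hf _ _ (Finset.mem_offDiag.1 hp).2.2, map_zero]

theorem pairing_casimir (f g : MvPolynomial (α × β) ℚ) :
    pairing (casimir f) g = pairing f (casimir g) := by
  simp only [casimir_apply, map_sum, LinearMap.sum_apply, pairing_pol]

theorem casimir_eq_zero_iff {f : MvPolynomial (α × β) ℚ} : casimir f = 0 ↔ f ∈ polInv α β := by
  refine ⟨fun h a b hab => ?_, casimir_of_inv⟩
  have h1 : pairing (casimir f) f = 0 := by rw [h, map_zero, LinearMap.zero_apply]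
  rw [casimir_apply, map_sum, LinearMap.sum_apply] at h1
  simp only [pairing_pol _ _ (pol _ _ f)] at h1
  rw [Finset.sum_eq_zero_iff_of_nonneg fun _ _ => pairing_self_nonneg _] at h1
  exact pairing_self_eq_zero (h1 (a, b) (by simp [hab]))

theorem casimir_casimir {f : MvPolynomial (α × β) ℚ} (h : casimir (casimir f) = 0) :
    casimir f = 0 := by
  refine pairing_self_eq_zero ?_
  rw [pairing_casimir, h, map_zero]

theorem totalDegree_pol_le (a b : α) (f : MvPolynomial (α × β) ℚ) :
    (pol a b f).totalDegree ≤ f.totalDegree := by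
  classical
  rw [pol_apply]
  refine totalDegree_finsetSum_le fun l _ => Finset.sup_le fun e he => ?_
  rw [support_X_mul, Finset.mem_map] at he
  obtain ⟨e, he, rfl⟩ := he
  rw [mem_support_iff, coeff_pderiv] at he
  refine le_trans (le_of_eq ?_) (le_totalDegree (mem_support_iff.2 (left_ne_zero_of_mul he)))
  rw [addLeftEmbedding_apply, Finsupp.sum_add_index' (fun _ => rfl) (fun _ _ _ => rfl),
    Finsupp.sum_add_index' (fun _ => rfl) (fun _ _ _ => rfl), Finsupp.sum_single_index rfl,
    Finsupp.sum_single_index rfl, add_comm]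

theorem exists_casimir_decomp (f : MvPolynomial (α × β) ℚ) :
    ∃ f₀ ∈ polInv α β, ∃ f₁, f = f₀ + casimir f₁ := by
  let V := restrictTotalDegree (α × β) ℚ f.totalDegree
  have hV : ∀ g ∈ V, casimir g ∈ V := by
    intro g hg
    rw [casimir_apply]
    refine Submodule.sum_mem _ fun p _ => ?_
    rw [mem_restrictTotalDegree] at hg ⊢
    exact (totalDegree_pol_le _ _ _).trans ((totalDegree_pol_le _ _ _).trans hg)
  let T : V →ₗ[ℚ] V := casimir.restrict hV
  have h1 : LinearMap.ker T ⊔ LinearMap.range T = ⊤ := by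
    refine Submodule.eq_top_of_disjoint _ _ ?_ ?_
    · rw [add_comm, LinearMap.finrank_range_add_finrank_ker]
    · rw [Submodule.disjoint_def]
      rintro _ hx ⟨y, rfl⟩
      refine Subtype.ext ?_
      exact casimir_casimir (congrArg Subtype.val hx)
  obtain ⟨x, hx, _, ⟨y, rfl⟩, hxy⟩ := Submodule.mem_sup.1
    (h1 ▸ Submodule.mem_top : (⟨f, (mem_restrictTotalDegree _ _ _).2 le_rfl⟩ : V) ∈ _)
  exact ⟨x, casimir_eq_zero_iff.1 (congrArg Subtype.val hx), y, (congrArg Subtype.val hxy).symm⟩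

end Polarization

end KoszulColim

namespace KoszulColim

open MvPolynomial

section Linear

variable {σ τ : Type} [Fintype σ] [Fintype τ]

/-- The algebra map given by the linear substitution `X s ↦ ∑ t, L s t * X t`. -/
noncomputable def linSubst (L : σ → τ → ℚ) : MvPolynomial σ ℚ →ₐ[ℚ] MvPolynomial τ ℚ :=
  aeval fun s => ∑ t, C (L s t) * X t

theorem pderiv_linSubst (L : σ → τ → ℚ) (t : τ) (f : MvPolynomial σ ℚ) :
    pderiv t (linSubst L f) = ∑ s, C (L s t) * linSubst L (pderiv s f) := by
  classical
  induction f using MvPolynomial.induction_on with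
  | C a => simp [linSubst, algebraMap_eq]
  | add f g hf hg => simp [map_add, hf, hg, mul_add, Finset.sum_add_distrib]
  | mul_X f s hf =>
    have h1 : pderiv t (linSubst L (X s : MvPolynomial σ ℚ)) = C (L s t) := by
      simp [linSubst, Derivation.leibniz, pderiv_X, Pi.single_apply]
    have h2 : ∀ s', linSubst L (pderiv s' (f * X s))
        = linSubst L (pderiv s' f) * linSubst L (X s) +
          (if s = s' then linSubst L f else 0) := by
      intro s'
      rw [Derivation.leibniz, pderiv_X, Pi.single_apply]
      simp only [smul_eq_mul, map_add, map_mul]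
      split_ifs <;> simp <;> ring
    rw [map_mul, Derivation.leibniz, h1, hf]
    simp only [h2, smul_eq_mul, mul_add, Finset.sum_add_distrib, mul_ite, mul_zero,
      Finset.sum_ite_eq, Finset.mem_univ, if_true, Finset.mul_sum]
    rw [add_comm, mul_comm (linSubst L f)]
    congr 1
    refine Finset.sum_congr rfl fun _ _ => by ring

theorem constantCoeff_linSubst (L : σ → τ → ℚ) (f : MvPolynomial σ ℚ) :
    constantCoeff (linSubst L f) = constantCoeff f := by
  induction f using MvPolynomial.induction_on with
  | C a => simp [linSubst, algebraMap_eq]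
  | add f g hf hg => simp [map_add, hf, hg]
  | mul_X f s hf => simp [linSubst]

theorem pairing_linSubst (L : σ → τ → ℚ) (h : MvPolynomial τ ℚ) :
    ∀ f : MvPolynomial σ ℚ,
      pairing (linSubst (fun t s => L s t) h) f = pairing h (linSubst L f) := by
  induction h using MvPolynomial.induction_on with
  | C a =>
    intro f
    have h1 : (C a : MvPolynomial τ ℚ) = a • 1 := by rw [smul_eq_C_mul, mul_one]
    rw [h1, map_smul, map_one, map_smul, map_smul, LinearMap.smul_apply, LinearMap.smul_apply,
      pairing_one, pairing_one, constantCoeff_linSubst]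
  | add f g hf hg => intro u; simp [map_add, hf, hg]
  | mul_X g t hg =>
    intro f
    rw [mul_comm, pairing_X_mul, pderiv_linSubst, map_mul]
    have h1 : linSubst (fun t s => L s t) (X t : MvPolynomial τ ℚ) = ∑ s, C (L s t) * X s := by
      simp [linSubst]
    rw [h1, Finset.sum_mul, map_sum, map_sum, LinearMap.sum_apply]
    refine Finset.sum_congr rfl fun s _ => ?_
    rw [mul_assoc, ← smul_eq_C_mul, ← smul_eq_C_mul, map_smul, map_smul, LinearMap.smul_apply,
      pairing_X_mul, hg]

end Linear

section Scaling

variable {α β : Type} [Fintype α] [Fintype β] [DecidableEq α]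

theorem coeff_pol_self (a : α) (f : MvPolynomial (α × β) ℚ) (e : α × β →₀ ℕ) :
    coeff e (pol a a f) = (∑ l, (e (a, l) : ℚ)) * coeff e f := by
  classical
  induction f using MvPolynomial.induction_on' with
  | add f g hf hg => rw [map_add, coeff_add, coeff_add, hf, hg, mul_add]
  | monomial u c =>
    rw [pol_apply]
    simp only [X_mul_pderiv_monomial]
    rw [coeff_sum, Finset.sum_mul]
    refine Finset.sum_congr rfl fun l _ => ?_
    rw [coeff_smul, coeff_monomial]
    split_ifs with h
    · subst h; simp
    · simp

theorem row_degree_eq {f : MvPolynomial (α × β) ℚ} (hf : f ∈ polInv α β) {e : α × β →₀ ℕ}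
    (he : coeff e f ≠ 0) (a b : α) : ∑ l, e (a, l) = ∑ l, e (b, l) := by
  rcases eq_or_ne a b with rfl | hab
  · rfl
  have h := pol_comm hab f
  rw [mem_polInv.1 hf b a hab.symm, mem_polInv.1 hf a b hab, map_zero, map_zero, sub_zero] at h
  have h2 := congrArg (coeff e) h
  rw [coeff_zero, coeff_sub, coeff_pol_self, coeff_pol_self, ← sub_mul] at h2
  have h3 := (mul_eq_zero.1 h2.symm).resolve_right he
  have h4 := sub_eq_zero.1 h3
  exact_mod_cast h4

theorem isHomogeneous_pol (a b : α) {f : MvPolynomial (α × β) ℚ} {n : ℕ} (hf : f.IsHomogeneous n) :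
    (pol a b f).IsHomogeneous n := by
  rw [pol_apply]
  refine IsHomogeneous.sum _ _ _ fun l _ => ?_
  rcases n with _ | n
  · have h0 : f.totalDegree = 0 := by
      rcases eq_or_ne f 0 with rfl | h
      · simp
      · exact hf.totalDegree h
    rw [totalDegree_eq_zero_iff_eq_C.1 h0]
    simp [isHomogeneous_zero]
  · have := (isHomogeneous_X ℚ (a, l)).mul (hf.pderiv (i := (b, l)))
    rwa [add_tsub_cancel_right, add_comm] at this

theorem homogeneousComponent_mem_polInv {f : MvPolynomial (α × β) ℚ} (hf : f ∈ polInv α β)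
    (n : ℕ) : homogeneousComponent n f ∈ polInv α β := by
  rw [mem_polInv]
  intro a b hab
  have h := mem_polInv.1 hf a b hab
  rw [← sum_homogeneousComponent f, map_sum] at h
  have h2 := congrArg (homogeneousComponent n) h
  rw [map_sum, map_zero] at h2
  by_cases hn : n ∈ Finset.range (f.totalDegree + 1)
  · rw [Finset.sum_eq_single_of_mem n hn] at h2
    · rwa [homogeneousComponent_of_mem
        (isHomogeneous_pol a b (homogeneousComponent_isHomogeneous n f)), if_pos rfl] at h2
    · intro m _ hm
      rw [homogeneousComponent_of_mem
        (isHomogeneous_pol a b (homogeneousComponent_isHomogeneous m f)), if_neg hm.symm]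
  · rw [homogeneousComponent_eq_zero, map_zero]
    simpa [Nat.lt_succ_iff] using hn

theorem eval_diagonal_mul {f : MvPolynomial (α × β) ℚ} {n : ℕ}
    (hn : ∀ e ∈ f.support, ∀ a, ∑ l, e (a, l) = n) (D : α → ℚ) (Z : Matrix α β ℚ) :
    eval (fun p => D p.1 * Z p.1 p.2) f = (∏ a, D a) ^ n * eval (fun p => Z p.1 p.2) f := by
  rw [eval_eq', eval_eq', Finset.mul_sum]
  refine Finset.sum_congr rfl fun e he => ?_
  simp only [mul_pow, Finset.prod_mul_distrib]
  have : ∏ p : α × β, D p.1 ^ e p = (∏ a, D a) ^ n := by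
    rw [Fintype.prod_prod_type, ← Finset.prod_pow]
    refine Finset.prod_congr rfl fun a _ => ?_
    change ∏ l, D a ^ e (a, l) = _
    rw [Finset.prod_pow_eq_pow_sum, hn e he a]
  rw [this]; ring

theorem eval_transvection {f : MvPolynomial (α × β) ℚ} (hf : f ∈ polInv α β) {i j : α}
    (hij : i ≠ j) (c : ℚ) (Z : Matrix α β ℚ) :
    eval (fun p => Z p.1 p.2 + if p.1 = i then c * Z j p.2 else 0) f
      = eval (fun p => Z p.1 p.2) f := by
  let φ : MvPolynomial (α × β) ℚ →ₐ[ℚ] Polynomial ℚ :=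
    aeval fun p => Polynomial.C (Z p.1 p.2) +
      if p.1 = i then Polynomial.X * Polynomial.C (Z j p.2) else 0
  have hder : ∀ g, Polynomial.derivative (φ g) = φ (pol j i g) := by
    intro g
    induction g using MvPolynomial.induction_on with
    | C a => simp [φ, ← algebraMap_eq]
    | add f g hf hg => simp [map_add, hf, hg]
    | mul_X f s hf =>
      obtain ⟨a, l⟩ := s
      rw [map_mul, Polynomial.derivative_mul, hf, Derivation.leibniz, pol_X]
      simp only [smul_eq_mul, map_add, map_mul]
      have : Polynomial.derivative (φ (X (a, l))) = φ (if a = i then X (j, l) else 0) := by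
        by_cases h : a = i <;> simp [φ, h, hij.symm]
      rw [this]; ring
  have h0 : Polynomial.derivative (φ f) = 0 := by
    rw [hder, mem_polInv.1 hf j i hij.symm, map_zero]
  have h1 := Polynomial.derivative_eq_zero.1 h0
  have hev : ∀ c : ℚ, (φ f).eval c
      = eval (fun p => Z p.1 p.2 + if p.1 = i then c * Z j p.2 else 0) f := by
    intro c
    have : ((Polynomial.aeval c).comp φ) = aeval
        (fun p => Z p.1 p.2 + if p.1 = i then c * Z j p.2 else 0) := by
      ext p
      by_cases h : p.1 = i
      · simp [φ, h]; ring
      · simp [φ, h]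
    rw [← Polynomial.coe_aeval_eq_eval, ← coe_aeval_eq_eval]
    exact DFunLike.congr_fun this f
  rw [← hev, Polynomial.eq_C_of_natDegree_eq_zero h1, Polynomial.eval_C]
  have := hev 0
  rw [Polynomial.eq_C_of_natDegree_eq_zero h1, Polynomial.eval_C] at this
  rw [this]; simp

theorem eval_mul_of_polInv {f : MvPolynomial (α × β) ℚ} (hf : f ∈ polInv α β) {n : ℕ}
    (hn : ∀ e ∈ f.support, ∀ a, ∑ l, e (a, l) = n) (g : Matrix α α ℚ) :
    ∀ Z : Matrix α β ℚ,
      eval (fun p => (g * Z) p.1 p.2) f = g.det ^ n * eval (fun p => Z p.1 p.2) f := by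
  induction g using Matrix.diagonal_transvection_induction with
  | hdiag D _ =>
    intro Z
    rw [Matrix.det_diagonal, ← eval_diagonal_mul hn]
    simp [Matrix.diagonal_mul]
  | htransvec t =>
    intro Z
    rw [Matrix.TransvectionStruct.det, one_pow, one_mul, ← eval_transvection hf t.hij t.c Z]
    congr 2
    ext p
    rw [Matrix.TransvectionStruct.toMatrix, Matrix.transvection, Matrix.add_mul, Matrix.one_mul, Matrix.add_apply]
    congr 1
    split_ifs with h
    · rw [h, Matrix.single_mul_apply_same]
    · rw [Matrix.single_mul_apply_of_ne _ _ _ _ _ h]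
  | hmul A B hA hB =>
    intro Z
    rw [Matrix.mul_assoc, hA, hB, Matrix.det_mul, mul_pow, mul_assoc]

end Scaling

end KoszulColim

namespace KoszulColim

open MvPolynomial

section FFT

variable {α β : Type} [Fintype α] [Fintype β] [DecidableEq α]

/-- The maximal minor of the generic matrix on the columns `τ`. -/
noncomputable def minor (K : Type) [CommRing K] (τ : α → β) : MvPolynomial (α × β) K :=
  (Matrix.of fun i j : α => (X (i, τ j) : MvPolynomial (α × β) K)).det

theorem eval_minor {K L : Type} [CommRing K] [CommRing L] (φ : MvPolynomial (α × β) K →+* L)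
    (τ : α → β) : φ (minor K τ) = (Matrix.of fun i j : α => φ (X (i, τ j))).det := by
  rw [minor, RingHom.map_det]
  rfl

theorem derivation_det_eq_zero {R A : Type} [CommRing R] [CommRing A] [Algebra R A]
    (D : Derivation R A A) (M : Matrix α α A) (h : ∀ i j, D (M i j) = 0) : D M.det = 0 := by
  rw [Matrix.det_apply', map_sum]
  refine Finset.sum_eq_zero fun σ _ => ?_
  have h1 : D (∏ i, M (σ i) i) = 0 := by
    refine Finset.prod_induction _ (fun x => D x = 0) (fun a b ha hb => ?_) (by simp)
      fun i _ => h _ _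
    rw [Derivation.leibniz, ha, hb, smul_zero, smul_zero, add_zero]
  rw [Derivation.leibniz, h1, smul_zero, Derivation.map_intCast, smul_zero, add_zero]

theorem minor_mem_polInv (τ : α → β) : minor ℚ τ ∈ polInv α β := by
  rw [mem_polInv]
  intro a b hab
  set M : Matrix α α (MvPolynomial (α × β) ℚ) := Matrix.of fun i j : α => X (i, τ j) with hM
  have h0 : ∀ j, pol a b (M.adjugate j b) = 0 := by
    intro j
    rw [Matrix.adjugate_apply]
    refine derivation_det_eq_zero _ _ fun i l => ?_
    by_cases hi : i = b
    · subst hi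
      rw [Matrix.updateRow_self, Pi.single_apply]
      split_ifs <;> simp
    · rw [Matrix.updateRow_ne hi, hM, Matrix.of_apply, pol_X, if_neg hi]
  have h1 : minor ℚ τ = ∑ j, M b j * M.adjugate j b := by
    rw [← Matrix.mul_apply, Matrix.mul_adjugate]
    simp [minor, hM]
  have h2 : ∑ j, M a j * M.adjugate j b = 0 := by
    rw [← Matrix.mul_apply, Matrix.mul_adjugate]
    simp [hab]
  rw [h1, map_sum, ← h2]
  refine Finset.sum_congr rfl fun j _ => ?_
  rw [Derivation.leibniz, h0, smul_zero, zero_add, hM, Matrix.of_apply, pol_X, if_pos rfl,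
    smul_eq_mul, mul_comm, Matrix.of_apply]

theorem det_mul_transpose_expand {A : Type} [CommRing A] (U V : Matrix α β A) :
    (U * V.transpose).det
      = ∑ τ : α → β, (∏ i, U i (τ i)) * (Matrix.of fun i j => V i (τ j)).det := by
  classical
  rw [← Matrix.det_transpose, Matrix.transpose_mul, Matrix.transpose_transpose]
  simp only [Matrix.det_apply', Matrix.mul_apply, Finset.prod_univ_sum, Finset.mul_sum,
    Fintype.piFinset_univ]
  rw [Finset.sum_comm]
  refine Finset.sum_congr rfl fun τ _ => Finset.sum_congr rfl fun σ _ => ?_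
  simp only [Matrix.transpose_apply, Finset.prod_mul_distrib, Matrix.of_apply]
  ring

theorem mem_adjoin_of_row_degree {f : MvPolynomial (α × β) ℚ} (hf : f ∈ polInv α β) {n : ℕ}
    (hn : ∀ e ∈ f.support, ∀ a, ∑ l, e (a, l) = n) :
    f ∈ Algebra.adjoin ℚ (Set.range fun τ : α → β => minor ℚ τ) := by
  set Δ : MvPolynomial (α × α) ℚ := (Matrix.mvPolynomialX α α ℚ).det with hΔ
  set c : ℚ := pairing (Δ ^ n) (Δ ^ n) with hc
  have hc0 : c ≠ 0 := fun h =>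
    pow_ne_zero n (Matrix.det_mvPolynomialX_ne_zero α ℚ) (pairing_self_eq_zero h)
  have key : f = ∑ ν : Fin n → α → β,
      C (c⁻¹ * pairing (∏ k, ∏ i, X (i, ν k i)) f) * ∏ k, minor ℚ (ν k) := by
    refine MvPolynomial.funext fun z => ?_
    set Z : Matrix α β ℚ := Matrix.of fun i l => z (i, l) with hZ
    let L : α × β → α × α → ℚ := fun p q => if p.1 = q.1 then Z q.2 p.2 else 0
    have hLX : ∀ p, linSubst L (X p) = ∑ j, C (Z j p.2) * X (p.1, j) := by
      intro p
      simp only [linSubst, aeval_X, L]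
      rw [Fintype.sum_prod_type, Finset.sum_eq_single p.1]
      · simp
      · intro b _ hb; simp [hb.symm]
      · simp
    have hLT : ∀ q, linSubst (fun t s => L s t) (X q) = ∑ l, C (Z q.2 l) * X (q.1, l) := by
      intro q
      simp only [linSubst, aeval_X, L]
      rw [Fintype.sum_prod_type, Finset.sum_eq_single q.1]
      · simp
      · intro b _ hb; simp [hb]
      · simp
    have h1 : linSubst L f = C (eval z f) * Δ ^ n := by
      refine MvPolynomial.funext fun g => ?_
      set G : Matrix α α ℚ := Matrix.of fun i l => g (i, l) with hG
      have e1 : eval g (linSubst L f) = eval (fun p => (G * Z) p.1 p.2) f := by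
        have : ((aeval g : MvPolynomial (α × α) ℚ →ₐ[ℚ] ℚ).comp (linSubst L))
            = aeval (fun p : α × β => (G * Z) p.1 p.2) := by
          ext p
          rw [AlgHom.comp_apply, hLX]
          simp [Matrix.mul_apply, hG, mul_comm]
        rw [← coe_aeval_eq_eval, ← coe_aeval_eq_eval]
        exact DFunLike.congr_fun this f
      rw [e1, eval_mul_of_polInv hf hn, map_mul, eval_C, map_pow, hΔ, RingHom.map_det, mul_comm]
      congr 2
      · congr 1
        ext i j
        simp [hG]
    set U : Matrix α β (MvPolynomial (α × β) ℚ) := Matrix.of fun i l => X (i, l) with hU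
    set V : Matrix α β (MvPolynomial (α × β) ℚ) := Z.map C with hV
    have h2 : linSubst (fun t s => L s t) Δ
        = ∑ τ : α → β, C (eval z (minor ℚ τ)) * ∏ i, X (i, τ i) := by
      have e1 : linSubst (fun t s => L s t) Δ
          = (U * V.transpose).det := by
        rw [hΔ, AlgHom.map_det]
        congr 1
        ext1 i j
        rw [AlgHom.mapMatrix_apply, Matrix.map_apply, Matrix.mvPolynomialX_apply, hLT,
          Matrix.mul_apply]
        simp [mul_comm, hU, hV]
      rw [e1, det_mul_transpose_expand]
      refine Finset.sum_congr rfl fun τ _ => ?_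
      rw [mul_comm, eval_minor, RingHom.map_det]
      congr 2
      ext1 i j
      simp [hZ, hV]
    have h3 : eval z f * c = ∑ ν : Fin n → α → β,
        (∏ k, eval z (minor ℚ (ν k))) * pairing (∏ k, ∏ i, X (i, ν k i)) f := by
      have e1 := pairing_linSubst L (Δ ^ n) f
      rw [h1, ← smul_eq_C_mul, map_smul, ← hc, map_pow, h2, Fintype.sum_pow, map_sum,
        LinearMap.sum_apply, smul_eq_mul] at e1
      rw [← e1]
      refine Finset.sum_congr rfl fun ν _ => ?_
      rw [Finset.prod_mul_distrib, ← map_prod C, ← smul_eq_C_mul, map_smul, LinearMap.smul_apply,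
        smul_eq_mul]
    have h4 : eval z f = c⁻¹ * (eval z f * c) := by field_simp
    rw [h4, h3, map_sum, Finset.mul_sum]
    refine Finset.sum_congr rfl fun ν _ => ?_
    rw [map_mul, eval_C, map_prod (eval z)]
    ring
  rw [key]
  refine sum_mem fun ν _ => mul_mem ?_ (prod_mem fun k _ => Algebra.subset_adjoin ⟨_, rfl⟩)
  exact (Algebra.adjoin ℚ _).algebraMap_mem _

theorem polInv_eq_adjoin [Nonempty α] :
    polInv α β = Algebra.adjoin ℚ (Set.range fun τ : α → β => minor ℚ τ) := by
  refine le_antisymm (fun f hf => ?_)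
    (Algebra.adjoin_le (by rintro _ ⟨τ, rfl⟩; exact minor_mem_polInv τ))
  rw [← sum_homogeneousComponent f]
  refine sum_mem fun m _ => ?_
  have hm := homogeneousComponent_mem_polInv hf m
  set g := homogeneousComponent m f with hg
  have hgh : g.IsHomogeneous m := homogeneousComponent_isHomogeneous m f
  refine mem_adjoin_of_row_degree hm (n := m / Fintype.card α) fun e he a => ?_
  have h1 : ∑ a', ∑ l, e (a', l) = m := by
    rw [← Fintype.sum_prod_type (fun p => e p), ← hgh (mem_support_iff.1 he),
      Finsupp.weight_apply, Finsupp.sum_fintype _ _ (by simp)]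
    simp
  rw [Finset.sum_congr rfl fun a' _ => row_degree_eq hm (mem_support_iff.1 he) a' a] at h1
  rw [Finset.sum_const, Finset.card_univ, smul_eq_mul] at h1
  rw [← h1, Nat.mul_div_cancel_left _ Fintype.card_pos]

end FFT

end KoszulColim

namespace KoszulColim

open MvPolynomial

section Plucker

variable {α β : Type} [Fintype α] [Fintype β] [DecidableEq α]

theorem minor_eq_zero (K : Type) [CommRing K] {τ : α → β} (h : ¬ Function.Injective τ) :
    minor K τ = 0 := by
  simp only [Function.Injective, not_forall] at h
  obtain ⟨a, b, hab, hne⟩ := h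
  exact Matrix.det_zero_of_column_eq hne fun i => by simp [hab]

theorem minor_comp_perm (K : Type) [CommRing K] (τ : α → β) (π : Equiv.Perm α) :
    minor K (τ ∘ π) = Equiv.Perm.sign π * minor K τ := by
  rw [minor, minor, ← Matrix.det_permute']
  rfl

theorem minor_update (K : Type) [CommRing K] (τ : α → β) (b : α) (l : β) :
    minor K (Function.update τ b l)
      = Matrix.cramer (Matrix.of fun i j : α => (X (i, τ j) : MvPolynomial (α × β) K))
        (fun i => X (i, l)) b := by
  rw [Matrix.cramer_apply, minor]
  congr 1
  ext1 i j
  rw [Matrix.updateCol_apply, Matrix.of_apply, Matrix.of_apply, Function.update_apply]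
  split_ifs <;> rfl

/-- The Plücker exchange relation. -/
theorem minor_mul_minor (K : Type) [CommRing K] (σ τ : α → β) (a : α) :
    minor K σ * minor K τ
      = ∑ b, minor K (Function.update σ a (τ b)) * minor K (Function.update τ b (σ a)) := by
  set Mσ : Matrix α α (MvPolynomial (α × β) K) := Matrix.of fun i j => X (i, σ j) with hσ
  set Mτ : Matrix α α (MvPolynomial (α × β) K) := Matrix.of fun i j => X (i, τ j) with hτ
  have h1 : Mτ.mulVec (Matrix.cramer Mτ fun i => X (i, σ a)) = Mτ.det • fun i => X (i, σ a) :=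
    Matrix.mulVec_cramer _ _
  have h2 : minor K σ * minor K τ
      = Matrix.cramer Mσ (Mτ.det • fun i => X (i, σ a)) a := by
    rw [map_smul, Pi.smul_apply, ← minor_update, Function.update_eq_self, smul_eq_mul, mul_comm]
    rfl
  rw [h2, ← h1, Matrix.mulVec_eq_sum, map_sum, Finset.sum_apply]
  refine Finset.sum_congr rfl fun b _ => ?_
  rw [op_smul_eq_smul, map_smul, Pi.smul_apply, minor_update K σ, minor_update K τ, smul_eq_mul,
    mul_comm]
  rfl

end Plucker

section Filtration

variable {r s : ℕ}

/-- The sum of the column indices. -/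
def weight (τ : Fin r → Fin s) : ℕ := ∑ i, (τ i : ℕ)

theorem exists_strictMono (K : Type) [CommRing K] (τ : Fin r → Fin s) :
    minor K τ = 0 ∨ ∃ σ : Fin r → Fin s, StrictMono σ ∧ weight σ = weight τ ∧
      (minor K τ = minor K σ ∨ minor K τ = - minor K σ) := by
  by_cases h : Function.Injective τ
  · right
    refine ⟨τ ∘ Tuple.sort τ, (Tuple.monotone_sort τ).strictMono_of_injective
      (h.comp (Tuple.sort τ).injective), ?_, ?_⟩
    · exact Equiv.sum_comp (Tuple.sort τ) fun i => (τ i : ℕ)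
    · rw [minor_comp_perm]
      rcases Int.units_eq_one_or (Equiv.Perm.sign (Tuple.sort τ)) with h | h <;> simp [h]
  · exact Or.inl (minor_eq_zero K h)

/-- The span of the maximal minors of weight less than `w`. -/
noncomputable def lowSpan (r s w : ℕ) : Submodule ℚ (MvPolynomial (Fin r × Fin s) ℚ) :=
  Submodule.span ℚ {p | ∃ τ : Fin r → Fin s, weight τ < w ∧ minor ℚ τ = p}

/-- The span of all the maximal minors. -/
noncomputable def minorSpan (r s : ℕ) : Submodule ℚ (MvPolynomial (Fin r × Fin s) ℚ) :=
  Submodule.span ℚ (Set.range fun τ : Fin r → Fin s => minor ℚ τ)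

theorem lowSpan_le (w : ℕ) : lowSpan r s w ≤ minorSpan r s :=
  Submodule.span_mono (by rintro _ ⟨τ, _, rfl⟩; exact ⟨τ, rfl⟩)

theorem minor_mem_minorSpan (τ : Fin r → Fin s) : minor ℚ τ ∈ minorSpan r s :=
  Submodule.subset_span ⟨τ, rfl⟩

theorem minor_mem_lowSpan {w : ℕ} {τ : Fin r → Fin s} (h : weight τ < w) :
    minor ℚ τ ∈ lowSpan r s w :=
  Submodule.subset_span ⟨τ, h, rfl⟩

theorem weight_update (τ : Fin r → Fin s) (b : Fin r) (l : Fin s) (h : l < τ b) :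
    weight (Function.update τ b l) < weight τ := by
  refine Finset.sum_lt_sum (fun i _ => ?_) ⟨b, Finset.mem_univ _, by simpa using h⟩
  rw [Function.update_apply]
  split_ifs with hi
  · subst hi; exact h.le
  · exact le_rfl

theorem minor_mul_mem_of_min {w : ℕ} {σ τ : Fin r → Fin s} (hτ : weight τ = w) {a : Fin r}
    (ha : σ a ∉ Set.range τ) (hmin : ∀ b, τ b ∉ Set.range σ → σ a ≤ τ b) :
    minor ℚ σ * minor ℚ τ ∈ lowSpan r s w * minorSpan r s := by
  rw [minor_mul_minor ℚ σ τ a]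
  refine sum_mem fun b _ => ?_
  by_cases hb : τ b ∈ Set.range σ
  · obtain ⟨c, hc⟩ := hb
    rw [minor_eq_zero, zero_mul]
    · exact zero_mem _
    · intro hinj
      have hca : c ≠ a := by rintro rfl; exact ha ⟨b, hc.symm⟩
      refine hca (hinj ?_)
      rw [Function.update_self, Function.update_of_ne hca, hc]
  · rw [mul_comm (minor ℚ _)]
    refine Submodule.mul_mem_mul (minor_mem_lowSpan ?_) (minor_mem_minorSpan _)
    rw [← hτ]
    exact weight_update _ _ _ (lt_of_le_of_ne (hmin b hb) fun h => ha ⟨b, h.symm⟩)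

theorem minor_mul_mem {w : ℕ} {σ τ : Fin r → Fin s} (hσ : StrictMono σ) (hτ : StrictMono τ)
    (hne : σ ≠ τ) (hσw : weight σ = w) (hτw : weight τ = w) :
    minor ℚ σ * minor ℚ τ ∈ lowSpan r s w * minorSpan r s := by
  classical
  have hr : Set.range σ ≠ Set.range τ := fun h => hne ((StrictMono.range_inj hσ hτ).1 h)
  have hS : (symmDiff (Finset.univ.image σ) (Finset.univ.image τ)).Nonempty := by
    rw [Finset.nonempty_iff_ne_empty, ← Finset.bot_eq_empty, Ne, symmDiff_eq_bot]
    intro h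
    apply hr
    have := congrArg (fun T : Finset (Fin s) => (T : Set (Fin s))) h
    simpa using this
  obtain ⟨e, he, hmin⟩ := Finset.exists_min_image _ id hS
  simp only [Finset.mem_symmDiff, Finset.mem_image, Finset.mem_univ, true_and, id] at he hmin
  rcases he with ⟨⟨a, rfl⟩, h2⟩ | ⟨⟨a, rfl⟩, h2⟩
  · exact minor_mul_mem_of_min hτw h2 fun b hb => hmin _ (Or.inr ⟨⟨b, rfl⟩, hb⟩)
  · rw [mul_comm (minor ℚ _)]
    exact minor_mul_mem_of_min hσw h2 fun b hb => hmin _ (Or.inl ⟨⟨b, rfl⟩, hb⟩)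

/-- The sum of the maximal minors of given weight. -/
noncomputable def hsop (K : Type) [CommRing K] (r s : ℕ) (i : Fin (r * (s - r) + 1)) :
    MvPolynomial (Fin r × Fin s) K :=
  open Classical in
  ∑ σ : Fin r → Fin s with StrictMono σ ∧ weight σ = ∑ j : Fin r, (j : ℕ) + i, minor K σ

theorem weight_bounds {σ : Fin r → Fin s} (hσ : StrictMono σ) :
    ∃ i : Fin (r * (s - r) + 1), weight σ = ∑ j : Fin r, (j : ℕ) + i := by
  have h1 : ∀ j : Fin r, (j : ℕ) ≤ σ j ∧ (σ j : ℕ) ≤ j + (s - r) := by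
    intro j
    have hlow : ∀ n (hn : n < r), n ≤ σ ⟨n, hn⟩ := by
      intro n
      induction n with
      | zero => intro _; exact Nat.zero_le _
      | succ n ih =>
        intro hn
        have := hσ (show (⟨n, by omega⟩ : Fin r) < ⟨n + 1, hn⟩ from Nat.lt_succ_self n)
        have h3 := ih (by omega)
        rw [Fin.lt_def] at this
        omega
    have hup : ∀ n, ∀ (hn : n < r), (σ ⟨r - 1 - n, by omega⟩ : ℕ) + n + 1 ≤ s := by
      intro n
      induction n with
      | zero => intro hn; exact (σ _).2
      | succ n ih =>
        intro hn
        have := hσ (show (⟨r - 1 - (n + 1), by omega⟩ : Fin r) < ⟨r - 1 - n, by omega⟩ from by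
          rw [Fin.lt_def]; dsimp; omega)
        have h3 := ih (by omega)
        rw [Fin.lt_def] at this
        omega
    refine ⟨hlow j j.2, ?_⟩
    have h4 := hup (r - 1 - j) (by omega)
    have h5 : (⟨r - 1 - (r - 1 - (j : ℕ)), by omega⟩ : Fin r) = j := by
      ext; dsimp; omega
    rw [h5] at h4
    omega
  have h2 : ∑ j : Fin r, (j : ℕ) ≤ weight σ := Finset.sum_le_sum fun j _ => (h1 j).1
  have h3 : weight σ ≤ ∑ j : Fin r, (j : ℕ) + r * (s - r) := by
    refine (Finset.sum_le_sum fun j _ => (h1 j).2).trans_eq ?_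
    simp [Finset.sum_add_distrib]
  exact ⟨⟨weight σ - ∑ j : Fin r, (j : ℕ), by omega⟩, by dsimp; omega⟩

/-- The span of the elements `hsop`. -/
noncomputable def hsopSpan (r s : ℕ) : Submodule ℚ (MvPolynomial (Fin r × Fin s) ℚ) :=
  Submodule.span ℚ (Set.range (hsop ℚ r s))

theorem hsopSpan_le : hsopSpan r s ≤ minorSpan r s := by
  refine Submodule.span_le.2 ?_
  rintro _ ⟨i, rfl⟩
  exact sum_mem fun σ _ => minor_mem_minorSpan σ

theorem lowSpan_mul_lowSpan (w : ℕ) : lowSpan r s (w + 1) * lowSpan r s (w + 1)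
    ≤ hsopSpan r s * minorSpan r s + lowSpan r s w * minorSpan r s := by
  classical
  have hneg : ∀ {p q u : MvPolynomial (Fin r × Fin s) ℚ}
      {V : Submodule ℚ (MvPolynomial (Fin r × Fin s) ℚ)},
      (p = q ∨ p = -q) → q * u ∈ V → p * u ∈ V := by
    rintro p q u V (rfl | rfl) h
    · exact h
    · rw [neg_mul]; exact neg_mem h
  have key : ∀ σ τ : Fin r → Fin s, StrictMono σ → StrictMono τ → weight σ = w → weight τ = w →
      minor ℚ σ * minor ℚ τ
        ∈ hsopSpan r s * minorSpan r s + lowSpan r s w * minorSpan r s := by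
    intro σ τ hσ hτ hσw hτw
    by_cases hne : σ = τ
    · subst hne
      obtain ⟨i, hi⟩ := weight_bounds hσ
      have h1 : minor ℚ σ = hsop ℚ r s i -
          ∑ σ' ∈ (Finset.univ.filter fun σ' : Fin r → Fin s =>
            StrictMono σ' ∧ weight σ' = ∑ j : Fin r, (j : ℕ) + i).erase σ, minor ℚ σ' := by
        rw [hsop, ← Finset.add_sum_erase _ _ (show σ ∈ Finset.univ.filter fun σ' : Fin r → Fin s =>
            StrictMono σ' ∧ weight σ' = ∑ j : Fin r, (j : ℕ) + i by simp [hσ, hi])]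
        abel
      nth_rewrite 1 [h1]
      rw [sub_mul, Finset.sum_mul]
      refine sub_mem ((le_sup_left : hsopSpan r s * minorSpan r s ≤ _)
        (Submodule.mul_mem_mul (Submodule.subset_span ⟨i, rfl⟩) (minor_mem_minorSpan _)))
        (sum_mem fun σ' hσ' => ?_)
      rw [Finset.mem_erase, Finset.mem_filter] at hσ'
      exact (le_sup_right : lowSpan r s w * minorSpan r s ≤ _)
        (minor_mul_mem hσ'.2.2.1 hσ hσ'.1 (by rw [hσ'.2.2.2, ← hi, hσw]) hσw)
    · exact (le_sup_right : lowSpan r s w * minorSpan r s ≤ _)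
        (minor_mul_mem hσ hτ hne hσw hτw)
  rw [lowSpan, Submodule.span_mul_span, Submodule.span_le]
  rintro _ ⟨_, ⟨σ, hσ, rfl⟩, _, ⟨τ, hτ, rfl⟩, rfl⟩
  change minor ℚ σ * minor ℚ τ ∈ _
  rcases (Nat.lt_succ_iff_lt_or_eq.1 hσ) with hσ | hσ
  · exact (le_sup_right : lowSpan r s w * minorSpan r s ≤ _)
      (Submodule.mul_mem_mul (minor_mem_lowSpan hσ) (minor_mem_minorSpan _))
  rcases (Nat.lt_succ_iff_lt_or_eq.1 hτ) with hτ | hτ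
  · rw [mul_comm (minor ℚ _)]
    exact (le_sup_right : lowSpan r s w * minorSpan r s ≤ _)
      (Submodule.mul_mem_mul (minor_mem_lowSpan hτ) (minor_mem_minorSpan _))
  rcases exists_strictMono ℚ σ with h | ⟨σ', hσ', hσw, hs⟩
  · rw [h, zero_mul]; exact zero_mem _
  rcases exists_strictMono ℚ τ with h | ⟨τ', hτ', hτw, ht⟩
  · rw [h, mul_zero]; exact zero_mem _
  refine hneg hs ?_
  rw [mul_comm (minor ℚ _)]
  refine hneg ht ?_
  rw [mul_comm (minor ℚ _)]
  exact key σ' τ' hσ' hτ' (by omega) (by omega)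

theorem add_pow_le {S : Type*} [IdemCommSemiring S] {a b T : S} (ha : a ≤ T) (hb : b ≤ T) (n : ℕ) :
    (a + b) ^ (n + 1) ≤ a * T ^ n + b ^ (n + 1) := by
  induction n with
  | zero => simp
  | succ n ih =>
    calc (a + b) ^ (n + 2) = (a + b) ^ (n + 1) * a + (a + b) ^ (n + 1) * b := by ring
      _ ≤ T ^ (n + 1) * a + (a * T ^ n + b ^ (n + 1)) * b := by
        have hab : a + b ≤ T := by rw [add_eq_sup]; exact sup_le ha hb
        exact add_le_add (mul_le_mul' (pow_le_pow_left' hab _) le_rfl) (mul_le_mul' ih le_rfl)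
      _ = T ^ (n + 1) * a + (a * T ^ n * b + b ^ (n + 2)) := by ring
      _ ≤ T ^ (n + 1) * a + (T ^ (n + 1) * a + b ^ (n + 2)) := by
        refine add_le_add le_rfl (add_le_add ?_ le_rfl)
        calc a * T ^ n * b ≤ a * T ^ n * T := mul_le_mul' le_rfl hb
          _ = T ^ (n + 1) * a := by ring
      _ = (T ^ (n + 1) * a + T ^ (n + 1) * a) + b ^ (n + 2) := by rw [add_assoc]
      _ = a * T ^ (n + 1) + b ^ (n + 2) := by rw [add_idem, mul_comm]

theorem exists_minorSpan_pow_le :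
    ∃ n, minorSpan r s ^ (n + 1) ≤ hsopSpan r s * minorSpan r s ^ n := by
  have key : ∀ w, ∃ n, lowSpan r s w ^ (n + 1) ≤ hsopSpan r s * minorSpan r s ^ n := by
    intro w
    induction w with
    | zero =>
      refine ⟨0, ?_⟩
      have : lowSpan r s 0 = ⊥ := by simp [lowSpan]
      rw [this, zero_add, pow_one]
      exact bot_le
    | succ w ih =>
      obtain ⟨n, hn⟩ := ih
      refine ⟨2 * n + 1, ?_⟩
      have hV := lowSpan_le (r := r) (s := s) w
      have hY := hsopSpan_le (r := r) (s := s)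
      have hVV := lowSpan_mul_lowSpan (r := r) (s := s) w
      generalize minorSpan r s = A at *
      calc lowSpan r s (w + 1) ^ (2 * n + 1 + 1)
          = (lowSpan r s (w + 1) * lowSpan r s (w + 1)) ^ (n + 1) := by ring
        _ ≤ (hsopSpan r s * A + lowSpan r s w * A) ^ (n + 1) := pow_le_pow_left' hVV _
        _ ≤ hsopSpan r s * A * (A * A) ^ n + (lowSpan r s w * A) ^ (n + 1) :=
            add_pow_le (mul_le_mul' hY le_rfl) (mul_le_mul' hV le_rfl) n
        _ = hsopSpan r s * A ^ (2 * n + 1) + lowSpan r s w ^ (n + 1) * A ^ (n + 1) := by ring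
        _ ≤ hsopSpan r s * A ^ (2 * n + 1) + hsopSpan r s * A ^ n * A ^ (n + 1) :=
            add_le_add le_rfl (mul_le_mul' hn le_rfl)
        _ = hsopSpan r s * A ^ (2 * n + 1) + hsopSpan r s * A ^ (2 * n + 1) := by ring
        _ = hsopSpan r s * A ^ (2 * n + 1) := add_idem _
  obtain ⟨n, hn⟩ := key (r * s + 1)
  refine ⟨n, le_trans (pow_le_pow_left' ?_ _) hn⟩
  refine Submodule.span_mono ?_
  rintro _ ⟨τ, rfl⟩
  refine ⟨τ, Nat.lt_succ_of_le ?_, rfl⟩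
  refine (Finset.sum_le_sum fun i _ => (τ i).2.le).trans ?_
  simp

end Filtration

end KoszulColim

namespace KoszulColim

open MvPolynomial

section Finiteness

variable {r s : ℕ}

theorem exists_minor_pow_mem : ∃ n, ∀ τ : Fin r → Fin s,
    minor ℚ τ ^ n ∈ Ideal.span (Set.range (hsop ℚ r s)) := by
  obtain ⟨n, hn⟩ := exists_minorSpan_pow_le (r := r) (s := s)
  refine ⟨n + 1, fun τ => ?_⟩
  have h1 := hn (Submodule.pow_mem_pow _ (minor_mem_minorSpan τ) (n + 1))
  refine Submodule.mul_induction_on h1 (fun y hy x _ => Ideal.mul_mem_right _ _ ?_)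
    fun x y hx hy => add_mem hx hy
  induction hy using Submodule.span_induction with
  | mem x hx => exact Ideal.subset_span hx
  | zero => exact zero_mem _
  | add x y _ _ hx hy => exact add_mem hx hy
  | smul c x _ hx => rw [smul_eq_C_mul]; exact Ideal.mul_mem_left _ _ hx

theorem map_minor {K : Type} [Field K] [Algebra ℚ K] (τ : Fin r → Fin s) :
    map (algebraMap ℚ K) (minor ℚ τ) = minor K τ := by
  rw [eval_minor]
  simp [minor]

theorem map_hsop {K : Type} [Field K] [Algebra ℚ K] (i : Fin (r * (s - r) + 1)) :
    map (algebraMap ℚ K) (hsop ℚ r s i) = hsop K r s i := by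
  simp only [hsop, map_sum, map_minor]

theorem radical_hsop (K : Type) [Field K] [CharZero K] :
    (Ideal.span (Set.range fun τ : Fin r → Fin s => minor K τ)).radical
      = (Ideal.span (Set.range (hsop K r s))).radical := by
  apply le_antisymm
  · rw [Ideal.radical_le_radical_iff, Ideal.span_le]
    rintro _ ⟨τ, rfl⟩
    obtain ⟨n, hn⟩ := exists_minor_pow_mem (r := r) (s := s)
    refine ⟨n, ?_⟩
    have h := Ideal.mem_map_of_mem (map (algebraMap ℚ K)) (hn τ)
    rw [Ideal.map_span, ← Set.range_comp, map_pow, map_minor] at h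
    convert h using 3
    ext1 i
    exact (map_hsop i).symm
  · refine Ideal.radical_mono (Ideal.span_le.2 ?_)
    rintro _ ⟨i, rfl⟩
    exact sum_mem fun σ _ => Ideal.subset_span ⟨σ, rfl⟩

theorem hsop_mem_polInv (i : Fin (r * (s - r) + 1)) : hsop ℚ r s i ∈ polInv (Fin r) (Fin s) :=
  sum_mem fun σ _ => minor_mem_polInv σ

theorem exists_fg_submodule (hr : 0 < r) {B : Type} [CommRing B] [Algebra ℚ B]
    [Algebra B (MvPolynomial (Fin r × Fin s) ℚ)]
    [IsScalarTower ℚ B (MvPolynomial (Fin r × Fin s) ℚ)]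
    (hB : ∀ i, hsop ℚ r s i ∈ (algebraMap B (MvPolynomial (Fin r × Fin s) ℚ)).range) :
    ∃ N : Submodule B (MvPolynomial (Fin r × Fin s) ℚ), N.FG ∧ 1 ∈ N ∧
      ∀ f ∈ polInv (Fin r) (Fin s), ∀ x ∈ N, f * x ∈ N := by
  classical
  have : Nonempty (Fin r) := ⟨⟨0, hr⟩⟩
  obtain ⟨n, hn⟩ := exists_minorSpan_pow_le (r := r) (s := s)
  set A := minorSpan r s with hA
  have hfg : ((1 + A) ^ n).FG := by
    refine Submodule.FG.pow (Submodule.FG.sup ?_ ?_) n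
    · rw [Submodule.one_eq_span]; exact Submodule.fg_span_singleton 1
    · exact Submodule.fg_span (Set.finite_range _)
  obtain ⟨S, hS⟩ := hfg
  set N : Submodule B (MvPolynomial (Fin r × Fin s) ℚ) := Submodule.span B S with hN
  have hTN : ∀ x ∈ (1 + A) ^ n, x ∈ N := by
    intro x hx
    rw [← hS] at hx
    exact Submodule.span_le_restrictScalars ℚ B _ hx
  have hYN : ∀ y ∈ hsopSpan r s, ∀ x ∈ N, y * x ∈ N := by
    intro y hy x hx
    induction hy using Submodule.span_induction with
    | mem y hy =>
      obtain ⟨i, rfl⟩ := hy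
      obtain ⟨b, hb⟩ := hB i
      rw [← hb, ← Algebra.smul_def]
      exact N.smul_mem _ hx
    | zero => rw [zero_mul]; exact zero_mem _
    | add y z _ _ hy hz => rw [add_mul]; exact add_mem hy hz
    | smul c y _ hy =>
      rw [smul_mul_assoc, ← algebraMap_smul B c]
      exact N.smul_mem _ hy
  have hle : A * (1 + A) ^ n ≤ (1 + A) ^ n + hsopSpan r s * (1 + A) ^ n := by
    calc A * (1 + A) ^ n ≤ (1 + A) * (1 + A) ^ n := mul_le_mul' le_sup_right le_rfl
      _ = (1 + A) ^ (n + 1) := by ring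
      _ ≤ 1 * (1 + A) ^ n + A ^ (n + 1) := add_pow_le le_sup_left le_sup_right n
      _ ≤ (1 + A) ^ n + hsopSpan r s * A ^ n := add_le_add (one_mul _).le hn
      _ ≤ _ := add_le_add le_rfl (mul_le_mul' le_rfl (pow_le_pow_left' le_sup_right _))
  have hAN : ∀ τ : Fin r → Fin s, ∀ x ∈ N, minor ℚ τ * x ∈ N := by
    intro τ x hx
    induction hx using Submodule.span_induction with
    | mem x hx =>
      have hx' : x ∈ (1 + A) ^ n := by rw [← hS]; exact Submodule.subset_span hx
      have h1 := hle (Submodule.mul_mem_mul (minor_mem_minorSpan τ) hx')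
      obtain ⟨u, hu, v, hv, huv⟩ := Submodule.mem_sup.1 h1
      rw [← huv]
      refine add_mem (hTN u hu) ?_
      exact Submodule.mul_induction_on hv (fun y hy x hx => hYN y hy x (hTN x hx))
        fun x y hx hy => add_mem hx hy
    | zero => rw [mul_zero]; exact zero_mem _
    | add y z _ _ hy hz => rw [mul_add]; exact add_mem hy hz
    | smul c y _ hy => rw [mul_smul_comm]; exact N.smul_mem _ hy
  refine ⟨N, ⟨S, rfl⟩, hTN 1 ?_, fun f hf => ?_⟩
  · have : (1 : MvPolynomial (Fin r × Fin s) ℚ) ∈ 1 + A :=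
      (le_sup_left : (1 : Submodule ℚ _) ≤ 1 ⊔ A) (Submodule.one_le.1 le_rfl)
    simpa using Submodule.pow_mem_pow _ this n
  · rw [polInv_eq_adjoin] at hf
    induction hf using Algebra.adjoin_induction with
    | mem f hf => obtain ⟨τ, rfl⟩ := hf; exact hAN τ
    | algebraMap c =>
      intro x hx
      rw [← Algebra.smul_def, ← algebraMap_smul B c]
      exact N.smul_mem _ hx
    | add f g _ _ hf hg => intro x hx; rw [add_mul]; exact add_mem (hf x hx) (hg x hx)
    | mul f g _ _ hf hg => intro x hx; rw [mul_assoc]; exact hf _ (hg x hx)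

theorem isIntegralElem_minor (hr : 0 < r) (τ : Fin r → Fin s) :
    (aeval (hsop ℚ r s) : _ →ₐ[ℚ] MvPolynomial (Fin r × Fin s) ℚ).toRingHom.IsIntegralElem
      (minor ℚ τ) := by
  let : Algebra (MvPolynomial (Fin (r * (s - r) + 1)) ℚ) (MvPolynomial (Fin r × Fin s) ℚ) :=
    (aeval (hsop ℚ r s) : _ →ₐ[ℚ] MvPolynomial (Fin r × Fin s) ℚ).toRingHom.toAlgebra
  have : IsScalarTower ℚ (MvPolynomial (Fin (r * (s - r) + 1)) ℚ)
      (MvPolynomial (Fin r × Fin s) ℚ) := IsScalarTower.of_algebraMap_eq fun c => by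
    exact ((aeval (hsop ℚ r s) : _ →ₐ[ℚ] MvPolynomial (Fin r × Fin s) ℚ).commutes c).symm
  obtain ⟨N, hfg, h1, hN⟩ := exists_fg_submodule (s := s) hr
    (B := MvPolynomial (Fin (r * (s - r) + 1)) ℚ) fun i => ⟨X i, by
      exact aeval_X (hsop ℚ r s) i⟩
  exact isIntegral_of_smul_mem_submodule N (by rintro rfl; exact one_ne_zero h1) hfg _
    (hN _ (minor_mem_polInv τ))

/-- Specialization of the generic matrix to `(u I | V)`. -/
noncomputable def specialize (r s : ℕ) :
    MvPolynomial (Fin r × Fin s) ℚ →ₐ[ℚ] MvPolynomial (Option (Fin r × Fin (s - r))) ℚ :=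
  aeval fun p => if h : (p.2 : ℕ) < r then (if (p.1 : ℕ) = p.2 then X none else 0)
    else X (some (p.1, ⟨p.2 - r, by omega⟩))

theorem algebraicIndependent_hsop (hr : 0 < r) (hrs : r ≤ s) :
    AlgebraicIndependent ℚ (hsop ℚ r s) := by
  let φ := specialize r s
  let u : MvPolynomial (Option (Fin r × Fin (s - r))) ℚ := X none
  let ι : Fin r → Fin s := Fin.castLE hrs
  let e : Fin (s - r) → Fin s := fun j => ⟨r + j, by omega⟩
  have hι : ∀ i j, φ (X (i, ι j)) = (u • (1 : Matrix (Fin r) (Fin r) _)) i j := by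
    intro i j
    have hj : ((ι j : Fin s) : ℕ) = j := rfl
    simp [φ, specialize, ι, u, Matrix.one_apply, Fin.ext_iff]
  have he : ∀ i j, φ (X (i, e j)) = X (some (i, j)) := by
    intro i j
    simp [φ, specialize, e]
  have h1 : φ (minor ℚ ι) = u ^ r := by
    have := eval_minor φ.toRingHom ι
    refine this.trans ?_
    have h2 : (Matrix.of fun i j : Fin r => φ (X (i, ι j))) = u • 1 := by
      ext1 i j; exact hι i j
    refine (congrArg Matrix.det h2).trans ?_
    rw [Matrix.det_smul, Matrix.det_one, mul_one, Fintype.card_fin]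
  have h2 : ∀ i j, φ (minor ℚ (Function.update ι i (e j))) = u ^ (r - 1) * X (some (i, j)) := by
    intro i j
    have := eval_minor φ.toRingHom
      (Function.update ι i (e j))
    refine this.trans ?_
    have h3 : (Matrix.of fun i' j' : Fin r => φ (X (i', Function.update ι i (e j) j')))
        = (u • (1 : Matrix (Fin r) (Fin r) _)).updateCol i fun i' => X (some (i', j)) := by
      ext1 i' j'
      rw [Matrix.updateCol_apply, Matrix.of_apply, Function.update_apply]
      split_ifs
      · exact he i' j
      · exact hι i' j'
    refine (congrArg Matrix.det h3).trans ?_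
    rw [← Matrix.cramer_apply, Matrix.cramer_eq_adjugate_mulVec, Matrix.adjugate_smul,
      Matrix.adjugate_one, Matrix.smul_mulVec, Matrix.one_mulVec, Fintype.card_fin]
    simp
  set y' : Fin (r * (s - r) + 1) → MvPolynomial (Option (Fin r × Fin (s - r))) ℚ :=
    fun i => φ (hsop ℚ r s i) with hy'
  have hint : ∀ τ : Fin r → Fin s,
      IsAlgebraic (Algebra.adjoin ℚ (Set.range y')) (φ (minor ℚ τ)) := by
    intro τ
    obtain ⟨p, hp, hpe⟩ := isIntegralElem_minor hr τ
    let g : MvPolynomial (Fin (r * (s - r) + 1)) ℚ →ₐ[ℚ] Algebra.adjoin ℚ (Set.range y') :=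
      aeval fun i => ⟨y' i, Algebra.subset_adjoin ⟨i, rfl⟩⟩
    have hcomp : (algebraMap (Algebra.adjoin ℚ (Set.range y'))
        (MvPolynomial (Option (Fin r × Fin (s - r))) ℚ)).comp g.toRingHom
        = φ.toRingHom.comp (aeval (hsop ℚ r s) :
          _ →ₐ[ℚ] MvPolynomial (Fin r × Fin s) ℚ).toRingHom := by
      refine MvPolynomial.ringHom_ext (fun c => ?_) fun i => ?_
      · simp [g, Algebra.algebraMap_eq_smul_one, smul_eq_C_mul]
      · simp [g, hy']
    refine IsIntegral.isAlgebraic ⟨p.map g.toRingHom, hp.map _, ?_⟩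
    rw [Polynomial.eval₂_map, hcomp]
    have := congrArg φ hpe
    rw [map_zero] at this
    rw [← this]
    exact (Polynomial.hom_eval₂ p _ φ.toRingHom _).symm
  have hu : IsAlgebraic (Algebra.adjoin ℚ (Set.range y')) u := by
    refine IsAlgebraic.of_pow hr ?_
    rw [← h1]
    exact hint ι
  have hX : ∀ o, IsAlgebraic (Algebra.adjoin ℚ (Set.range y'))
      (X o : MvPolynomial (Option (Fin r × Fin (s - r))) ℚ) := by
    rintro (_ | ⟨i, j⟩)
    · exact hu
    · have h3 := hint (Function.update ι i (e j))
      rw [h2] at h3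
      refine IsAlgebraic.of_mul (y := u ^ (r - 1)) ?_ (hu.pow _) h3
      exact mem_nonZeroDivisors_of_ne_zero (pow_ne_zero _ (X_ne_zero _))
  have : Algebra.IsAlgebraic (Algebra.adjoin ℚ (Set.range y'))
      (MvPolynomial (Option (Fin r × Fin (s - r))) ℚ) := by
    refine ⟨fun f => ?_⟩
    induction f using MvPolynomial.induction_on with
    | C c =>
      have := isAlgebraic_algebraMap (A := MvPolynomial (Option (Fin r × Fin (s - r))) ℚ)
        (algebraMap ℚ (Algebra.adjoin ℚ (Set.range y')) c)
      exact this
    | add f g hf hg => exact hf.add hg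
    | mul_X f i hf => exact hf.mul (hX i)
  have hind : AlgebraicIndependent ℚ y' := by
    refine (Algebra.IsAlgebraic.isTranscendenceBasis_of_le_trdeg_of_finite ℚ y' ?_).1
    rw [MvPolynomial.trdeg_of_isDomain]
    simp
  exact AlgebraicIndependent.of_comp φ hind
end Finiteness

end KoszulColim

namespace KoszulColim

/-- A finitely generated module over a domain is a retract of a finite free module up to
multiplication by a nonzero scalar. -/
theorem exists_free_retract {P M : Type} [CommRing P] [IsDomain P] [AddCommGroup M] [Module P M]
    [Module.Finite P M] : ∃ (κ : Type) (c : P) (β : M →ₗ[P] κ → P)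
      (γ : (κ → P) →ₗ[P] M), c ≠ 0 ∧ ∀ x, γ (β x) = c • x := by
  classical
  obtain ⟨n, v, hv⟩ := Module.Finite.exists_fin (R := P) (M := M)
  obtain ⟨t, ht, hmax⟩ := exists_maximal_linearIndepOn P v
  have h1 : ∀ i, ∃ a : P, a ≠ 0 ∧ a • v i ∈ Submodule.span P (v '' t) := by
    intro i
    by_cases hi : i ∈ t
    · exact ⟨1, one_ne_zero, by rw [one_smul]; exact Submodule.subset_span ⟨i, hi, rfl⟩⟩
    · exact hmax i hi
  choose a ha0 ha using h1
  set c := ∏ i, a i with hc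
  set F := Submodule.span P (Set.range fun i : t => v i) with hF
  have hF' : Submodule.span P (v '' t) = F := by
    rw [hF, Set.image_eq_range]
  have hcM : ∀ x : M, c • x ∈ F := by
    intro x
    have hx : x ∈ Submodule.span P (Set.range v) := hv ▸ Submodule.mem_top
    induction hx using Submodule.span_induction with
    | mem x hx =>
      obtain ⟨i, rfl⟩ := hx
      rw [hc, ← Finset.prod_erase_mul _ _ (Finset.mem_univ i), mul_smul, ← hF']
      exact Submodule.smul_mem _ _ (ha i)
    | zero => rw [smul_zero]; exact zero_mem _
    | add x y _ _ hx hy => rw [smul_add]; exact add_mem hx hy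
    | smul b x _ hx => rw [smul_comm]; exact F.smul_mem _ hx
  let B : Module.Basis t P F := Module.Basis.span ht
  refine ⟨t, c, B.equivFun.toLinearMap ∘ₗ (LinearMap.codRestrict F (c • LinearMap.id) hcM),
    F.subtype ∘ₗ B.equivFun.symm.toLinearMap, Finset.prod_ne_zero_iff.2 fun i _ => ha0 i,
    fun x => ?_⟩
  simp

open MvPolynomial

section Finiteness

variable {r s : ℕ}

theorem exists_hsop_module (hr : 0 < r) (hrs : r ≤ s) :
    ∃ (A : Algebra (MvPolynomial (Fin (r * (s - r) + 1)) ℚ) (MvPolynomial (Fin r × Fin s) ℚ))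
      (N : Submodule (MvPolynomial (Fin (r * (s - r) + 1)) ℚ) (MvPolynomial (Fin r × Fin s) ℚ)),
      (∀ i, A.algebraMap (X i) = hsop ℚ r s i) ∧ Function.Injective A.algebraMap ∧
      (∀ p, A.algebraMap p ∈ polInv (Fin r) (Fin s)) ∧ N.FG ∧
      ∀ f ∈ polInv (Fin r) (Fin s), f ∈ N := by
  let A : Algebra (MvPolynomial (Fin (r * (s - r) + 1)) ℚ) (MvPolynomial (Fin r × Fin s) ℚ) :=
    (aeval (hsop ℚ r s) : _ →ₐ[ℚ] MvPolynomial (Fin r × Fin s) ℚ).toRingHom.toAlgebra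
  have : IsScalarTower ℚ (MvPolynomial (Fin (r * (s - r) + 1)) ℚ)
      (MvPolynomial (Fin r × Fin s) ℚ) := IsScalarTower.of_algebraMap_eq fun c => by
    exact ((aeval (hsop ℚ r s) : _ →ₐ[ℚ] MvPolynomial (Fin r × Fin s) ℚ).commutes c).symm
  obtain ⟨N, hfg, h1, hN⟩ := exists_fg_submodule (s := s) hr
    (B := MvPolynomial (Fin (r * (s - r) + 1)) ℚ) fun i => ⟨X i, by
      exact aeval_X (hsop ℚ r s) i⟩
  refine ⟨A, N, fun i => aeval_X (hsop ℚ r s) i, algebraicIndependent_hsop hr hrs, fun p => ?_,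
    hfg, fun f hf => by simpa using hN f hf 1 h1⟩
  change aeval (hsop ℚ r s) p ∈ _
  have h2 : aeval (hsop ℚ r s) p ∈ Algebra.adjoin ℚ (Set.range (hsop ℚ r s)) := by
    rw [Algebra.adjoin_range_eq_range_aeval]; exact ⟨p, rfl⟩
  refine Algebra.adjoin_le ?_ h2
  rintro _ ⟨i, rfl⟩
  exact hsop_mem_polInv i

/-- The Koszul complex of `hsop` on the invariants is exact below the top degree, up to
multiplication by a fixed nonzero invariant. -/
theorem exists_mul_hsop_exact (hr : 0 < r) (hrs : r ≤ s) :
    ∃ c ∈ polInv (Fin r) (Fin s), c ≠ 0 ∧ ∀ (N q : ℕ), q < r * (s - r) + 1 →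
      ∀ m : Finset (Fin (r * (s - r) + 1)) → MvPolynomial (Fin r × Fin s) ℚ,
      (∀ K, m K ∈ polInv (Fin r) (Fin s)) → (∀ K, K.card ≠ q → m K = 0) →
      (∀ K, kd (hsop ℚ r s) N m K = 0) →
      ∃ b : Finset (Fin (r * (s - r) + 1)) → MvPolynomial (Fin r × Fin s) ℚ,
        ∀ K, kd (hsop ℚ r s) N b K = c * m K := by
  obtain ⟨A, L, hX, hinj, hpol, hfg, hmem⟩ := exists_hsop_module hr hrs
  have : Module.Finite (MvPolynomial (Fin (r * (s - r) + 1)) ℚ) L := Module.Finite.iff_fg.2 hfg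
  obtain ⟨κ, c, β, γ, hc, hγ⟩ :=
    exists_free_retract (P := MvPolynomial (Fin (r * (s - r) + 1)) ℚ) (M := L)
  refine ⟨A.algebraMap c, hpol c, ?_, fun N q hq m hm hdeg hd => ?_⟩
  · rw [← map_zero A.algebraMap]; exact fun h => hc (hinj h)
  let m' : Finset (Fin (r * (s - r) + 1)) → L := fun K => ⟨m K, hmem _ (hm K)⟩
  have hsub : ∀ j (x : L), L.subtype.toAddMonoidHom
      ((X j : MvPolynomial (Fin (r * (s - r) + 1)) ℚ) • x)
      = hsop ℚ r s j • L.subtype.toAddMonoidHom x := by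
    intro j x
    rw [← hX, smul_eq_mul]
    exact Algebra.smul_def _ _
  have hd' : ∀ K, kd (fun j => (X j : MvPolynomial (Fin (r * (s - r) + 1)) ℚ)) N m' K = 0 := by
    intro K
    have h := kd_map (fun j => (X j : MvPolynomial (Fin (r * (s - r) + 1)) ℚ)) (hsop ℚ r s)
      L.subtype.toAddMonoidHom hsub N m' K
    exact Subtype.ext (h.symm.trans (hd K))
  obtain ⟨b, hb⟩ := kd_X_exact N q (by simpa using hq) (fun K => β (m' K))
    (fun J hJ => by
      have : m' J = 0 := Subtype.ext (hdeg J hJ)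
      rw [this, map_zero])
    (fun K => by
      have h := kd_map (fun j => (X j : MvPolynomial (Fin (r * (s - r) + 1)) ℚ))
        (fun j => (X j : MvPolynomial (Fin (r * (s - r) + 1)) ℚ))
        β.toAddMonoidHom (fun j x => map_smul β _ _) N m' K
      refine h.trans ?_
      rw [hd', map_zero])
  refine ⟨fun K => (γ (b K) : L), fun K => ?_⟩
  have h1 := kd_map (fun j => (X j : MvPolynomial (Fin (r * (s - r) + 1)) ℚ))
    (fun j => (X j : MvPolynomial (Fin (r * (s - r) + 1)) ℚ))
    γ.toAddMonoidHom (fun j x => map_smul γ _ _) N b K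
  have h2 := kd_map (fun j => (X j : MvPolynomial (Fin (r * (s - r) + 1)) ℚ)) (hsop ℚ r s)
      L.subtype.toAddMonoidHom hsub N (fun K => γ (b K)) K
  refine h2.trans ?_
  have h3 : kd (fun j => (X j : MvPolynomial (Fin (r * (s - r) + 1)) ℚ)) N
      (fun K => γ (b K)) K = c • m' K := by
    refine h1.trans ?_
    rw [hb]
    exact hγ _
  rw [h3]
  exact Algebra.smul_def c (m K)

theorem X_prod_pow_ne {d : ℕ} {f : MvPolynomial (Fin d) ℚ} (hf : f ≠ 0) (k : ℕ)
    (g : Fin d → MvPolynomial (Fin d) ℚ) :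
    (∏ j, X j) ^ k * f ≠ ∑ j, X j ^ (f.totalDegree + 1 + k) * g j := by
  intro h
  obtain ⟨μ, hμ⟩ := MvPolynomial.ne_zero_iff.1 hf
  let e : Fin d →₀ ℕ := Finsupp.equivFunOnFinite.symm fun _ => k
  have h1 : ((∏ j, X j) ^ k : MvPolynomial (Fin d) ℚ) = monomial e 1 := by
    rw [monomial_eq]
    simp [e, Finsupp.prod_fintype, Finset.prod_pow]
  have h2 := congrArg (coeff (e + μ)) h
  rw [h1, coeff_monomial_mul, one_mul, coeff_sum] at h2
  rw [Finset.sum_eq_zero] at h2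
  · exact hμ h2
  · intro j _
    rw [X_pow_eq_monomial, coeff_monomial_mul', if_neg]
    intro hle
    have h3 := hle j
    have h4 : μ j ≤ f.totalDegree :=
      (Finset.single_le_sum (f := fun i => μ i) (fun _ _ => Nat.zero_le _)
        (Finset.mem_univ j)).trans
      (by
        have := le_totalDegree (mem_support_iff.2 hμ)
        rwa [Finsupp.sum_fintype _ _ fun _ => rfl] at this)
    simp [e] at h3
    omega

theorem exists_hsop_prod_pow_ne (hr : 0 < r) (hrs : r ≤ s) :
    ∃ N, ∀ (k : ℕ) (g : Fin (r * (s - r) + 1) → MvPolynomial (Fin r × Fin s) ℚ),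
      (∀ j, g j ∈ polInv (Fin r) (Fin s)) →
      (∏ j, hsop ℚ r s j) ^ k ≠ ∑ j, hsop ℚ r s j ^ (N + k) * g j := by
  obtain ⟨A, L, hX, hinj, hpol, hfg, hmem⟩ := exists_hsop_module hr hrs
  have : Module.Finite (MvPolynomial (Fin (r * (s - r) + 1)) ℚ) L := Module.Finite.iff_fg.2 hfg
  obtain ⟨κ, c, β, γ, hc, hγ⟩ :=
    exists_free_retract (P := MvPolynomial (Fin (r * (s - r) + 1)) ℚ) (M := L)
  have h1 : (1 : MvPolynomial (Fin r × Fin s) ℚ) ∈ L := hmem 1 (one_mem _)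
  have hβ : β ⟨1, h1⟩ ≠ 0 := by
    intro h0
    have h2 := hγ ⟨1, h1⟩
    rw [h0, map_zero] at h2
    have h3 := congrArg (Subtype.val) h2
    have h4 : A.algebraMap c = 0 := by
      refine Eq.trans ?_ h3.symm
      exact ((Algebra.smul_def c (1 : MvPolynomial (Fin r × Fin s) ℚ)).trans (mul_one _)).symm
    exact hc (hinj (h4.trans (map_zero _).symm))
  obtain ⟨x, hx⟩ := Function.ne_iff.1 hβ
  refine ⟨(β ⟨1, h1⟩ x).totalDegree + 1, fun k g hg he => ?_⟩
  refine X_prod_pow_ne hx k (fun j => β ⟨g j, hmem _ (hg j)⟩ x) ?_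
  have h5 : ((∏ j, X j) ^ k : MvPolynomial (Fin (r * (s - r) + 1)) ℚ) • (⟨1, h1⟩ : L)
      = ∑ j, (X j ^ ((β ⟨1, h1⟩ x).totalDegree + 1 + k) :
        MvPolynomial (Fin (r * (s - r) + 1)) ℚ) • (⟨g j, hmem _ (hg j)⟩ : L) := by
    apply Subtype.ext
    rw [Submodule.coe_smul, Submodule.coe_sum]
    simp only [Submodule.coe_smul]
    have hs : ∀ (p : MvPolynomial (Fin (r * (s - r) + 1)) ℚ) (f : MvPolynomial (Fin r × Fin s) ℚ),
      p • f = A.algebraMap p * f := fun p f => Algebra.smul_def p f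
    simp only [hs, map_pow, map_prod, hX, mul_one]
    exact he
  have h6 := congrFun (congrArg β h5) x
  rw [map_smul, map_sum] at h6
  simp only [map_smul, Finset.sum_apply, Pi.smul_apply, smul_eq_mul] at h6
  exact h6

end Finiteness

end KoszulColim

namespace KoszulColim

open MvPolynomial

/-- The top cohomology supported at the ideal of maximal minors does not vanish. -/
theorem not_KV_hsop_top {r s : ℕ} (hr : 0 < r) (hrs : r ≤ s) :
    ¬ KV (hsop ℚ r s) (MvPolynomial (Fin r × Fin s) ℚ) (r * (s - r) + 1) := by
  intro h
  obtain ⟨N, hN⟩ := exists_hsop_prod_pow_ne (s := s) hr hrs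
  have hcard : ∀ K : Finset (Fin (r * (s - r) + 1)), K.card = r * (s - r) + 1 ↔
      K = Finset.univ := by
    intro K
    rw [← Finset.card_eq_iff_eq_univ, Fintype.card_fin]
  let m : Finset (Fin (r * (s - r) + 1)) → MvPolynomial (Fin r × Fin s) ℚ :=
    fun K => if K = Finset.univ then 1 else 0
  have hm : ∀ J, J.card ≠ r * (s - r) + 1 → m J = 0 := fun J hJ =>
    if_neg fun h => hJ ((hcard J).2 h)
  obtain ⟨k, b, hb⟩ := h N m hm fun K => by
    refine kd_deg _ _ _ hm K ?_
    have := Finset.card_le_univ K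
    rw [Fintype.card_fin] at this
    omega
  have h1 : (∏ j, hsop ℚ r s j) ^ k
      = ∑ j, hsop ℚ r s j ^ (N + k) * (ksign j Finset.univ • b (Finset.univ.erase j)) := by
    have h2 := hb Finset.univ
    rw [kd, kphi] at h2
    simp only [m, if_true, smul_eq_mul, mul_one] at h2
    rw [← h2]
    refine Finset.sum_congr rfl fun j _ => ?_
    rw [mul_smul_comm]
  obtain ⟨g, h1⟩ : ∃ g : Fin (r * (s - r) + 1) → MvPolynomial (Fin r × Fin s) ℚ,
      (∏ j, hsop ℚ r s j) ^ k = ∑ j, hsop ℚ r s j ^ (N + k) * g j := ⟨_, h1⟩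
  choose g₀ hg₀ g₁ hg using fun j => exists_casimir_decomp (g j)
  refine hN k g₀ hg₀ ?_
  have h2 : (∏ j, hsop ℚ r s j) ^ k - ∑ j, hsop ℚ r s j ^ (N + k) * g₀ j
      = casimir (∑ j, hsop ℚ r s j ^ (N + k) * g₁ j) := by
    rw [h1, map_sum, ← Finset.sum_sub_distrib]
    refine Finset.sum_congr rfl fun j _ => ?_
    rw [casimir_mul_inv (pow_mem (hsop_mem_polInv j) _), ← mul_sub]
    conv_lhs => rw [hg j]
    rw [add_sub_cancel_left]
  have h3 : (∏ j, hsop ℚ r s j) ^ k - ∑ j, hsop ℚ r s j ^ (N + k) * g₀ j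
      ∈ polInv (Fin r) (Fin s) :=
    sub_mem (pow_mem (prod_mem fun j _ => hsop_mem_polInv j) _)
      (sum_mem fun j _ => mul_mem (pow_mem (hsop_mem_polInv j) _) (hg₀ j))
  rw [h2] at h3
  rw [← sub_eq_zero, h2]
  exact casimir_casimir (casimir_of_inv h3)

section Weyl

variable {σ H : Type} [AddCommGroup H] [Module ℚ H]
  [Module (MvPolynomial σ ℚ) H] [IsScalarTower ℚ (MvPolynomial σ ℚ) H]

theorem exists_solution_map (D : σ → H →ₗ[ℚ] H)
    (hcomm : ∀ i j h, D i (D j h) = D j (D i h)) (v : H) :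
    ∃ Φ : MvPolynomial σ ℚ →ₗ[ℚ] H, Φ 1 = v ∧ ∀ i f, Φ (X i * f) = D i (Φ f) := by
  let D' : σ → Module.End ℚ H := D
  have hc : ∀ a ∈ Set.range D', ∀ b ∈ Set.range D', a * b = b * a := by
    rintro _ ⟨i, rfl⟩ _ ⟨j, rfl⟩
    ext h
    exact hcomm i j h
  have hm := Algebra.isMulCommutative_adjoin ℚ hc
  let _ : CommRing (Algebra.adjoin ℚ (Set.range D')) :=
    { (Algebra.adjoin ℚ (Set.range D')).toRing with mul_comm := hm.is_comm.comm }
  let ψ : MvPolynomial σ ℚ →ₐ[ℚ] Algebra.adjoin ℚ (Set.range D') :=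
    aeval (S₁ := Algebra.adjoin ℚ (Set.range D'))
      fun i => ⟨D' i, Algebra.subset_adjoin ⟨i, rfl⟩⟩
  have h1 : ((ψ 1 : Algebra.adjoin ℚ (Set.range D')) : Module.End ℚ H) = 1 := by
    rw [map_one]; rfl
  have h2 : ∀ i f, ((ψ (X i * f) : Algebra.adjoin ℚ (Set.range D')) : Module.End ℚ H)
      = D' i * (ψ f : Algebra.adjoin ℚ (Set.range D')) := by
    intro i f
    rw [map_mul]
    change ((ψ (X i) : Algebra.adjoin ℚ (Set.range D')) : Module.End ℚ H) * _ = _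
    rw [show ψ (X i) = _ from aeval_X _ i]
  refine ⟨(LinearMap.applyₗ v).comp
    ((Algebra.adjoin ℚ (Set.range D')).val.comp ψ).toLinearMap, ?_, fun i f => ?_⟩
  · change ((ψ 1 : Algebra.adjoin ℚ (Set.range D')) : Module.End ℚ H) v = v
    rw [h1]; rfl
  · change ((ψ (X i * f) : Algebra.adjoin ℚ (Set.range D')) : Module.End ℚ H) v = _
    rw [h2]; rfl

theorem totalDegree_pderiv_le {i : σ} {n : ℕ} {f : MvPolynomial σ ℚ}
    (hf : f.totalDegree ≤ n + 1) : (pderiv i f).totalDegree ≤ n := by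
  classical
  refine Finset.sup_le fun e he => ?_
  rw [mem_support_iff, coeff_pderiv] at he
  have h := (le_totalDegree (mem_support_iff.2 (left_ne_zero_of_mul he))).trans hf
  rw [Finsupp.sum_add_index' (by simp) (by simp), Finsupp.sum_single_index rfl] at h
  omega

theorem eq_C_of_pderiv_eq_zero {f : MvPolynomial σ ℚ} (h : ∀ i, pderiv i f = 0) :
    f = C (constantCoeff f) := by
  classical
  ext e
  rw [coeff_C]
  split_ifs with he
  · rw [← he]; rfl
  · obtain ⟨i, hi⟩ := Finsupp.ne_iff.1 (Ne.symm he)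
    have h1 := congrArg (coeff (e - Finsupp.single i 1)) (h i)
    have h2 : e - Finsupp.single i 1 + Finsupp.single i 1 = e :=
      tsub_add_cancel_of_le (Finsupp.single_le_iff.2 (Nat.one_le_iff_ne_zero.2 hi))
    rw [coeff_pderiv, h2, coeff_zero, mul_eq_zero] at h1
    refine h1.resolve_right ?_
    positivity

variable {D : σ → H →ₗ[ℚ] H}
  (hL : ∀ i (f : MvPolynomial σ ℚ) h, D i (f • h) = pderiv i f • h + f • D i h)
  {v : H} (hv : ∀ i, (X i : MvPolynomial σ ℚ) • v = 0) {Φ : MvPolynomial σ ℚ →ₗ[ℚ] H}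
  (h1 : Φ 1 = v) (hX : ∀ i f, Φ (X i * f) = D i (Φ f))

theorem X_smul_solution (hL : ∀ i (f : MvPolynomial σ ℚ) h,
      D i (f • h) = pderiv i f • h + f • D i h)
    (hv : ∀ i, (X i : MvPolynomial σ ℚ) • v = 0) (h1 : Φ 1 = v)
    (hX : ∀ i f, Φ (X i * f) = D i (Φ f)) (i : σ) (f : MvPolynomial σ ℚ) :
    (X i : MvPolynomial σ ℚ) • Φ f = - Φ (pderiv i f) := by
  classical
  induction f using MvPolynomial.induction_on with
  | C c =>
    have : (C c : MvPolynomial σ ℚ) = c • 1 := by rw [smul_eq_C_mul, mul_one]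
    rw [pderiv_C, map_zero, neg_zero, this, map_smul, h1, smul_comm, hv, smul_zero]
  | add f g hf hg => rw [map_add, smul_add, hf, hg, map_add, map_add, neg_add]
  | mul_X f j hf =>
    have h2 := hL j (X i) (Φ f)
    rw [hf, map_neg, ← hX] at h2
    rw [mul_comm f, hX, Derivation.leibniz, map_add, smul_eq_mul, smul_eq_mul, neg_add]
    have h3 : (pderiv j (X i) : MvPolynomial σ ℚ) • Φ f = Φ (f * pderiv i (X j)) := by
      rw [pderiv_X, pderiv_X, Pi.single_apply, Pi.single_apply]
      by_cases hij : i = j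
      · rw [if_pos hij, if_pos hij.symm, one_smul, mul_one]
      · rw [if_neg hij, if_neg (Ne.symm hij), zero_smul, mul_zero, map_zero]
    rw [h3] at h2
    rw [h2]
    abel

theorem solution_injective (hL : ∀ i (f : MvPolynomial σ ℚ) h,
      D i (f • h) = pderiv i f • h + f • D i h)
    (hv : ∀ i, (X i : MvPolynomial σ ℚ) • v = 0) (hv0 : v ≠ 0) (h1 : Φ 1 = v)
    (hX : ∀ i f, Φ (X i * f) = D i (Φ f)) : ∀ (n : ℕ) (u : MvPolynomial σ ℚ),
      u.totalDegree ≤ n → Φ u = 0 → u = 0 := by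
  have key : ∀ u : MvPolynomial σ ℚ, (∀ i, pderiv i u = 0) → Φ u = 0 → u = 0 := by
    intro u hu h
    rw [eq_C_of_pderiv_eq_zero hu] at h ⊢
    have : (C (constantCoeff u) : MvPolynomial σ ℚ) = constantCoeff u • 1 := by
      rw [smul_eq_C_mul, mul_one]
    rw [this, map_smul, h1] at h
    rw [(smul_eq_zero.1 h).resolve_right hv0, C_0]
  intro n
  induction n with
  | zero =>
    intro u hu h
    refine key u (fun i => ?_) h
    rw [totalDegree_eq_zero_iff_eq_C.1 (Nat.le_zero.1 hu), pderiv_C]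
  | succ n ih =>
    intro u hu h
    refine key u (fun i => ih _ (totalDegree_pderiv_le hu) ?_) h
    rw [← neg_eq_zero, ← X_smul_solution hL hv h1 hX, h, smul_zero]

variable [Fintype σ]

theorem smul_solution (hL : ∀ i (f : MvPolynomial σ ℚ) h,
      D i (f • h) = pderiv i f • h + f • D i h)
    (hv : ∀ i, (X i : MvPolynomial σ ℚ) • v = 0) (h1 : Φ 1 = v)
    (hX : ∀ i f, Φ (X i * f) = D i (Φ f)) (f : MvPolynomial σ ℚ) :
    ∀ g, ∃ u, f • Φ g = Φ u ∧
      constantCoeff u = pairing (aeval (fun i => -(X i : MvPolynomial σ ℚ)) f) g := by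
  induction f using MvPolynomial.induction_on with
  | C c =>
    intro g
    refine ⟨c • g, ?_, ?_⟩
    · rw [map_smul, ← algebraMap_smul (MvPolynomial σ ℚ) c (Φ g)]; rfl
    · have : (C c : MvPolynomial σ ℚ) = c • 1 := by rw [smul_eq_C_mul, mul_one]
      rw [aeval_C, algebraMap_eq, this, map_smul pairing, LinearMap.smul_apply, pairing_one,
        smul_eq_C_mul, map_mul, constantCoeff_C, smul_eq_mul]
  | add f f' hf hf' =>
    intro g
    obtain ⟨u, hu, hc⟩ := hf g
    obtain ⟨u', hu', hc'⟩ := hf' g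
    exact ⟨u + u', by rw [add_smul, hu, hu', map_add],
      by rw [map_add, hc, hc', map_add, map_add, LinearMap.add_apply]⟩
  | mul_X f i hf =>
    intro g
    obtain ⟨u, hu, hc⟩ := hf (pderiv i g)
    refine ⟨-u, ?_, ?_⟩
    · rw [mul_smul, X_smul_solution hL hv h1 hX, smul_neg, hu, map_neg]
    · rw [map_neg, hc, map_mul, aeval_X, mul_neg, mul_comm, map_neg, LinearMap.neg_apply,
        pairing_X_mul]

end Weyl

section Casimir

variable {α β : Type} [Fintype α] [Fintype β] [DecidableEq α]

theorem pol_aeval_neg (a b : α) (f : MvPolynomial (α × β) ℚ) :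
    pol a b (aeval (fun i => -(X i : MvPolynomial (α × β) ℚ)) f)
      = aeval (fun i => -(X i : MvPolynomial (α × β) ℚ)) (pol a b f) := by
  induction f using MvPolynomial.induction_on with
  | C c => simp [← algebraMap_eq]
  | add f g hf hg => simp only [map_add, hf, hg]
  | mul_X f i hf =>
    obtain ⟨c, l⟩ := i
    rw [map_mul, aeval_X, Derivation.leibniz, Derivation.leibniz, map_neg, pol_X, hf]
    simp only [smul_eq_mul, map_add, map_mul, aeval_X]
    split_ifs
    · rw [aeval_X]
    · simp

theorem exists_socle {σ H : Type} [AddCommGroup H] [Module (MvPolynomial σ ℚ) H]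
    {Z : Submodule (MvPolynomial σ ℚ) H}
    (hnil : ∀ i, ∀ w ∈ Z, ∃ n, (X i ^ n : MvPolynomial σ ℚ) • w = 0) {w : H} (hw : w ∈ Z)
    (hw0 : w ≠ 0) (t : Finset σ) :
    ∃ v ∈ Z, v ≠ 0 ∧ ∀ i ∈ t, (X i : MvPolynomial σ ℚ) • v = 0 := by
  classical
  induction t using Finset.induction_on with
  | empty => exact ⟨w, hw, hw0, by simp⟩
  | insert a t _ ih =>
    obtain ⟨v, hv, hv0, ht⟩ := ih
    have hex := hnil a v hv
    have hpos : Nat.find hex ≠ 0 := by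
      intro h0
      have := Nat.find_spec hex
      rw [h0, pow_zero, one_smul] at this
      exact hv0 this
    obtain ⟨n, hn⟩ := Nat.exists_eq_succ_of_ne_zero hpos
    refine ⟨(X a ^ n : MvPolynomial σ ℚ) • v, Z.smul_mem _ hv,
      Nat.find_min hex (by omega), fun i hi => ?_⟩
    rcases Finset.mem_insert.1 hi with rfl | hi
    · rw [smul_smul, ← pow_succ', ← Nat.succ_eq_add_one, ← hn]
      exact Nat.find_spec hex
    · rw [smul_comm, ht i hi, smul_zero]

/-- A module with compatible derivations, supported at the origin, vanishes if a nonzero invariant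
annihilates the kernel of the Casimir operator. -/
theorem eq_bot_of_casimir {H : Type} [AddCommGroup H] [Module ℚ H]
    [Module (MvPolynomial (α × β) ℚ) H] [IsScalarTower ℚ (MvPolynomial (α × β) ℚ) H]
    (D : α × β → H →ₗ[ℚ] H) (hcomm : ∀ i j h, D i (D j h) = D j (D i h))
    (hL : ∀ i (f : MvPolynomial (α × β) ℚ) h, D i (f • h) = pderiv i f • h + f • D i h)
    (Z : Submodule (MvPolynomial (α × β) ℚ) H) (hDZ : ∀ i, ∀ w ∈ Z, D i w ∈ Z)
    (hnil : ∀ i, ∀ w ∈ Z, ∃ n, (X i ^ n : MvPolynomial (α × β) ℚ) • w = 0)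
    {c : MvPolynomial (α × β) ℚ} (hc : c ∈ polInv α β) (hc0 : c ≠ 0)
    (E : α → α → H → H)
    (hE : ∀ a b w, E a b w = ∑ l, (X (a, l) : MvPolynomial (α × β) ℚ) • D (b, l) w)
    (hcas : ∀ w ∈ Z, ∑ p ∈ (Finset.univ : Finset α).offDiag, E p.2 p.1 (E p.1 p.2 w) = 0 →
      c • w = 0) : ∀ w ∈ Z, w = 0 := by
  classical
  intro w hw
  by_contra hw0
  obtain ⟨v, hv, hv0, hvX⟩ := exists_socle hnil hw hw0 Finset.univ
  replace hvX : ∀ i, (X i : MvPolynomial (α × β) ℚ) • v = 0 := fun i => hvX i (Finset.mem_univ i)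
  obtain ⟨Φ, h1, hX⟩ := exists_solution_map D hcomm v
  have hΦZ : ∀ f, Φ f ∈ Z := by
    intro f
    induction f using MvPolynomial.induction_on with
    | C c =>
      have : (C c : MvPolynomial (α × β) ℚ) = c • 1 := by rw [smul_eq_C_mul, mul_one]
      rw [this, map_smul, h1, ← algebraMap_smul (MvPolynomial (α × β) ℚ) c]
      exact Z.smul_mem _ hv
    | add f g hf hg => rw [map_add]; exact add_mem hf hg
    | mul_X f i hf => rw [mul_comm, hX]; exact hDZ i _ hf
  have hEΦ : ∀ a b, a ≠ b → ∀ f, E a b (Φ f) = - Φ (pol b a f) := by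
    intro a b hab f
    rw [hE, pol_apply, map_sum, ← Finset.sum_neg_distrib]
    refine Finset.sum_congr rfl fun l _ => ?_
    rw [← hX, X_smul_solution hL hvX h1 hX, Derivation.leibniz, pderiv_X_of_ne, smul_zero,
      add_zero, smul_eq_mul]
    simpa using Ne.symm hab
  set ν : MvPolynomial (α × β) ℚ →ₐ[ℚ] MvPolynomial (α × β) ℚ :=
    aeval (fun i => -(X i : MvPolynomial (α × β) ℚ)) with hν
  have hνν : ∀ f, ν (ν f) = f := by
    intro f
    induction f using MvPolynomial.induction_on with
    | C c => simp [← algebraMap_eq]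
    | add f g hf hg => simp only [map_add, hf, hg]
    | mul_X f i hf => rw [map_mul, map_mul, hf, hν, aeval_X, map_neg, aeval_X, neg_neg]
  have hg : ν c ∈ polInv α β := fun a b hab => by rw [hν, pol_aeval_neg, hc a b hab, map_zero]
  have hE0 : ∀ a b, E a b 0 = 0 := fun a b => by simp [hE]
  have h2 : c • Φ (ν c) = 0 := by
    refine hcas _ (hΦZ _) (Finset.sum_eq_zero fun p hp => ?_)
    have hp' := (Finset.mem_offDiag.1 hp).2.2
    rw [hEΦ _ _ hp', hg _ _ hp'.symm, map_zero, neg_zero, hE0]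
  obtain ⟨u, hu, hcu⟩ := smul_solution hL hvX h1 hX c (ν c)
  rw [h2] at hu
  have hu0 := solution_injective hL hvX hv0 h1 hX _ u le_rfl hu.symm
  rw [hu0, map_zero] at hcu
  have := pairing_self_eq_zero hcu.symm
  rw [← hνν c, hν] at hc0
  exact hc0 (by rw [← hν] at this ⊢; rw [this, map_zero])

end Casimir

end KoszulColim

namespace KoszulColim

open MvPolynomial TensorProduct

section Fractions

variable {ι R K : Type} [LinearOrder ι] [CommRing R] [IsDomain R] [Field K] [Algebra R K]
  [IsFractionRing R K]

/-- The cochain `c` of fractions has the numerators `m` over the denominators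
`(∏ j ∈ J, y j) ^ N`. -/
def HasNum (y : ι → R) (N : ℕ) (c : Finset ι → K) (m : Finset ι → R) : Prop :=
  ∀ J, kphi y N c J = algebraMap R K (m J)

variable {y : ι → R} {N : ℕ} {c b : Finset ι → K} {m b' : Finset ι → R}

theorem algebraMap_smul_comm (y : ι → R) (j : ι) (m : R) :
    (algebraMap R K).toAddMonoidHom (y j • m) = y j • (algebraMap R K).toAddMonoidHom m := by
  simp [Algebra.smul_def]

theorem HasNum.bump (h : HasNum y N c m) (k : ℕ) : HasNum y (N + k) c (kphi y k m) := by
  intro J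
  rw [← kphi_kphi]
  have h1 : kphi y N c = fun J => algebraMap R K (m J) := funext h
  rw [h1]
  exact kphi_map y y (algebraMap R K).toAddMonoidHom (algebraMap_smul_comm y) k m J

theorem HasNum.kd (h : HasNum y N c m) : HasNum y N (kd y 0 c) (kd y N m) := by
  intro J
  rw [kphi_kd, zero_add]
  have h1 : kphi y N c = fun J => algebraMap R K (m J) := funext h
  rw [h1]
  exact kd_map y y (algebraMap R K).toAddMonoidHom (algebraMap_smul_comm y) N m J

theorem exists_hasNum (hy : ∀ j, y j ≠ 0) (N : ℕ) (m : Finset ι → R) :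
    ∃ c : Finset ι → K, HasNum y N c m := by
  refine ⟨fun J => (algebraMap R K ((∏ j ∈ J, y j) ^ N))⁻¹ * algebraMap R K (m J), fun J => ?_⟩
  rw [kphi, Algebra.smul_def, mul_inv_cancel_left₀]
  have : (∏ j ∈ J, y j) ^ N ≠ 0 := pow_ne_zero _ (Finset.prod_ne_zero_iff.2 fun j _ => hy j)
  rwa [Ne, FaithfulSMul.algebraMap_eq_zero_iff]

theorem HasNum.eq_iff (hy : ∀ j, y j ≠ 0) (h : HasNum y N c m) (h' : HasNum y N b b')
    (J : Finset ι) : c J = b J ↔ m J = b' J := by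
  have h0 : algebraMap R K ((∏ j ∈ J, y j) ^ N) ≠ 0 := by
    have : (∏ j ∈ J, y j) ^ N ≠ 0 := pow_ne_zero _ (Finset.prod_ne_zero_iff.2 fun j _ => hy j)
    rwa [Ne, FaithfulSMul.algebraMap_eq_zero_iff]
  rw [← (FaithfulSMul.algebraMap_injective R K).eq_iff, ← h J, ← h' J, kphi, kphi,
    Algebra.smul_def, Algebra.smul_def, mul_right_inj' h0]

theorem HasNum.add (h : HasNum y N c m) (h' : HasNum y N b b') :
    HasNum y N (c + b) (m + b') := by
  intro J
  have h1 := h J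
  have h2 := h' J
  rw [kphi] at h1 h2 ⊢
  rw [Pi.add_apply, Pi.add_apply, smul_add, h1, h2, map_add]

theorem HasNum.smul (a : R) (h : HasNum y N c m) : HasNum y N (a • c) (a • m) := by
  intro J
  have h1 := h J
  rw [kphi] at h1 ⊢
  rw [Pi.smul_apply, Pi.smul_apply, smul_comm, h1, Algebra.smul_def, smul_eq_mul, map_mul]

theorem HasNum.zero : HasNum y N (0 : Finset ι → K) 0 := by
  intro J
  simp [kphi]

theorem HasNum.deg (hy : ∀ j, y j ≠ 0) (h : HasNum y N c m) {q : ℕ} :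
    (∀ J, J.card ≠ q → c J = 0) ↔ ∀ J, J.card ≠ q → m J = 0 :=
  forall_congr' fun J => imp_congr_right fun _ => h.eq_iff hy HasNum.zero J

variable (K) in
/-- The cochains of fractions whose denominators are powers of the elements `y`. -/
def fracCochain (y : ι → R) : Submodule R (Finset ι → K) where
  carrier := {c | ∃ N m, HasNum y N c m}
  add_mem' := by
    rintro a b ⟨N, m, h⟩ ⟨N', m', h'⟩
    have h'' := h'.bump N
    rw [add_comm] at h''
    exact ⟨_, _, (h.bump N').add h''⟩
  zero_mem' := ⟨0, _, HasNum.zero⟩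
  smul_mem' := by
    rintro a c ⟨N, m, h⟩
    exact ⟨N, _, h.smul a⟩

variable (K) in
/-- The homogeneous cocycles of fractions. -/
def fracCocycle (y : ι → R) (q : ℕ) : Submodule R (Finset ι → K) where
  carrier := {c | c ∈ fracCochain K y ∧ (∀ J, J.card ≠ q → c J = 0) ∧ ∀ J, kd y 0 c J = 0}
  add_mem' := by
    rintro a b ⟨h1, h2, h3⟩ ⟨h1', h2', h3'⟩
    refine ⟨add_mem h1 h1', fun J hJ => by rw [Pi.add_apply, h2 J hJ, h2' J hJ, add_zero],
      fun J => ?_⟩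
    have := kd_add y 0 a b J
    rw [h3, h3', add_zero] at this
    exact this
  zero_mem' := ⟨zero_mem _, fun _ _ => rfl, fun J => kd_zero y 0 J⟩
  smul_mem' := by
    rintro a c ⟨h1, h2, h3⟩
    refine ⟨Submodule.smul_mem _ _ h1, fun J hJ => by rw [Pi.smul_apply, h2 J hJ, smul_zero],
      fun J => ?_⟩
    have := kd_smul y 0 a c J
    rw [h3, smul_zero] at this
    exact this

variable (K) in
/-- The coboundaries of fractions. -/
def fracCoboundary (y : ι → R) : Submodule R (Finset ι → K) where
  carrier := {c | ∃ b ∈ fracCochain K y, ∀ J, kd y 0 b J = c J}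
  add_mem' := by
    rintro c c' ⟨b, hb, h⟩ ⟨b', hb', h'⟩
    exact ⟨b + b', add_mem hb hb', fun J => (kd_add y 0 b b' J).trans (by rw [h, h']; rfl)⟩
  zero_mem' := ⟨0, zero_mem _, fun J => kd_zero y 0 J⟩
  smul_mem' := by
    rintro a c ⟨b, hb, h⟩
    exact ⟨a • b, Submodule.smul_mem _ _ hb, fun J =>
      (kd_smul y 0 a b J).trans (by rw [h]; rfl)⟩

/-- A fraction cochain is a coboundary if and only if its numerators become one. -/
theorem HasNum.mem_fracCoboundary (hy : ∀ j, y j ≠ 0) (h : HasNum y N c m) :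
    c ∈ fracCoboundary K y ↔ ∃ k b', ∀ J, KoszulColim.kd y (N + k) b' J = kphi y k m J := by
  constructor
  · rintro ⟨b, ⟨N', b', hb⟩, hbc⟩
    refine ⟨N', kphi y N b', fun J => ?_⟩
    have h1 := (hb.bump N).kd
    rw [add_comm] at h1
    exact (h1.eq_iff hy (h.bump N') J).1 (hbc J)
  · rintro ⟨k, b', hb⟩
    obtain ⟨b, hb'⟩ := exists_hasNum (K := K) hy (N + k) b'
    exact ⟨b, ⟨_, _, hb'⟩, fun J => (hb'.kd.eq_iff hy (h.bump k) J).2 (hb J)⟩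

theorem HasNum.cocycle_iff (hy : ∀ j, y j ≠ 0) (h : HasNum y N c m) :
    (∀ J, KoszulColim.kd y 0 c J = 0) ↔ ∀ J, KoszulColim.kd y N m J = 0 :=
  forall_congr' fun J => h.kd.eq_iff hy HasNum.zero J

theorem KV.of_frac (hy : ∀ j, y j ≠ 0) {q : ℕ}
    (h : fracCocycle K y q ≤ fracCoboundary K y) : KV y R q := by
  intro N m hm hd
  obtain ⟨c, hc⟩ := exists_hasNum (K := K) hy N m
  exact (hc.mem_fracCoboundary hy).1
    (h ⟨⟨N, m, hc⟩, (hc.deg hy).2 hm, (hc.cocycle_iff hy).2 hd⟩)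

end Fractions

section Derivations

variable {R K : Type} [CommRing R] [IsDomain R] [Algebra ℚ R] [Field K] [Algebra R K]
  [IsFractionRing R K] [Algebra ℚ K] [IsScalarTower ℚ R K]

theorem exists_derivation_extend (d : Derivation ℚ R R) :
    ∃ D : Derivation ℚ K K, ∀ f, D (algebraMap R K f) = algebraMap R K (d f) := by
  have := Algebra.FormallyEtale.of_isLocalization (Rₘ := K) (nonZeroDivisors R)
  let l : Ω[R⁄ℚ] →ₗ[R] K := (Algebra.linearMap R K).comp d.liftKaehlerDifferential
  let L : Ω[K⁄ℚ] →ₗ[K] K := (l.liftBaseChange K).comp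
    (KaehlerDifferential.tensorKaehlerEquivOfFormallyEtale ℚ R K).symm.toLinearMap
  refine ⟨L.compDer (KaehlerDifferential.D ℚ K), fun f => ?_⟩
  change (l.liftBaseChange K) ((KaehlerDifferential.tensorKaehlerEquivOfFormallyEtale ℚ R K).symm
    (KaehlerDifferential.D ℚ K (algebraMap R K f))) = _
  rw [KaehlerDifferential.tensorKaehlerEquivOfFormallyEtale_symm_D_algebraMap,
    LinearMap.liftBaseChange_tmul, one_smul]
  simp [l]

theorem derivation_frac_eq_zero (D : Derivation ℚ K K) (h : ∀ f, D (algebraMap R K f) = 0)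
    (x : K) : D x = 0 := by
  obtain ⟨a, b, hb, rfl⟩ := IsFractionRing.div_surjective (A := R) x
  have hb0 : algebraMap R K b ≠ 0 := by
    rw [Ne, FaithfulSMul.algebraMap_eq_zero_iff]; exact nonZeroDivisors.ne_zero hb
  have h1 := D.leibniz (algebraMap R K b) (algebraMap R K a / algebraMap R K b)
  rw [mul_div_cancel₀ _ hb0, h, h, smul_zero, add_zero, smul_eq_mul] at h1
  exact (mul_eq_zero.1 h1.symm).resolve_left hb0

theorem derivation_frac_comm {D D' : Derivation ℚ K K} {d d' : Derivation ℚ R R}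
    (hd : ∀ f, D (algebraMap R K f) = algebraMap R K (d f))
    (hd' : ∀ f, D' (algebraMap R K f) = algebraMap R K (d' f))
    (h : ∀ f, d (d' f) = d' (d f)) (x : K) : D (D' x) = D' (D x) := by
  have := derivation_frac_eq_zero (R := R) ⁅D, D'⁆ (fun f => by
    rw [Derivation.commutator_apply, hd', hd, hd, hd', h, sub_self]) x
  rwa [Derivation.commutator_apply, sub_eq_zero] at this

end Derivations

end KoszulColim

namespace KoszulColim

open MvPolynomial

section Derivations

variable {ι R K : Type} [LinearOrder ι] [CommRing R] [IsDomain R] [Field K] [Algebra R K]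
  [IsFractionRing R K] [Algebra ℚ R] [Algebra ℚ K] [IsScalarTower ℚ R K]
  {D : Derivation ℚ K K} {d : Derivation ℚ R R} {y : ι → R} {N : ℕ} {c : Finset ι → K}
  {m : Finset ι → R}

theorem HasNum.derivation (hd : ∀ f, D (algebraMap R K f) = algebraMap R K (d f))
    (h : HasNum y N c m) : ∃ m', HasNum y (N + N) (fun J => D (c J)) m' := by
  refine ⟨fun J => (∏ j ∈ J, y j) ^ N * d (m J) - d ((∏ j ∈ J, y j) ^ N) * m J, fun J => ?_⟩
  have h1 := h J
  rw [kphi, Algebra.smul_def] at h1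
  have h2 := congrArg D h1
  rw [Derivation.leibniz, hd, hd, smul_eq_mul, smul_eq_mul] at h2
  rw [kphi, Algebra.smul_def, pow_add]
  simp only [map_mul, map_sub]
  rw [← h2, ← h1]
  ring

theorem kd_derivation (y : ι → R) (c : Finset ι → K) (J : Finset ι) :
    kd y 0 (fun J => D (c J)) J = D (kd y 0 c J) := by
  simp only [kd, pow_zero, one_smul, map_sum, map_zsmul]

theorem derivation_mem_fracCochain (hd : ∀ f, D (algebraMap R K f) = algebraMap R K (d f))
    (hc : c ∈ fracCochain K y) : (fun J => D (c J)) ∈ fracCochain K y := by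
  obtain ⟨N, m, h⟩ := hc
  obtain ⟨m', hm'⟩ := h.derivation hd
  exact ⟨_, m', hm'⟩

theorem derivation_mem_fracCocycle (hd : ∀ f, D (algebraMap R K f) = algebraMap R K (d f)) {q : ℕ}
    (hc : c ∈ fracCocycle K y q) : (fun J => D (c J)) ∈ fracCocycle K y q := by
  obtain ⟨h1, h2, h3⟩ := hc
  refine ⟨derivation_mem_fracCochain hd h1, fun J hJ => (congrArg D (h2 J hJ)).trans (map_zero D),
    fun J => ?_⟩
  rw [kd_derivation, h3, map_zero]

theorem derivation_mem_fracCoboundary (hd : ∀ f, D (algebraMap R K f) = algebraMap R K (d f))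
    (hc : c ∈ fracCoboundary K y) : (fun J => D (c J)) ∈ fracCoboundary K y := by
  obtain ⟨b, h1, h2⟩ := hc
  refine ⟨_, derivation_mem_fracCochain hd h1, fun J => ?_⟩
  rw [kd_derivation, h2]

end Derivations

theorem exists_kd_eq_kproj {ι R : Type} [LinearOrder ι] [CommRing R] (y : ι → R) (N q : ℕ)
    (b : Finset ι → R) : ∃ b', ∀ J, kd y N b' J = kproj q (kd y N b) J := by
  cases q with
  | zero =>
    refine ⟨fun _ => 0, fun J => ?_⟩
    rw [kd_zero, kproj]
    split_ifs with h
    · rw [Finset.card_eq_zero.1 h]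
      simp [kd]
    · rfl
  | succ q => exact ⟨_, kd_kproj y N q b⟩

theorem exists_quotient_map {R V : Type} [CommRing R] [Algebra ℚ R] [AddCommGroup V] [Module ℚ V]
    [Module R V] [IsScalarTower ℚ R V] (B : Submodule R V) (f : V →ₗ[ℚ] V)
    (h : ∀ c ∈ B, f c ∈ B) : ∃ g : (V ⧸ B) →ₗ[ℚ] (V ⧸ B), ∀ c, g (B.mkQ c) = B.mkQ (f c) := by
  have h' : B.toAddSubgroup ≤ B.toAddSubgroup.comap f.toAddMonoidHom := h
  let g : (V ⧸ B) →+ (V ⧸ B) :=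
    QuotientAddGroup.map B.toAddSubgroup B.toAddSubgroup f.toAddMonoidHom h'
  exact ⟨g.toRatLinearMap, fun c => rfl⟩

section Polarization

variable {α β ι : Type} [Fintype α] [Fintype β] [DecidableEq α] [LinearOrder ι]
  {y : ι → MvPolynomial (α × β) ℚ}

/-- A cocycle annihilated by the Casimir operator up to coboundaries is annihilated by `c` up to
coboundaries. -/
theorem exists_kd_eq_mul_of_casimir (hy : ∀ j, y j ∈ polInv α β) {c : MvPolynomial (α × β) ℚ}
    {N q : ℕ} (hex : ∀ m : Finset ι → MvPolynomial (α × β) ℚ, (∀ K, m K ∈ polInv α β) →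
      (∀ K, K.card ≠ q → m K = 0) → (∀ K, kd y N m K = 0) → ∃ b, ∀ K, kd y N b K = c * m K)
    {m b : Finset ι → MvPolynomial (α × β) ℚ} (hm : ∀ K, K.card ≠ q → m K = 0)
    (hd : ∀ K, kd y N m K = 0) (hb : ∀ K, kd y N b K = casimir (m K)) :
    ∃ b', ∀ K, kd y N b' K = c * m K := by
  choose b₀ hb₀ b₁ hb₁ using fun K => exists_casimir_decomp (b K)
  have hmem : ∀ K, kd y N b₀ K ∈ polInv α β := fun K =>
    sum_mem fun j _ => zsmul_mem (mul_mem (pow_mem (hy j) N) (hb₀ _)) _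
  have hcas : ∀ K, kd y N (fun J => casimir (b₁ J)) K = casimir (kd y N b₁ K) := by
    intro K
    simp only [kd, map_sum, map_zsmul, smul_eq_mul]
    exact Finset.sum_congr rfl fun j _ => by rw [casimir_mul_inv (pow_mem (hy j) N)]
  have h1 : ∀ K, casimir (m K - kd y N b₁ K) = kd y N b₀ K := by
    intro K
    rw [map_sub, ← hb, ← hcas, sub_eq_iff_eq_add, ← kd_add]
    exact kd_congr y N fun j _ => hb₁ _
  have h2 : ∀ K, m K - kd y N b₁ K ∈ polInv α β := fun K =>
    casimir_eq_zero_iff.1 (casimir_casimir (by rw [h1]; exact casimir_of_inv (hmem K)))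
  set m₀ := kproj q (fun K => m K - kd y N b₁ K) with hm₀
  obtain ⟨b₂, hb₂⟩ := hex m₀ (fun K => by
      rw [hm₀, kproj]
      split_ifs
      · exact h2 K
      · exact zero_mem _) (kproj_ne q _) (fun K => by
      rw [hm₀, kd_kproj, kproj]
      split_ifs
      · rw [kd_sub, hd, kd_kd, sub_zero]
      · rfl)
  obtain ⟨b₃, hb₃⟩ := exists_kd_eq_kproj y N q b₁
  refine ⟨fun K => b₂ K + c • b₃ K, fun K => ?_⟩
  rw [kd_add, kd_smul, hb₂, hb₃, smul_eq_mul, ← mul_add, hm₀, kproj, kproj]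
  split_ifs with h
  · rw [sub_add_cancel]
  · rw [hm K h, add_zero]

variable {K : Type} [Field K] [Algebra (MvPolynomial (α × β) ℚ) K]
  [IsFractionRing (MvPolynomial (α × β) ℚ) K] [Algebra ℚ K]
  [IsScalarTower ℚ (MvPolynomial (α × β) ℚ) K] {D : α × β → Derivation ℚ K K}

/-- The polarization operators on fractions. -/
noncomputable def fracPol (D : α × β → Derivation ℚ K K) (a b : α) (c : Finset ι → K) (J : Finset ι) : K :=
  ∑ l : β, (X (a, l) : MvPolynomial (α × β) ℚ) • D (b, l) (c J)

theorem HasNum.fracPol (hD : ∀ i (f : MvPolynomial (α × β) ℚ),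
    D i (algebraMap (MvPolynomial (α × β) ℚ) K f) =
      algebraMap (MvPolynomial (α × β) ℚ) K (pderiv i f))
    (hy : ∀ j, y j ∈ polInv α β) {N : ℕ} {c : Finset ι → K}
    {m : Finset ι → MvPolynomial (α × β) ℚ} (h : HasNum y N c m) {a b : α} (hab : a ≠ b) :
    HasNum y N (fracPol D a b c) (fun J => pol a b (m J)) := by
  intro J
  have hP : (∏ j ∈ J, y j) ^ N ∈ polInv α β := pow_mem (prod_mem fun j _ => hy j) _
  have h1 := h J
  rw [kphi] at h1 ⊢
  set P := (∏ j ∈ J, y j) ^ N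
  have h2 : ∀ l, P • D (b, l) (c J) = algebraMap (MvPolynomial (α × β) ℚ) K (pderiv (b, l) (m J))
      - pderiv (b, l) P • c J := by
    intro l
    rw [← hD, ← h1, Algebra.smul_def, Algebra.smul_def P (c J), Derivation.leibniz, hD,
      smul_eq_mul, smul_eq_mul, Algebra.smul_def]
    ring
  have h3 := hP a b hab
  rw [pol_apply] at h3
  simp only [KoszulColim.fracPol, pol_apply, map_sum, map_mul]
  rw [Finset.smul_sum]
  have h4 : ∀ l, P • (X (a, l) : MvPolynomial (α × β) ℚ) • D (b, l) (c J)
      = algebraMap (MvPolynomial (α × β) ℚ) K (X (a, l)) *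
          algebraMap (MvPolynomial (α × β) ℚ) K (pderiv (b, l) (m J))
        - (X (a, l) * pderiv (b, l) P) • c J := by
    intro l
    rw [smul_comm, h2, smul_sub, Algebra.smul_def, mul_smul]
  rw [Finset.sum_congr rfl fun l _ => h4 l, Finset.sum_sub_distrib, ← Finset.sum_smul, h3,
    zero_smul, sub_zero]

theorem pderiv_comm {σ : Type} (i j : σ) (f : MvPolynomial σ ℚ) :
    pderiv i (pderiv j f) = pderiv j (pderiv i f) := by
  let d (l : σ) : Derivation ℚ (MvPolynomial σ ℚ) (MvPolynomial σ ℚ) := pderiv l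
  have h : ⁅d i, d j⁆ = 0 := by
    classical
    refine MvPolynomial.derivation_ext fun l => ?_
    simp only [d, Derivation.commutator_apply, pderiv_X]
    rw [Pi.single_apply, Pi.single_apply]
    split_ifs <;> simp
  have h1 := congrArg (fun d : Derivation ℚ (MvPolynomial σ ℚ) (MvPolynomial σ ℚ) => d f) h
  rwa [Derivation.commutator_apply, Derivation.zero_apply, sub_eq_zero] at h1

theorem KV.of_forall_X_torsion_of_frac (hD : ∀ i (f : MvPolynomial (α × β) ℚ),
      D i (algebraMap (MvPolynomial (α × β) ℚ) K f) =
        algebraMap (MvPolynomial (α × β) ℚ) K (pderiv i f))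
    (hy : ∀ j, y j ∈ polInv α β) (hy0 : ∀ j, y j ≠ 0)
    {c : MvPolynomial (α × β) ℚ} (hc : c ∈ polInv α β) (hc0 : c ≠ 0) {q : ℕ}
    (hex : ∀ N, ∀ m : Finset ι → MvPolynomial (α × β) ℚ, (∀ K, m K ∈ polInv α β) →
      (∀ K, K.card ≠ q → m K = 0) → (∀ K, kd y N m K = 0) → ∃ b, ∀ K, kd y N b K = c * m K)
    (htors : ∀ i N, ∀ m : Finset ι → MvPolynomial (α × β) ℚ, (∀ K, K.card ≠ q → m K = 0) →
      (∀ K, kd y N m K = 0) → ∃ n k b, ∀ K, kd y (N + k) b K =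
        (X i ^ n : MvPolynomial (α × β) ℚ) • kphi y k m K) :
    KV y (MvPolynomial (α × β) ℚ) q := by
  refine KV.of_frac (K := K) hy0 fun w hw => ?_
  let B := fracCoboundary K y
  choose DQ hDQ' using fun i : α × β => exists_quotient_map B
    ((D i).toLinearMap.compLeft (Finset ι))
    (fun c hc => derivation_mem_fracCoboundary (hD i) hc)
  have hDQ : ∀ i c, DQ i (B.mkQ c) = B.mkQ (fun J => D i (c J)) := hDQ'
  let E : α → α → (Finset ι → K) ⧸ B → (Finset ι → K) ⧸ B := fun a b w =>
    ∑ l, (X (a, l) : MvPolynomial (α × β) ℚ) • DQ (b, l) w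
  have hEQ : ∀ a b c, E a b (B.mkQ c) = B.mkQ (fracPol D a b c) := by
    intro a b c
    simp only [E, hDQ, ← map_smul, ← map_sum]
    congr 1
    ext J
    simp [fracPol, Finset.sum_apply]
  have key := eq_bot_of_casimir DQ (fun i j h => ?_) (fun i f h => ?_)
    ((fracCocycle K y q).map B.mkQ) ?_ ?_ hc hc0 E (fun a b w => rfl) ?_ (B.mkQ w) ⟨w, hw, rfl⟩
  · exact (Submodule.Quotient.mk_eq_zero B).1 key
  · obtain ⟨c, rfl⟩ := B.mkQ_surjective h
    rw [hDQ, hDQ, hDQ, hDQ]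
    congr 1
    ext J
    refine derivation_frac_comm (hD i) (hD j) (fun f => ?_) _
    exact pderiv_comm i j f
  · obtain ⟨c, rfl⟩ := B.mkQ_surjective h
    rw [← map_smul, hDQ, hDQ, ← map_smul, ← map_smul, ← map_add]
    congr 1
    ext J
    simp only [Pi.smul_apply, Pi.add_apply]
    rw [Algebra.smul_def, Derivation.leibniz, hD, smul_eq_mul, smul_eq_mul, Algebra.smul_def,
      Algebra.smul_def]
    ring
  · rintro i _ ⟨c, hc, rfl⟩
    exact ⟨_, derivation_mem_fracCocycle (hD i) hc, (hDQ i c).symm⟩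
  · rintro i _ ⟨z, hz, rfl⟩
    obtain ⟨⟨N, m, h⟩, h2, h3⟩ := hz
    obtain ⟨n, k, b, hb⟩ := htors i N m ((h.deg hy0).1 h2) ((h.cocycle_iff hy0).1 h3)
    refine ⟨n, ?_⟩
    rw [← map_smul]
    refine (Submodule.Quotient.mk_eq_zero B).2 (((h.smul _).mem_fracCoboundary hy0).2
      ⟨k, b, fun J => ?_⟩)
    rw [hb, kphi, kphi, Pi.smul_apply, smul_comm]
  · rintro _ ⟨z, hz, rfl⟩ h0
    obtain ⟨⟨N, m, h⟩, h2, h3⟩ := hz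
    simp only [hEQ, ← map_sum] at h0
    have h4 : HasNum y N (∑ p ∈ (Finset.univ : Finset α).offDiag,
        fracPol D p.2 p.1 (fracPol D p.1 p.2 z)) (fun J => casimir (m J)) := by
      intro J
      have h5 : ∀ p ∈ (Finset.univ : Finset α).offDiag, kphi y N
          (fracPol D p.2 p.1 (fracPol D p.1 p.2 z)) J
            = algebraMap (MvPolynomial (α × β) ℚ) K (pol p.2 p.1 (pol p.1 p.2 (m J))) := by
        intro p hp
        have hp' := (Finset.mem_offDiag.1 hp).2.2
        exact (h.fracPol hD hy hp').fracPol hD hy hp'.symm J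
      show _ = algebraMap (MvPolynomial (α × β) ℚ) K (casimir (m J))
      rw [casimir_apply, map_sum, ← Finset.sum_congr rfl h5]
      simp only [kphi, Finset.sum_apply, Finset.smul_sum]
    obtain ⟨k, b, hb⟩ := (h4.mem_fracCoboundary hy0).1 ((Submodule.Quotient.mk_eq_zero B).1 h0)
    have h6 := h.bump k
    obtain ⟨b', hb'⟩ := exists_kd_eq_mul_of_casimir hy (hex (N + k)) ((h6.deg hy0).1 h2)
      ((h6.cocycle_iff hy0).1 h3) (b := b) (fun J => by
        rw [hb, kphi, kphi, smul_eq_mul, smul_eq_mul,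
          casimir_mul_inv (pow_mem (prod_mem fun j _ => hy j) _)])
    rw [← map_smul]
    refine (Submodule.Quotient.mk_eq_zero B).2 (((h6.smul _).mem_fracCoboundary hy0).2
      ⟨0, b', fun J => ?_⟩)
    rw [add_zero, hb']
    simp [kphi]

/-- The vanishing of local cohomology when it is supported at the origin. -/
theorem KV.of_forall_X_torsion (hy : ∀ j, y j ∈ polInv α β) (hy0 : ∀ j, y j ≠ 0)
    {c : MvPolynomial (α × β) ℚ} (hc : c ∈ polInv α β) (hc0 : c ≠ 0) {q : ℕ}
    (hex : ∀ N, ∀ m : Finset ι → MvPolynomial (α × β) ℚ, (∀ K, m K ∈ polInv α β) →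
      (∀ K, K.card ≠ q → m K = 0) → (∀ K, kd y N m K = 0) → ∃ b, ∀ K, kd y N b K = c * m K)
    (htors : ∀ i N, ∀ m : Finset ι → MvPolynomial (α × β) ℚ, (∀ K, K.card ≠ q → m K = 0) →
      (∀ K, kd y N m K = 0) → ∃ n k b, ∀ K, kd y (N + k) b K =
        (X i ^ n : MvPolynomial (α × β) ℚ) • kphi y k m K) :
    KV y (MvPolynomial (α × β) ℚ) q := by
  choose D hD using fun i : α × β =>
    exists_derivation_extend (K := FractionRing (MvPolynomial (α × β) ℚ))
      (pderiv i : Derivation ℚ (MvPolynomial (α × β) ℚ) _)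
  exact KV.of_forall_X_torsion_of_frac hD hy hy0 hc hc0 hex htors

end Polarization

end KoszulColim

namespace KoszulColim

open MvPolynomial

section Minors

variable {L : Type} [Field L] {r s : ℕ}

theorem forall_det_submatrix_eq_zero_iff (A : Matrix (Fin r) (Fin s) L) :
    (∀ τ : Fin r → Fin s, (A.submatrix id τ).det = 0) ↔ ∃ v ≠ 0, Matrix.vecMul v A = 0 := by
  constructor
  · intro h
    by_contra! hv
    have hinj : LinearMap.ker A.vecMulLinear = ⊥ := by
      rw [LinearMap.ker_eq_bot']
      intro v h0
      by_contra hne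
      exact hv v hne h0
    obtain ⟨g, hg⟩ := LinearMap.exists_leftInverse_of_injective A.vecMulLinear hinj
    let B : Matrix (Fin s) (Fin r) L := Matrix.of fun m j => g (Pi.single m 1) j
    have hB : A * B = 1 := by
      ext i j
      have h1 := congrFun (LinearMap.congr_fun hg (Pi.single i 1)) j
      rw [LinearMap.comp_apply, Matrix.vecMulLinear_apply, Matrix.single_one_vecMul,
        LinearMap.id_apply, pi_eq_sum_univ' (A.row i), map_sum, Finset.sum_apply] at h1
      rw [Matrix.mul_apply, Matrix.one_apply]
      refine Eq.trans ?_ (h1.trans ?_)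
      · refine Finset.sum_congr rfl fun m _ => ?_
        rw [map_smul]
        rfl
      · simp [Pi.single_apply, eq_comm]
    have h2 : (A * B).transpose = fun j => ∑ m, B m j • A.transpose m := by
      ext j i
      simp [Matrix.mul_apply, mul_comm]
    have h3 : (A * B).transpose.det = 0 := by
      rw [h2]
      refine (Matrix.detRowAlternating.toMultilinearMap.map_sum _).trans
        (Finset.sum_eq_zero fun τ _ => ?_)
      rw [MultilinearMap.map_smul_univ]
      have h4 : Matrix.det (fun j => A.transpose (τ j)) = 0 := by
        rw [← h τ, ← Matrix.det_transpose]
        rfl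
      exact (congrArg _ h4).trans (smul_zero _)
    rw [Matrix.det_transpose, hB, Matrix.det_one] at h3
    exact one_ne_zero h3
  · rintro ⟨v, hv, h⟩ τ
    refine Matrix.exists_vecMul_eq_zero_iff.1 ⟨v, hv, ?_⟩
    ext j
    exact congrFun h (τ j)

theorem exists_vecMul_schur (A : Matrix (Fin (r + 1)) (Fin (s + 1)) L) (a : Fin (r + 1))
    (l : Fin (s + 1)) (h : A a l ≠ 0) (B : Matrix (Fin r) (Fin s) L)
    (hB : ∀ i m, A a l * B i m = A a l * A (a.succAbove i) (l.succAbove m)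
      - A (a.succAbove i) l * A a (l.succAbove m)) :
    (∃ v ≠ 0, Matrix.vecMul v A = 0) ↔ ∃ w ≠ 0, Matrix.vecMul w B = 0 := by
  have key : ∀ w m, A a l * Matrix.vecMul w B m =
      A a l * (∑ i, w i * A (a.succAbove i) (l.succAbove m))
        - (∑ i, w i * A (a.succAbove i) l) * A a (l.succAbove m) := by
    intro w m
    rw [Matrix.vecMul_eq_sum, Finset.sum_apply, Finset.mul_sum, Finset.mul_sum, Finset.sum_mul,
      ← Finset.sum_sub_distrib]
    refine Finset.sum_congr rfl fun i _ => ?_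
    simp only [Pi.smul_apply, smul_eq_mul]
    linear_combination w i * hB i m
  have hA : ∀ v j, Matrix.vecMul v A j = v a * A a j
      + ∑ i, v (a.succAbove i) * A (a.succAbove i) j := by
    intro v j
    rw [Matrix.vecMul_eq_sum, Finset.sum_apply, Fin.sum_univ_succAbove _ a]
    rfl
  constructor
  · rintro ⟨v, hv, h0⟩
    have h1 := fun j => (hA v j).symm.trans (congrFun h0 j)
    refine ⟨fun i => v (a.succAbove i), fun hw => hv ?_, ?_⟩
    · have hw' : ∀ i, v (a.succAbove i) = 0 := congrFun hw
      have h2 := h1 l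
      simp only [hw', zero_mul, Finset.sum_const_zero, add_zero, Pi.zero_apply] at h2
      ext i
      rcases Fin.eq_self_or_eq_succAbove a i with rfl | ⟨i, rfl⟩
      · exact (mul_eq_zero.1 h2).resolve_right h
      · exact hw' i
    · ext m
      have h2 := h1 l
      have h3 := h1 (l.succAbove m)
      simp only [Pi.zero_apply] at h2 h3
      have := key (fun i => v (a.succAbove i)) m
      refine (mul_eq_zero.1 (this.trans ?_)).resolve_left h
      linear_combination A a l * h3 - A a (l.succAbove m) * h2
  · rintro ⟨w, hw, h0⟩
    refine ⟨a.insertNth (-(∑ i, w i * A (a.succAbove i) l) / A a l) w, fun hv => hw ?_, ?_⟩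
    · ext i
      have := congrFun hv (a.succAbove i)
      rwa [Fin.insertNth_apply_succAbove] at this
    · ext j
      rw [hA]
      simp only [Fin.insertNth_apply_same, Fin.insertNth_apply_succAbove, Pi.zero_apply]
      rcases Fin.eq_self_or_eq_succAbove l j with rfl | ⟨m, rfl⟩
      · field_simp
        ring
      · have h1 := key w m
        rw [h0, Pi.zero_apply, mul_zero] at h1
        field_simp
        linear_combination -h1

theorem radical_span_eq {S κ κ' : Type} [CommRing S] (f : κ → S) (g : κ' → S)
    (h : ∀ P : Ideal S, P.IsPrime → ((∀ j, f j ∈ P) ↔ ∀ j, g j ∈ P)) :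
    (Ideal.span (Set.range f)).radical = (Ideal.span (Set.range g)).radical := by
  rw [Ideal.radical_eq_sInf, Ideal.radical_eq_sInf]
  congr 1
  ext P
  simp only [Set.mem_ofPred_eq, Ideal.span_le, Set.range_subset_iff]
  exact and_congr_left fun hP => h P hP

/-- Schur complements preserve the radical of the ideal of maximal minors. -/
theorem radical_span_minors_schur {S : Type} [CommRing S]
    (φ : MvPolynomial (Fin (r + 1) × Fin (s + 1)) ℚ →+* S) (φ' : MvPolynomial (Fin r × Fin s) ℚ →+* S)
    (a : Fin (r + 1)) (l : Fin (s + 1)) (hu : IsUnit (φ (X (a, l))))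
    (h : ∀ i m, φ (X (a, l)) * φ' (X (i, m)) =
      φ (X (a, l)) * φ (X (a.succAbove i, l.succAbove m))
        - φ (X (a.succAbove i, l)) * φ (X (a, l.succAbove m))) :
    (Ideal.span (Set.range fun τ : Fin (r + 1) → Fin (s + 1) => φ (minor ℚ τ))).radical =
      (Ideal.span (Set.range fun τ : Fin r → Fin s => φ' (minor ℚ τ))).radical := by
  refine radical_span_eq _ _ fun P hP => ?_
  let ψ := algebraMap S P.ResidueField
  have hψ : ∀ z, z ∈ P ↔ ψ z = 0 := fun z => Ideal.algebraMap_residueField_eq_zero.symm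
  let A : Matrix (Fin (r + 1)) (Fin (s + 1)) P.ResidueField :=
    Matrix.of fun i j => ψ (φ (X (i, j)))
  let B : Matrix (Fin r) (Fin s) P.ResidueField := Matrix.of fun i j => ψ (φ' (X (i, j)))
  have h1 : ∀ τ : Fin (r + 1) → Fin (s + 1), φ (minor ℚ τ) ∈ P ↔ (A.submatrix id τ).det = 0 :=
    fun τ => by
      rw [hψ]
      exact Eq.congr_left (eval_minor (ψ.comp φ) τ)
  have h2 : ∀ τ : Fin r → Fin s, φ' (minor ℚ τ) ∈ P ↔ (B.submatrix id τ).det = 0 :=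
    fun τ => by
      rw [hψ]
      exact Eq.congr_left (eval_minor (ψ.comp φ') τ)
  simp only [h1, h2]
  rw [forall_det_submatrix_eq_zero_iff, forall_det_submatrix_eq_zero_iff]
  refine exists_vecMul_schur A a l (hu.map ψ).ne_zero B fun i m => ?_
  have h3 := congrArg ψ (h i m)
  rw [map_sub, map_mul, map_mul, map_mul] at h3
  exact h3

theorem radical_span_map {S S' κ κ' : Type} [CommRing S] [CommRing S'] (φ : S →+* S') {f : κ → S}
    {g : κ' → S}
    (h : (Ideal.span (Set.range f)).radical = (Ideal.span (Set.range g)).radical) :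
    (Ideal.span (Set.range fun j => φ (f j))).radical =
      (Ideal.span (Set.range fun j => φ (g j))).radical := by
  refine radical_span_eq _ _ fun P hP => ?_
  have key : ∀ {κ₁ : Type} (f₁ : κ₁ → S),
      (∀ j, φ (f₁ j) ∈ P) ↔ (Ideal.span (Set.range f₁)).radical ≤ P.comap φ := by
    intro κ₁ f₁
    rw [(hP.comap φ).isRadical.radical_le_iff, Ideal.span_le, Set.range_subset_iff]
    rfl
  rw [key, key, h]

end Minors

section Rename

variable {σ σ' ι k : Type} [Field k] [LinearOrder ι] [Fintype ι]

theorem KV.rename {f : σ' → σ} (hf : Function.Injective f) {y : ι → MvPolynomial σ' k} {q : ℕ}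
    (h : KV y (MvPolynomial σ' k) q) :
    KV (fun j => MvPolynomial.rename f (y j)) (MvPolynomial σ k) q := by
  classical
  let C := ((Set.range f)ᶜ : Set σ)
  let e : C ⊕ σ' ≃ σ := (Equiv.sumComm _ _).trans
    (((Equiv.ofInjective f hf).sumCongr (Equiv.refl _)).trans (Equiv.Set.sumCompl (Set.range f)))
  let E := (sumAlgEquiv k C σ').symm.trans (renameEquiv k e)
  have h1 := (h.free (R' := MvPolynomial C (MvPolynomial σ' k))).ringEquiv E.toRingEquiv
  have h2 : (MvPolynomial.rename f : MvPolynomial σ' k →ₐ[k] MvPolynomial σ k).toRingHom =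
      E.toRingEquiv.toRingHom.comp (algebraMap (MvPolynomial σ' k) (MvPolynomial C _)) := by
    refine ringHom_ext (fun c => ?_) fun i => ?_
    · simp [E, MvPolynomial.algebraMap_eq]
    · simp [E, e, MvPolynomial.algebraMap_eq]
      rfl
  have h3 : (fun j => MvPolynomial.rename f (y j)) = fun j => E.toRingEquiv
      (algebraMap (MvPolynomial σ' k) (MvPolynomial C (MvPolynomial σ' k)) (y j)) :=
    funext fun j => RingHom.congr_fun h2 (y j)
  rw [h3]
  exact h1

end Rename

section Shear

variable {r s : ℕ} (a : Fin (r + 1)) (l : Fin (s + 1)) (S : Type) [CommRing S]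
  [Algebra (MvPolynomial (Fin (r + 1) × Fin (s + 1)) ℚ) S]
  [IsLocalization.Away (X (a, l) : MvPolynomial (Fin (r + 1) × Fin (s + 1)) ℚ) S]

/-- Adding `u X (i, l) X (a, j) / X (a, l)` to the entries `X (i, j)` outside the cross of
`(a, l)`. -/
noncomputable def shear (u : S) : MvPolynomial (Fin (r + 1) × Fin (s + 1)) ℚ →+* S :=
  eval₂Hom ((algebraMap (MvPolynomial (Fin (r + 1) × Fin (s + 1)) ℚ) S).comp C) fun p =>
    algebraMap (MvPolynomial (Fin (r + 1) × Fin (s + 1)) ℚ) S (X p) +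
      if p.1 = a ∨ p.2 = l then 0 else
        u * algebraMap (MvPolynomial (Fin (r + 1) × Fin (s + 1)) ℚ) S (X (p.1, l) * X (a, p.2)) *
          IsLocalization.Away.invSelf (X (a, l) : MvPolynomial (Fin (r + 1) × Fin (s + 1)) ℚ)

theorem shear_X (u : S) (p : Fin (r + 1) × Fin (s + 1)) :
    shear a l S u (X p) = algebraMap (MvPolynomial (Fin (r + 1) × Fin (s + 1)) ℚ) S (X p) +
      if p.1 = a ∨ p.2 = l then 0 else
        u * algebraMap (MvPolynomial (Fin (r + 1) × Fin (s + 1)) ℚ) S (X (p.1, l) * X (a, p.2)) *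
          IsLocalization.Away.invSelf (X (a, l) : MvPolynomial (Fin (r + 1) × Fin (s + 1)) ℚ) :=
  eval₂Hom_X' _ _ _

theorem shear_C (u : S) (c : ℚ) :
    shear a l S u (C c) = algebraMap (MvPolynomial (Fin (r + 1) × Fin (s + 1)) ℚ) S (C c) :=
  eval₂Hom_C _ _ _

theorem isUnit_shear (u : S) : IsUnit (shear a l S u (X (a, l))) := by
  rw [shear_X, if_pos (Or.inl rfl), add_zero]
  exact IsLocalization.Away.algebraMap_isUnit _

/-- The extension of `shear` to the localization. -/
noncomputable def shearLift (u : S) : S →+* S :=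
  IsLocalization.Away.lift (X (a, l) : MvPolynomial (Fin (r + 1) × Fin (s + 1)) ℚ)
    (isUnit_shear a l S u)

theorem shearLift_algebraMap (u : S) (f : MvPolynomial (Fin (r + 1) × Fin (s + 1)) ℚ) :
    shearLift a l S u (algebraMap _ S f) = shear a l S u f :=
  IsLocalization.Away.lift_eq _ _ _

theorem shearLift_invSelf (u : S) :
    shearLift a l S u (IsLocalization.Away.invSelf
      (X (a, l) : MvPolynomial (Fin (r + 1) × Fin (s + 1)) ℚ)) =
      IsLocalization.Away.invSelf (X (a, l) : MvPolynomial (Fin (r + 1) × Fin (s + 1)) ℚ) := by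
  have h1 := IsLocalization.Away.mul_invSelf (S := S)
    (X (a, l) : MvPolynomial (Fin (r + 1) × Fin (s + 1)) ℚ)
  have h2 := congrArg (shearLift a l S u) h1
  rw [map_mul, shearLift_algebraMap, shear_X, if_pos (Or.inl rfl), add_zero, map_one] at h2
  exact (IsLocalization.Away.algebraMap_isUnit (S := S)
    (X (a, l) : MvPolynomial (Fin (r + 1) × Fin (s + 1)) ℚ)).mul_left_cancel (h2.trans h1.symm)

theorem shearLift_comp {u v : S} (huv : u + v = 0)
    (hv : shearLift a l S u v = v) :
    (shearLift a l S u).comp (shearLift a l S v) = RingHom.id S := by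
  refine IsLocalization.ringHom_ext
    (Submonoid.powers (X (a, l) : MvPolynomial (Fin (r + 1) × Fin (s + 1)) ℚ)) ?_
  refine MvPolynomial.ringHom_ext (fun c => ?_) fun p => ?_
  · simp only [RingHom.comp_apply, shearLift_algebraMap, shear_C, RingHom.id_apply]
  · simp only [RingHom.comp_apply, shearLift_algebraMap, RingHom.id_apply]
    rw [shear_X a l S v, map_add, shearLift_algebraMap, shear_X a l S u]
    split_ifs with h
    · simp
    · rw [map_mul (shearLift a l S u), map_mul (shearLift a l S u), hv, shearLift_invSelf,
        shearLift_algebraMap, map_mul (shear a l S u), shear_X, shear_X,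
        if_pos (Or.inr rfl), if_pos (Or.inl rfl), add_zero, add_zero, map_mul]
      linear_combination (algebraMap (MvPolynomial (Fin (r + 1) × Fin (s + 1)) ℚ) S (X (p.1, l)) *
        algebraMap (MvPolynomial (Fin (r + 1) × Fin (s + 1)) ℚ) S (X (a, p.2)) *
          IsLocalization.Away.invSelf
            (X (a, l) : MvPolynomial (Fin (r + 1) × Fin (s + 1)) ℚ)) * huv

/-- The automorphism `X (i, j) ↦ X (i, j) - X (i, l) X (a, j) / X (a, l)`. -/
noncomputable def shearEquiv : S ≃+* S :=
  RingEquiv.ofRingHom (shearLift a l S (-1)) (shearLift a l S 1)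
    (shearLift_comp a l S (by ring) (by simp)) (shearLift_comp a l S (by ring) (by simp))

end Shear

theorem kv_hsop_localization_iff {r s : ℕ} (a : Fin (r + 1)) (l : Fin (s + 1)) (S : Type) [CommRing S]
    [Algebra (MvPolynomial (Fin (r + 1) × Fin (s + 1)) ℚ) S]
    [IsLocalization.Away (X (a, l) : MvPolynomial (Fin (r + 1) × Fin (s + 1)) ℚ) S]
    [IsDomain S] [IsNoetherianRing S] (q : ℕ) :
    KV (fun j => algebraMap (MvPolynomial (Fin (r + 1) × Fin (s + 1)) ℚ) S
      (hsop ℚ (r + 1) (s + 1) j)) S q ↔ KV (hsop ℚ r s) (MvPolynomial (Fin r × Fin s) ℚ) q := by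
  let f : Fin r × Fin s → Fin (r + 1) × Fin (s + 1) := fun p => (a.succAbove p.1, l.succAbove p.2)
  have hf : Function.Injective f := by
    rintro ⟨i, m⟩ ⟨i', m'⟩ h
    simpa [f] using h
  let A := algebraMap (MvPolynomial (Fin (r + 1) × Fin (s + 1)) ℚ) S
  let ρ : MvPolynomial (Fin r × Fin s) ℚ →+* MvPolynomial (Fin (r + 1) × Fin (s + 1)) ℚ :=
    (MvPolynomial.rename f).toRingHom
  let e := shearEquiv a l S
  have hρX : ∀ p, ρ (X p) = X (f p) := fun p => rename_X f p
  have heA : ∀ g, e (A g) = shear a l S (-1) g := shearLift_algebraMap a l S (-1)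
  have hrad : (Ideal.span (Set.range fun j => A (hsop ℚ (r + 1) (s + 1) j))).radical =
      (Ideal.span (Set.range fun j => e (A (ρ (hsop ℚ r s j))))).radical := by
    refine (radical_span_map A (radical_hsop ℚ)).symm.trans (Eq.trans ?_
      (radical_span_map ((e : S →+* S).comp (A.comp ρ)) (radical_hsop ℚ)))
    refine radical_span_minors_schur A ((e : S →+* S).comp (A.comp ρ)) a l
      (IsLocalization.Away.algebraMap_isUnit _) fun i m => ?_
    have h1 := IsLocalization.Away.mul_invSelf (S := S)
      (X (a, l) : MvPolynomial (Fin (r + 1) × Fin (s + 1)) ℚ)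
    show A (X (a, l)) * e (A (ρ (X (i, m)))) = _
    rw [hρX, heA, shear_X, if_neg (by simp [f, Fin.succAbove_ne]), map_mul]
    show A _ * (A _ + _) = _
    linear_combination (-A (X (a.succAbove i, l)) * A (X (a, l.succAbove m))) * h1
  rw [KV.congr_radical _ _ hrad]
  have hS : Submonoid.powers (X (a, l) : MvPolynomial (Fin (r + 1) × Fin (s + 1)) ℚ) ≤
      nonZeroDivisors _ := powers_le_nonZeroDivisors_of_noZeroDivisors (X_ne_zero _)
  constructor
  · intro h
    have h1 := h.ringEquiv e.symm
    simp only [RingEquiv.symm_apply_apply] at h1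
    let g : MvPolynomial (Fin (r + 1) × Fin (s + 1)) ℚ →+* MvPolynomial (Fin r × Fin s) ℚ :=
      (aeval fun p => if h : ∃ p', f p' = p then X h.choose else 1 :
        MvPolynomial (Fin (r + 1) × Fin (s + 1)) ℚ →ₐ[ℚ] _).toRingHom
    have hg : IsUnit (g (X (a, l))) := by
      have : g (X (a, l)) = 1 := by
        refine (aeval_X _ _).trans (dif_neg ?_)
        rintro ⟨p', hp'⟩
        exact Fin.succAbove_ne a _ (congrArg Prod.fst hp')
      rw [this]
      exact isUnit_one
    refine KV.of_ring_retract (A.comp ρ) (IsLocalization.Away.lift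
      (X (a, l) : MvPolynomial (Fin (r + 1) × Fin (s + 1)) ℚ) hg) (fun x => ?_) h1
    refine (IsLocalization.Away.lift_eq _ _ _).trans ?_
    have h2 : g.comp ρ = RingHom.id _ := by
      refine MvPolynomial.ringHom_ext (fun c => ?_) fun p => ?_
      · simp [g, ρ]
      · rw [RingHom.comp_apply, hρX]
        refine (aeval_X _ _).trans ?_
        have h3 : ∃ p', f p' = f p := ⟨p, rfl⟩
        rw [dif_pos h3, hf h3.choose_spec]
        rfl
    exact RingHom.congr_fun h2 x
  · intro h
    have h1 := KV.localization (R' := S) _ hS (h.rename hf)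
    exact h1.ringEquiv e

end KoszulColim

namespace KoszulColim

open MvPolynomial

theorem kv_of_eq_one {R : Type} [CommRing R] (q : ℕ) : KV (fun _ : Fin 1 => (1 : R)) R q := by
  have hset : ∀ K : Finset (Fin 1), K = ∅ ∨ K = {0} := by decide
  intro N m hm hd
  have h0 : m ∅ = 0 := by
    have := hd {0}
    rwa [kd_singleton, one_pow, one_smul] at this
  refine ⟨0, fun _ => m {0}, fun K => ?_⟩
  rcases hset K with rfl | rfl
  · rw [kd_empty, kphi_empty, h0]
  · rw [kd_singleton, one_pow, one_smul]
    simp [kphi]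

theorem kv_hsop_zero (s q : ℕ) : KV (hsop ℚ 0 s) (MvPolynomial (Fin 0 × Fin s) ℚ) q := by
  rw [KV.congr_radical (hsop ℚ 0 s) (fun _ : Fin 1 => (1 : MvPolynomial (Fin 0 × Fin s) ℚ))]
  · exact kv_of_eq_one q
  · rw [← radical_hsop]
    refine radical_span_eq _ _ fun P hP => ?_
    simp only [minor, Matrix.det_isEmpty, forall_const]

theorem kv_hsop_iff (r : ℕ) : ∀ s, r < s → ∀ q,
    KV (hsop ℚ r s) (MvPolynomial (Fin r × Fin s) ℚ) q ↔
      ¬ ∃ j, 1 ≤ j ∧ j ≤ r ∧ q = j * (s - r) + 1 := by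
  induction r with
  | zero =>
    intro s _ q
    refine iff_of_true (kv_hsop_zero s q) ?_
    rintro ⟨j, h1, h2, -⟩
    omega
  | succ r ih =>
    intro s hrs q
    obtain ⟨s, rfl⟩ : ∃ s', s = s' + 1 := ⟨s - 1, by omega⟩
    have ih' := ih s (by omega) q
    have hS : ∀ p : Fin (r + 1) × Fin (s + 1),
        Submonoid.powers (X p : MvPolynomial (Fin (r + 1) × Fin (s + 1)) ℚ) ≤ nonZeroDivisors _ :=
      fun p => powers_le_nonZeroDivisors_of_noZeroDivisors (X_ne_zero _)
    have hloc : ∀ a l, KV (fun j => algebraMap _ (Localization.Away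
        (X (a, l) : MvPolynomial (Fin (r + 1) × Fin (s + 1)) ℚ)) (hsop ℚ (r + 1) (s + 1) j))
        (Localization.Away (X (a, l) : MvPolynomial (Fin (r + 1) × Fin (s + 1)) ℚ)) q ↔
          KV (hsop ℚ r s) (MvPolynomial (Fin r × Fin s) ℚ) q := by
      intro a l
      have := IsLocalization.isDomain_localization (hS (a, l))
      have : IsNoetherianRing (Localization.Away
          (X (a, l) : MvPolynomial (Fin (r + 1) × Fin (s + 1)) ℚ)) :=
        IsLocalization.isNoetherianRing (Submonoid.powers
          (X (a, l) : MvPolynomial (Fin (r + 1) × Fin (s + 1)) ℚ)) _ inferInstance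
      exact kv_hsop_localization_iff a l _ q
    have hn : s + 1 - (r + 1) = s - r := by omega
    constructor
    · rintro h ⟨j, h1, h2, h3⟩
      rcases h2.eq_or_lt with rfl | h2
      · exact not_KV_hsop_top (Nat.succ_pos r) hrs.le (h3 ▸ h)
      · refine ih'.1 ((hloc 0 0).1 (h.localization _ (hS (0, 0)))) ⟨j, h1, by omega, ?_⟩
        rw [h3, hn]
    · intro h
      have hd : q ≠ (r + 1) * (s + 1 - (r + 1)) + 1 := fun hq => h ⟨r + 1, by omega, le_rfl, hq⟩
      rcases lt_or_gt_of_ne hd with hd | hd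
      · obtain ⟨c, hc, hc0, hex⟩ := exists_mul_hsop_exact (Nat.succ_pos r) hrs.le
        refine KV.of_forall_X_torsion hsop_mem_polInv
          (fun j => (algebraicIndependent_hsop (Nat.succ_pos r) hrs.le).ne_zero j) hc hc0
          (fun N m h1 h2 h3 => hex N q hd m h1 h2 h3) ?_
        rintro ⟨a, l⟩ N m hm hm'
        have h1 : KV (hsop ℚ r s) (MvPolynomial (Fin r × Fin s) ℚ) q :=
          ih'.2 fun ⟨j, h1, h2, h3⟩ => h ⟨j, h1, by omega, by rw [h3, hn]⟩
        obtain ⟨_, ⟨n, rfl⟩, k, b, hb⟩ :=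
          KV.exists_smul_of_localization _ (hS (a, l)) ((hloc a l).2 h1) N m hm hm'
        exact ⟨n, k, b, hb⟩
      · exact KV.of_card_lt _ (by rwa [Fintype.card_fin])

section BaseChange

variable (k : Type) [Field k] [CharZero k] (r s : ℕ)

attribute [local instance] algebraMvPolynomial

theorem kv_hsop_base_change_iff (q : ℕ) : KV (hsop k r s) (MvPolynomial (Fin r × Fin s) k) q ↔
    KV (hsop ℚ r s) (MvPolynomial (Fin r × Fin s) ℚ) q := by
  have : Module.Free (MvPolynomial (Fin r × Fin s) ℚ) (MvPolynomial (Fin r × Fin s) k) :=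
    IsBaseChange.free (Algebra.IsPushout.out (R := ℚ) (S := MvPolynomial (Fin r × Fin s) ℚ)
      (R' := k) (S' := MvPolynomial (Fin r × Fin s) k))
  have h : hsop k r s = fun j => algebraMap (MvPolynomial (Fin r × Fin s) ℚ)
      (MvPolynomial (Fin r × Fin s) k) (hsop ℚ r s j) := funext fun j => (map_hsop j).symm
  rw [h]
  exact ⟨KV.of_free, KV.free⟩

end BaseChange

theorem minorsIdeal_genericMatrix (k : Type) [Field k] (r s : ℕ) :
    minorsIdeal (genericMatrix k r s) r =
      Ideal.span (Set.range fun τ : Fin r → Fin s => minor k τ) := by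
  apply le_antisymm
  · refine Ideal.span_le.2 ?_
    rintro _ ⟨⟨p₁, p₂⟩, rfl⟩
    let e : Equiv.Perm (Fin r) := Equiv.ofBijective p₁ (Finite.injective_iff_bijective.1 p₁.injective)
    have h1 := Matrix.det_permute e ((genericMatrix k r s).submatrix id p₂)
    have h2 : ((genericMatrix k r s).submatrix p₁ p₂).det = _ := h1
    show ((genericMatrix k r s).submatrix p₁ p₂).det ∈ _
    rw [h2]
    exact Ideal.mul_mem_left _ _ (Ideal.subset_span ⟨p₂, rfl⟩)
  · refine Ideal.span_le.2 ?_
    rintro _ ⟨τ, rfl⟩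
    by_cases h : Function.Injective τ
    · exact Ideal.subset_span ⟨(Function.Embedding.refl _, ⟨τ, h⟩), rfl⟩
    · show minor k τ ∈ _
      rw [minor_eq_zero k h]
      exact zero_mem _

end KoszulColim

/-- Let `k` be a field of characteristic zero, `X` an `r × s` matrix of indeterminates
with `r < s`, `R = k[X]`, and `I = I_r(X)` the ideal of maximal minors.  Then
`H^i_I(R) ≠ 0` if and only if `i = (r−t)(s−r) + 1` for some `0 ≤ t < r`. -/
theorem stmt_15 {k : Type} [Field k] [CharZero k] (r s : ℕ) (hr : 0 < r) (hrs : r < s)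
    (i : ℕ) :
    ¬ Subsingleton
        ((localCohomology (minorsIdeal (genericMatrix k r s) r) i).obj
          (ModuleCat.of (detPolyRing k r s) (detPolyRing k r s)))
      ↔ ∃ t : ℕ, t < r ∧ i = (r - t) * (s - r) + 1 := by
  rw [KoszulColim.localCohomology_subsingleton_iff_KV _ (KoszulColim.hsop k r s)
    (by rw [KoszulColim.minorsIdeal_genericMatrix, KoszulColim.radical_hsop]),
    KoszulColim.kv_hsop_base_change_iff, KoszulColim.kv_hsop_iff r s hrs, not_not]
  constructor
  · rintro ⟨j, h1, h2, rfl⟩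
    exact ⟨r - j, by omega, by rw [Nat.sub_sub_self h2]⟩
  · rintro ⟨t, ht, rfl⟩
    exact ⟨r - t, by omega, by omega, rfl⟩
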